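/- arXiv:2010.09812 — 2 statements merged into one kernel-verified Lean document; each statement's English description precedes it below -/
import Mathlib

section
/- For any positive constants c₀ and δ, the set D = {α ∈ ℝ \ ℚ : for every n ∈ ℕ, the n-th continued fraction denominator qₙ of α is a prime number and q_{n+1} ≥ c₀·e^{δ·qₙ}} is uncountable. -/
open GenContFract in
lemma exists_tails_fin (N : ℕ) : ∀ a : ℕ → ℕ, (∀ n, 1 ≤ a n) →
    ∃ x : ℕ → ℝ, (∀ n, x n ∈ Set.Icc (0:ℝ) 1) ∧ ∀ n < N, x n * (a n + x (n + 1)) = 1 := by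
  induction N with
  | zero => exact fun a _ => ⟨fun _ => 0, fun n => by simp, fun n hn => by omega⟩
  | succ N ih =>
    intro a ha
    obtain ⟨x, hx, hx'⟩ := ih (fun n => a (n + 1)) (fun n => ha _)
    have h1 : (1:ℝ) ≤ a 0 + x 0 := by
      have := (hx 0).1
      have : (1:ℝ) ≤ a 0 := by exact_mod_cast ha 0
      linarith
    refine ⟨fun n => Nat.casesOn n ((a 0 + x 0)⁻¹) x, ?_, ?_⟩
    · rintro (_ | n)
      · exact ⟨inv_nonneg.2 (by linarith), inv_le_one_of_one_le₀ h1⟩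
      · exact hx n
    · rintro (_ | n) hn
      · exact inv_mul_cancel₀ (zero_lt_one.trans_le h1).ne'
      · exact hx' n (by omega)

lemma exists_tails (a : ℕ → ℕ) (ha : ∀ n, 1 ≤ a n) :
    ∃ x : ℕ → ℝ, (∀ n, x n ∈ Set.Icc (0:ℝ) 1) ∧ ∀ n, x n * (a n + x (n + 1)) = 1 := by
  have hK : IsCompact (Set.univ.pi (fun _ : ℕ => Set.Icc (0:ℝ) 1)) :=
    isCompact_univ_pi (fun _ => isCompact_Icc)
  let t : ℕ → Set (ℕ → ℝ) := fun N => Set.univ.pi (fun _ : ℕ => Set.Icc (0:ℝ) 1) ∩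
    ⋂ n, ⋂ (_ : n < N), {x | x n * (a n + x (n + 1)) = 1}
  have hcl : ∀ N, IsClosed (t N) := fun N => hK.isClosed.inter <|
    isClosed_iInter fun n => isClosed_iInter fun _ =>
      isClosed_eq (by fun_prop) (by fun_prop)
  obtain ⟨x, hx⟩ := IsCompact.nonempty_iInter_of_sequence_nonempty_isCompact_isClosed t
    (by
      rintro i x ⟨h1, h2⟩
      simp only [Set.mem_iInter] at h2
      refine ⟨h1, ?_⟩
      simp only [Set.mem_iInter]
      exact fun n hn => h2 n (by omega))
    (by
      intro N
      obtain ⟨x, h1, h2⟩ := exists_tails_fin N a ha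
      refine ⟨x, fun n _ => h1 n, ?_⟩
      simp only [Set.mem_iInter]
      exact h2)
    (hK.of_isClosed_subset (hcl 0) Set.inter_subset_left) hcl
  rw [Set.mem_iInter] at hx
  refine ⟨x, fun n => (hx 0).1 n trivial, fun n => ?_⟩
  have := (hx (n + 1)).2
  simp only [Set.mem_iInter] at this
  exact this n (by omega)

open GenContFract in
lemma exists_of_quotients (a : ℕ → ℕ) (ha : ∀ n, 1 ≤ a n) :
    ∃ α : ℝ, Irrational α ∧ ∀ n, (GenContFract.of α).s.get? n = some ⟨1, (a n : ℝ)⟩ := by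
  obtain ⟨x, hx, hxe⟩ := exists_tails a ha
  have hpos : ∀ n, 0 < x n := fun n => by
    rcases (hx n).1.eq_or_lt with h | h
    · have := hxe n
      rw [← h] at this
      simp at this
    · exact h
  have hlt : ∀ n, x n < 1 := fun n => by
    have h1 : (1:ℝ) ≤ a n := by exact_mod_cast ha n
    have := hxe n
    nlinarith [hpos n, hpos (n + 1), mul_pos (hpos n) (hpos (n + 1))]
  have hinv : ∀ n, IntFractPair.of (x n)⁻¹ = ⟨(a n : ℤ), x (n + 1)⟩ := fun n => by
    have h1 : (x n)⁻¹ = a n + x (n + 1) := inv_eq_of_mul_eq_one_right (hxe n)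
    have h2 : ⌊(x n)⁻¹⌋ = (a n : ℤ) := by
      rw [h1, Int.floor_eq_iff]
      push_cast
      constructor <;> linarith [hpos (n + 1), hlt (n + 1)]
    have h3 : Int.fract (x n)⁻¹ = x (n + 1) := by
      rw [Int.fract, h2, h1]; push_cast; ring
    simp [IntFractPair.of, h2, h3]
  have hst : ∀ n, ∃ b, IntFractPair.stream (x 0) n = some ⟨b, x n⟩ := by
    intro n
    induction n with
    | zero =>
      refine ⟨⌊x 0⌋, ?_⟩
      rw [IntFractPair.stream_zero, IntFractPair.of, Int.fract_eq_self.2 ⟨(hpos 0).le, hlt 0⟩]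
    | succ n ih =>
      obtain ⟨b, hb⟩ := ih
      exact ⟨a n, by rw [IntFractPair.stream_succ_of_some hb (hpos n).ne', hinv]⟩
  have hs : ∀ n, (GenContFract.of (x 0)).s.get? n = some ⟨1, (a n : ℝ)⟩ := by
    intro n
    obtain ⟨b, hb⟩ := hst n
    rw [get?_of_eq_some_of_get?_intFractPair_stream_fr_ne_zero hb (hpos n).ne', hinv]
    simp
  refine ⟨x 0, ?_, hs⟩
  rintro ⟨q, hq⟩
  obtain ⟨n, hn⟩ := (terminates_iff_rat (x 0)).2 ⟨q, hq.symm⟩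
  have := hs n
  rw [hn] at this
  cases this

lemma exists_step (B : ℝ) (u v : ℕ) (hv : 0 < v) (h : u.Coprime v) :
    ∃ a : ℕ, 1 ≤ a ∧ (a * v + u).Prime ∧ B < ((a * v + u : ℕ) : ℝ) ∧ v < a * v + u := by
  obtain ⟨p, hp, hpp, hm⟩ := Nat.forall_exists_prime_gt_and_modEq (⌈B⌉₊ + u + v) hv.ne' h
  obtain ⟨a, hA⟩ := (Nat.modEq_iff_dvd' (by omega : u ≤ p)).1 hm.symm
  have hpe : a * v + u = p := by rw [mul_comm]; omega
  refine ⟨a, ?_, by rwa [hpe], ?_, by omega⟩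
  · rcases Nat.eq_zero_or_pos a with h0 | h0
    · subst h0; omega
    · exact h0
  · rw [hpe]
    refine (Nat.le_ceil B).trans_lt ?_
    exact_mod_cast (by omega : ⌈B⌉₊ < p)

lemma exists_alpha (B : ℕ → ℝ → ℝ) : ∃ α : ℝ, Irrational α ∧
    ∀ n : ℕ, (∃ p : ℕ, p.Prime ∧ (GenContFract.of α).dens (n + 1) = (p : ℝ)) ∧
      B n ((GenContFract.of α).dens n) < (GenContFract.of α).dens (n + 1) := by
  have key : ∀ (n u v : ℕ), ∃ a : ℕ, 0 < v → u.Coprime v →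
      1 ≤ a ∧ (a * v + u).Prime ∧ B n v < ((a * v + u : ℕ) : ℝ) ∧ v < a * v + u := by
    intro n u v
    by_cases h : 0 < v ∧ u.Coprime v
    · obtain ⟨a, ha⟩ := exists_step (B n v) u v h.1 h.2
      exact ⟨a, fun _ _ => ha⟩
    · exact ⟨0, fun h1 h2 => (h ⟨h1, h2⟩).elim⟩
  choose A hA using key
  let st : ℕ → ℕ × ℕ := fun n =>
    Nat.rec (0, 1) (fun n s => (s.2, A n s.1 s.2 * s.2 + s.1)) n
  have hst : ∀ n, st (n + 1) = ((st n).2, A n (st n).1 (st n).2 * (st n).2 + (st n).1) :=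
    fun n => rfl
  have hinv : ∀ n, 0 < (st n).2 ∧ (st n).1.Coprime (st n).2 := by
    intro n
    induction n with
    | zero => simp [st]
    | succ n ih =>
      obtain ⟨_, h2, _, h4⟩ := hA n _ _ ih.1 ih.2
      rw [hst]
      exact ⟨h2.pos, (Nat.coprime_of_lt_prime ih.1.ne' h4 h2).symm⟩
  have hA' := fun n => hA n _ _ (hinv n).1 (hinv n).2
  obtain ⟨α, hirr, hs⟩ := exists_of_quotients (fun n => A n (st n).1 (st n).2)
    (fun n => (hA' n).1)
  have hc : ∀ n, ((GenContFract.of α).contsAux n).b = ((st n).1 : ℝ) ∧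
      ((GenContFract.of α).contsAux (n + 1)).b = ((st n).2 : ℝ) := by
    intro n
    induction n with
    | zero => simp [st, GenContFract.contsAux]
    | succ n ih =>
      refine ⟨ih.2, ?_⟩
      rw [GenContFract.contsAux_recurrence (hs n) rfl rfl, hst]
      simp [ih.1, ih.2]
  have hd : ∀ n, (GenContFract.of α).dens n = ((st n).2 : ℝ) := fun n => (hc n).2
  refine ⟨α, hirr, fun n => ?_⟩
  obtain ⟨_, h2, h3, _⟩ := hA' n
  rw [hd, hd]
  exact ⟨⟨_, h2, rfl⟩, h3⟩


/-- For any positive constants `c₀` and `δ`, the set of irrationals `α` all of whose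
continued fraction convergent denominators `qₙ` (for `n ≥ 1`) are prime and satisfy
`q_{n+1} ≥ c₀ · e^{δ · qₙ}` is uncountable. -/
theorem stmt_0 (c₀ δ : ℝ) (hc₀ : 0 < c₀) (hδ : 0 < δ) :
    ¬ ({α : ℝ | Irrational α ∧
        (∀ n : ℕ, ∃ p : ℕ, p.Prime ∧ (GenContFract.of α).dens (n + 1) = (p : ℝ)) ∧
        (∀ n : ℕ, (GenContFract.of α).dens (n + 1) ≥
          c₀ * Real.exp (δ * (GenContFract.of α).dens n))} : Set ℝ).Countable := by
  intro hc
  obtain ⟨f, hf⟩ := Set.countable_iff_exists_subset_range.1 hc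
  obtain ⟨α, h1, h2⟩ := exists_alpha (fun n q => max (c₀ * Real.exp (δ * q))
    ((GenContFract.of (f n)).dens (n + 1)))
  obtain ⟨n, hn⟩ := hf ⟨h1, fun n => (h2 n).1,
    fun n => ((le_max_left _ _).trans (h2 n).2.le)⟩
  have := (le_max_right _ _).trans_lt (h2 n).2
  rw [hn] at this
  exact lt_irrefl _ this
end

section
/- For every ε > 0 there exists x₀ such that for all real x ≥ x₀, every prime q with q < (log x)², and every integer a with 0 < a < q, one has |π(x; q, a) − Li(x)/(q−1)| ≤ ε·Li(x)/(q−1); that is, π(x; q, a) ∼ Li(x)/(q−1) uniformly over primes q < (log x)² and residues 0 < a < q. -/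
namespace SW
open MeasureTheory Set Filter Topology

/-- The tail Mellin integral. -/
noncomputable def tailInt (R : ℝ → ℂ) (s : ℂ) : ℂ := ∫ t in Ioi (1:ℝ), R t * (t:ℂ) ^ (-(s + 1))

lemma tailInt_eq_mellin (R : ℝ → ℂ) (s : ℂ) :
    tailInt R s = mellin ((Ioi (1:ℝ)).indicator R) (-s) := by
  unfold tailInt mellin
  have : ∀ t : ℝ, (t:ℂ) ^ (-s - 1) • (Ioi (1:ℝ)).indicator R t
      = (Ioi (1:ℝ)).indicator (fun t : ℝ => R t * (t:ℂ) ^ (-(s + 1))) t := by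
    intro t
    by_cases ht : t ∈ Ioi (1:ℝ)
    · simp only [indicator_of_mem ht, smul_eq_mul]
      rw [mul_comm]; congr 2; ring
    · simp [indicator_of_notMem ht]
  simp_rw [this]
  rw [setIntegral_indicator measurableSet_Ioi]
  congr 2
  ext t; simp only [mem_Ioi, mem_inter_iff]
  constructor
  · intro h; exact ⟨by linarith, h⟩
  · exact fun h => h.2

lemma tailInt_differentiableAt {R : ℝ → ℂ} (hR : Measurable R) {K r : ℝ}
    (hb : ∀ u : ℝ, 1 < u → ‖R u‖ ≤ K * u ^ r) {s : ℂ} (hs : r < s.re) :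
    DifferentiableAt ℂ (tailInt R) s := by
  have h1 : DifferentiableAt ℂ (mellin ((Ioi (1:ℝ)).indicator R)) (-s) := by
    apply mellin_differentiableAt_of_isBigO_rpow (a := -r) (b := -s.re - 1)
    · have hg : LocallyIntegrableOn (fun t : ℝ => K * t ^ r) (Ioi 0) := by
        apply ContinuousOn.locallyIntegrableOn _ measurableSet_Ioi
        apply ContinuousOn.mul continuousOn_const
        intro x hx
        exact (Real.continuousAt_rpow_const x r (Or.inl (ne_of_gt hx))).continuousWithinAt
      refine hg.mono (hR.indicator measurableSet_Ioi).aestronglyMeasurable ?_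
      refine Eventually.of_forall ?_
      intro t
      by_cases ht : t ∈ Ioi (1:ℝ)
      · rw [indicator_of_mem ht]; exact (hb t ht).trans (le_abs_self _)
      · rw [indicator_of_notMem ht]; simp only [norm_zero]; positivity
    · rw [neg_neg]
      refine Asymptotics.IsBigO.of_bound K ?_
      filter_upwards [eventually_gt_atTop 1] with t ht
      rw [indicator_of_mem (by exact ht), Real.norm_of_nonneg (by positivity)]
      exact hb t ht
    · simpa using hs
    · refine Asymptotics.IsBigO.of_bound 1 ?_
      have : ∀ᶠ t : ℝ in 𝓝[>] 0, t < 1 := by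
        apply nhdsWithin_le_nhds; exact eventually_lt_nhds (by norm_num)
      filter_upwards [this] with t ht
      rw [indicator_of_notMem (by simp [ht.le])]
      simp
    · simp
  have h2 : tailInt R = fun s => mellin ((Ioi (1:ℝ)).indicator R) (-s) := by
    funext s; exact tailInt_eq_mellin R s
  rw [h2]
  exact h1.comp s (differentiable_neg s)

lemma norm_tailInt_le {R : ℝ → ℂ} {K r : ℝ}
    (hb : ∀ u : ℝ, 1 < u → ‖R u‖ ≤ K * u ^ r) {s : ℂ} (hs : r < s.re) :
    ‖tailInt R s‖ ≤ K / (s.re - r) := by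
  unfold tailInt
  have hlt : r - s.re - 1 < -1 := by linarith
  have h_integ : IntegrableOn (fun t : ℝ => K * t ^ (r - s.re - 1)) (Ioi 1) :=
    (integrableOn_Ioi_rpow_of_lt hlt one_pos).const_mul K
  have := norm_integral_le_of_norm_le h_integ (f := fun t : ℝ => R t * (t:ℂ) ^ (-(s + 1))) (by
    refine (ae_restrict_iff' measurableSet_Ioi).2 (Eventually.of_forall ?_)
    intro t ht
    have ht1 : (1:ℝ) < t := ht
    have ht0 : 0 < t := by linarith
    rw [norm_mul, Complex.norm_cpow_eq_rpow_re_of_pos ht0]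
    calc ‖R t‖ * t ^ (-(s+1)).re ≤ (K * t ^ r) * t ^ (-(s+1)).re := by
          gcongr; exact hb t ht1
      _ = K * t ^ (r - s.re - 1) := by
          rw [mul_assoc, ← Real.rpow_add ht0]; congr 2; simp; ring)
  refine this.trans ?_
  rw [integral_const_mul, integral_Ioi_rpow_of_lt hlt one_pos]
  simp only [Real.one_rpow]
  have h0 : s.re - r ≠ 0 := by linarith
  apply le_of_eq
  have h1 : r - s.re - 1 + 1 ≠ 0 := by intro h; apply h0; linarith
  field_simp
  ring

/-- The partial sums of a character -/
noncomputable def charSum {N : ℕ} (χ : DirichletCharacter ℂ N) (u : ℝ) : ℂ :=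
  ∑ k ∈ Finset.Icc 1 ⌊u⌋₊, χ (k : ZMod N)

lemma charSum_measurable {N : ℕ} (χ : DirichletCharacter ℂ N) : Measurable (charSum χ) :=
  (measurable_from_nat (f := fun n : ℕ => ∑ k ∈ Finset.Icc 1 n, χ (k : ZMod N))).comp
    Nat.measurable_floor

lemma sum_range_char_period {N : ℕ} [NeZero N] {χ : DirichletCharacter ℂ N} (hχ : χ ≠ 1) (m : ℕ) :
    ∑ k ∈ Finset.range (N * m), χ (k : ZMod N) = 0 := by
  have h1 : ∑ k ∈ Finset.range N, χ (k : ZMod N) = 0 := by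
    rw [← MulChar.sum_eq_zero_of_ne_one hχ]
    apply Finset.sum_bij (fun (k : ℕ) _ => (k : ZMod N))
    · simp
    · intro a ha b hb hab
      rw [ZMod.natCast_eq_natCast_iff'] at hab
      rw [Nat.mod_eq_of_lt (Finset.mem_range.1 ha), Nat.mod_eq_of_lt (Finset.mem_range.1 hb)] at hab
      exact hab
    · intro b _
      exact ⟨b.val, Finset.mem_range.2 (ZMod.val_lt b), by simp⟩
    · simp
  induction m with
  | zero => simp
  | succ m ih =>
    rw [Nat.mul_succ, Finset.sum_range_add, ih, zero_add, ← h1]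
    apply Finset.sum_congr rfl
    intro k _
    simp

lemma norm_charSum_le_N {N : ℕ} [NeZero N] {χ : DirichletCharacter ℂ N} (hχ : χ ≠ 1) (u : ℝ) :
    ‖charSum χ u‖ ≤ N := by
  unfold charSum
  have h0 : χ ((0:ℕ) : ZMod N) = 0 := by
    have hN : N ≠ 1 := by
      rintro rfl
      exact hχ (Subsingleton.elim _ _)
    have : Nontrivial (ZMod N) := by
      rw [ZMod.nontrivial_iff]; exact hN
    rw [Nat.cast_zero]
    exact MulChar.map_zero χ
  set n := ⌊u⌋₊
  have h1 : ∑ k ∈ Finset.Icc 1 n, χ (k : ZMod N) = ∑ k ∈ Finset.range (n+1), χ (k : ZMod N) := by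
    rw [Finset.range_eq_Ico, Finset.sum_eq_sum_Ico_succ_bot (by omega), h0, zero_add]
    rfl
  rw [h1, ← Nat.div_add_mod (n+1) N, Finset.sum_range_add, sum_range_char_period hχ, zero_add]
  refine (norm_sum_le _ _).trans ?_
  refine (Finset.sum_le_sum (g := fun _ => (1:ℝ)) (fun k _ => χ.norm_le_one _)).trans ?_
  simp only [Finset.sum_const, Finset.card_range, nsmul_eq_mul, mul_one]
  exact_mod_cast (Nat.mod_lt _ (NeZero.pos N)).le

lemma norm_charSum_le_u {N : ℕ} (χ : DirichletCharacter ℂ N) {u : ℝ} (hu : 0 ≤ u) :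
    ‖charSum χ u‖ ≤ u := by
  unfold charSum
  refine (norm_sum_le _ _).trans ?_
  refine (Finset.sum_le_sum (g := fun _ => (1:ℝ)) (fun k _ => χ.norm_le_one _)).trans ?_
  simp only [Finset.sum_const, Nat.card_Icc, nsmul_eq_mul, mul_one, add_tsub_cancel_right]
  exact Nat.floor_le hu

lemma norm_charSum_le {N : ℕ} [NeZero N] {χ : DirichletCharacter ℂ N} (hχ : χ ≠ 1)
    {θ : ℝ} (h0 : 0 ≤ θ) (h1 : θ ≤ 1) {u : ℝ} (hu : 1 < u) :
    ‖charSum χ u‖ ≤ (N:ℝ) ^ θ * u ^ (1 - θ) := by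
  have hx := norm_nonneg (charSum χ u)
  have e : ‖charSum χ u‖ = ‖charSum χ u‖ ^ θ * ‖charSum χ u‖ ^ (1 - θ) := by
    rw [← Real.rpow_add_of_nonneg hx h0 (by linarith)]; simp
  rw [e]
  have hN := norm_charSum_le_N hχ u
  have hU := norm_charSum_le_u χ (u := u) (by linarith)
  gcongr

lemma LFunction_eq_tailInt {N : ℕ} [NeZero N] {χ : DirichletCharacter ℂ N} (hχ : χ ≠ 1)
    {s : ℂ} (hs : 0 < s.re) : DirichletCharacter.LFunction χ s = s * tailInt (charSum χ) s := by
  have hb : ∀ u : ℝ, 1 < u → ‖charSum χ u‖ ≤ (N:ℝ) * u ^ (0:ℝ) := by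
    intro u _; simpa using norm_charSum_le_N hχ u
  set U : Set ℂ := {z : ℂ | 0 < z.re}
  have hUo : IsOpen U := isOpen_lt continuous_const Complex.continuous_re
  have hUc : IsPreconnected U := (convex_halfSpace_re_gt 0).isPreconnected
  have hA : AnalyticOnNhd ℂ (DirichletCharacter.LFunction χ) U :=
    ((DirichletCharacter.differentiable_LFunction hχ).differentiableOn).analyticOnNhd hUo
  have hB : AnalyticOnNhd ℂ (fun s => s * tailInt (charSum χ) s) U := by
    apply DifferentiableOn.analyticOnNhd _ hUo
    intro z hz
    exact (differentiableAt_id.mul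
      (tailInt_differentiableAt (charSum_measurable χ) hb hz)).differentiableWithinAt
  refine hA.eqOn_of_preconnected_of_eventuallyEq hB hUc (z₀ := 2) (by simp [U]) ?_ hs
  have : ∀ᶠ z : ℂ in 𝓝 2, 1 < z.re :=
    (isOpen_lt continuous_const Complex.continuous_re).mem_nhds (by simp)
  filter_upwards [this] with z hz
  rw [DirichletCharacter.LFunction_eq_LSeries χ hz]
  rw [LSeries_eq_mul_integral _ zero_le_one hz
    (DirichletCharacter.LSeriesSummable_of_one_lt_re χ hz)]
  · rfl
  · refine Asymptotics.IsBigO.of_bound 1 ?_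
    filter_upwards with n
    have := norm_charSum_le_u χ (u := n) (by positivity)
    simpa [charSum] using this

theorem norm_LFunction_le {N : ℕ} [NeZero N] {χ : DirichletCharacter ℂ N} (hχ : χ ≠ 1)
    {θ : ℝ} (h0 : 0 ≤ θ) (h1 : θ ≤ 1) {s : ℂ} (hs : 1 - θ < s.re) :
    ‖DirichletCharacter.LFunction χ s‖ ≤ ‖s‖ * ((N:ℝ) ^ θ / (s.re - (1 - θ))) := by
  rw [LFunction_eq_tailInt hχ (by linarith), norm_mul]
  gcongr
  exact norm_tailInt_le (fun u hu => norm_charSum_le hχ h0 h1 hu) hs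

/-- Real characters have real L-values. -/
theorem LFunction_im_eq_zero {N : ℕ} [NeZero N] {χ : DirichletCharacter ℂ N} (hχ : χ ≠ 1)
    (h2 : χ ^ 2 = 1) {x : ℝ} (hx : 0 < x) : (DirichletCharacter.LFunction χ (x:ℂ)).im = 0 := by
  rw [← Complex.conj_eq_iff_im, LFunction_eq_tailInt hχ (by simpa using hx), map_mul,
    Complex.conj_ofReal]
  congr 1
  unfold tailInt
  rw [← integral_conj]
  apply setIntegral_congr_fun measurableSet_Ioi
  intro t ht
  have ht0 : (0:ℝ) ≤ t := by have : (1:ℝ) < t := ht; linarith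
  simp only [map_mul]
  congr 1
  · unfold charSum
    rw [map_sum]
    apply Finset.sum_congr rfl
    intro k _
    have hc : (χ⁻¹ : DirichletCharacter ℂ N) = χ := by
      rw [inv_eq_iff_mul_eq_one, ← sq, h2]
    have := MulChar.star_apply' χ (k : ZMod N)
    rw [hc] at this
    exact this
  · have : (-((x:ℂ) + 1)) = ((-(x+1) : ℝ) : ℂ) := by push_cast; ring
    rw [this, ← Complex.ofReal_cpow ht0, Complex.conj_ofReal]

/-- `(s-1) ζ(s)` as an entire function -/
noncomputable def Zf : ℂ → ℂ := DirichletCharacter.LFunctionTrivChar₁ 1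

lemma Zf_one : Zf 1 = 1 := by simp [Zf, DirichletCharacter.LFunctionTrivChar₁]

lemma Zf_of_ne {s : ℂ} (hs : s ≠ 1) : Zf s = (s - 1) * riemannZeta s := by
  simp [Zf, DirichletCharacter.LFunctionTrivChar₁, Function.update_of_ne hs,
    DirichletCharacter.LFunctionTrivChar]

lemma Zf_differentiable : Differentiable ℂ Zf := DirichletCharacter.differentiable_LFunctionTrivChar₁ 1

lemma Zf_eq_tailInt {s : ℂ} (hs : 0 < s.re) :
    Zf s = 1 + (s - 1) * (1 - s * tailInt (fun u => ((Int.fract u : ℝ) : ℂ)) s) := by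
  have hm : Measurable (fun u : ℝ => ((Int.fract u : ℝ) : ℂ)) :=
    Complex.measurable_ofReal.comp measurable_fract
  have hb : ∀ u : ℝ, 1 < u → ‖((Int.fract u : ℝ) : ℂ)‖ ≤ 1 * u ^ (0:ℝ) := by
    intro u _
    simp only [Complex.norm_real, Real.norm_eq_abs, Int.abs_fract, Real.rpow_zero, mul_one]
    exact (Int.fract_lt_one u).le
  set U : Set ℂ := {z : ℂ | 0 < z.re}
  have hUo : IsOpen U := isOpen_lt continuous_const Complex.continuous_re
  have hUc : IsPreconnected U := (convex_halfSpace_re_gt 0).isPreconnected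
  have hA : AnalyticOnNhd ℂ Zf U := (Zf_differentiable.differentiableOn).analyticOnNhd hUo
  have hB : AnalyticOnNhd ℂ
      (fun s => 1 + (s - 1) * (1 - s * tailInt (fun u => ((Int.fract u : ℝ) : ℂ)) s)) U := by
    apply DifferentiableOn.analyticOnNhd _ hUo
    intro z hz
    have := tailInt_differentiableAt hm hb hz
    apply DifferentiableAt.differentiableWithinAt
    fun_prop
  refine hA.eqOn_of_preconnected_of_eventuallyEq hB hUc (z₀ := 2) (by simp [U]) ?_ hs
  have : ∀ᶠ z : ℂ in 𝓝 2, 1 < z.re :=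
    (isOpen_lt continuous_const Complex.continuous_re).mem_nhds (by simp)
  filter_upwards [this] with z hz
  have hz1 : z ≠ 1 := by rintro rfl; simp at hz
  have hz1' : z - 1 ≠ 0 := sub_ne_zero.2 hz1
  rw [Zf_of_ne hz1, ← LSeries_one_eq_riemannZeta hz]
  rw [LSeries_eq_mul_integral _ zero_le_one hz (LSeriesSummable_one_iff.2 hz)]
  · have hi1 : IntegrableOn (fun t : ℝ => (t:ℂ) ^ (-z)) (Ioi 1) :=
      integrableOn_Ioi_cpow_of_lt (by simpa using hz) one_pos
    have hi2 : IntegrableOn (fun t : ℝ => ((Int.fract t : ℝ) : ℂ) * (t:ℂ) ^ (-(z+1))) (Ioi 1) := by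
      have h3 : IntegrableOn (fun t : ℝ => (t:ℂ) ^ (-(z+1))) (Ioi 1) :=
        integrableOn_Ioi_cpow_of_lt (by simp; linarith) one_pos
      refine Integrable.bdd_mul (c := 1) h3 hm.aestronglyMeasurable ?_
      filter_upwards with t
      simp only [Complex.norm_real, Real.norm_eq_abs, Int.abs_fract]
      exact (Int.fract_lt_one t).le
    have e : ∫ t in Ioi (1:ℝ), (∑ k ∈ Finset.Icc 1 ⌊t⌋₊, (1 : ℕ → ℂ) k) * (t:ℂ) ^ (-(z+1))
        = (∫ t in Ioi (1:ℝ), (t:ℂ) ^ (-z)) -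
          ∫ t in Ioi (1:ℝ), ((Int.fract t : ℝ) : ℂ) * (t:ℂ) ^ (-(z+1)) := by
      rw [← integral_sub hi1 hi2]
      apply setIntegral_congr_fun measurableSet_Ioi
      intro t ht
      have ht0 : (0:ℝ) < t := by have : (1:ℝ) < t := ht; linarith
      have ht0' : (t:ℂ) ≠ 0 := by exact_mod_cast ht0.ne'
      have e1 : (t:ℂ) ^ (-z) = t * (t:ℂ) ^ (-(z+1)) := by
        have : -z = 1 + -(z+1) := by ring
        rw [this, Complex.cpow_add _ _ ht0', Complex.cpow_one]
      simp only [Pi.one_apply, Finset.sum_const, Nat.card_Icc, add_tsub_cancel_right, nsmul_eq_mul,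
        mul_one]
      rw [e1, ← sub_mul]
      congr 1
      have : ((⌊t⌋₊ : ℝ)) = t - Int.fract t := by
        rw [Int.self_sub_fract, natCast_floor_eq_intCast_floor ht0.le]
      rw [← Complex.ofReal_sub, ← this]; simp
    rw [e, integral_Ioi_cpow_of_lt (by simpa using hz) one_pos]
    unfold tailInt
    have h5 : -z + 1 ≠ 0 := by intro h; apply hz1'; linear_combination -h
    simp only [Complex.ofReal_one, Complex.one_cpow]
    field_simp
    ring
  · refine Asymptotics.IsBigO.of_bound 1 ?_
    filter_upwards with n
    simp

lemma norm_Zf_sub_one_le {s : ℂ} (hs : 1/2 ≤ s.re) : ‖Zf s - 1‖ ≤ ‖s - 1‖ * (1 + 2 * ‖s‖) := by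
  rw [Zf_eq_tailInt (by linarith), add_sub_cancel_left, norm_mul]
  gcongr
  refine (norm_sub_le _ _).trans ?_
  rw [norm_one, norm_mul]
  have hb : ∀ u : ℝ, 1 < u → ‖((Int.fract u : ℝ) : ℂ)‖ ≤ 1 * u ^ (0:ℝ) := by
    intro u _
    simp only [Complex.norm_real, Real.norm_eq_abs, Int.abs_fract, Real.rpow_zero, mul_one]
    exact (Int.fract_lt_one u).le
  have h1 := norm_tailInt_le hb (s := s) (by linarith)
  have h2 : 1 / (s.re - 0) ≤ 2 := by
    rw [div_le_iff₀ (by linarith)]; linarith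
  have : ‖s‖ * ‖tailInt (fun u => ((Int.fract u : ℝ) : ℂ)) s‖ ≤ ‖s‖ * 2 := by
    gcongr; exact h1.trans h2
  linarith

lemma norm_zeta_le {s : ℂ} (hs : 1/2 ≤ s.re) (h1 : s ≠ 1) :
    ‖riemannZeta s‖ ≤ 1 / ‖s - 1‖ + (1 + 2 * ‖s‖) := by
  have h := norm_Zf_sub_one_le hs
  have h0 : 0 < ‖s - 1‖ := norm_pos_iff.2 (sub_ne_zero.2 h1)
  have h2 : ‖Zf s‖ ≤ 1 + ‖s - 1‖ * (1 + 2 * ‖s‖) := by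
    calc ‖Zf s‖ = ‖1 + (Zf s - 1)‖ := by ring_nf
      _ ≤ ‖(1:ℂ)‖ + ‖Zf s - 1‖ := norm_add_le _ _
      _ ≤ _ := by rw [norm_one]; linarith
  rw [Zf_of_ne h1, norm_mul] at h2
  rw [← mul_le_mul_iff_right₀ h0, mul_add, mul_one_div_cancel h0.ne']
  exact h2

theorem Zf_im_eq_zero {x : ℝ} (hx : 0 < x) : (Zf (x:ℂ)).im = 0 := by
  rw [Zf_eq_tailInt (by simpa using hx)]
  have : tailInt (fun u => ((Int.fract u : ℝ) : ℂ)) (x:ℂ)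
      = ((∫ t in Ioi (1:ℝ), Int.fract t * t ^ (-(x+1)) : ℝ) : ℂ) := by
    unfold tailInt
    rw [← integral_complex_ofReal]
    apply setIntegral_congr_fun measurableSet_Ioi
    intro t ht
    have ht0 : (0:ℝ) ≤ t := by have : (1:ℝ) < t := ht; linarith
    have : (-((x:ℂ) + 1)) = ((-(x+1) : ℝ) : ℂ) := by push_cast; ring
    simp only [this, ← Complex.ofReal_cpow ht0]
    push_cast; rfl
  rw [this]
  norm_cast

end SW

namespace SW
open MeasureTheory Set Filter Topology

lemma differentiable_dslope {G : ℂ → ℂ} (hG : Differentiable ℂ G) (c : ℂ) :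
    Differentiable ℂ (dslope G c) := by
  have := (Complex.differentiableOn_dslope (f := G) (c := c) (s := univ) univ_mem).2
    hG.differentiableOn
  exact differentiableOn_univ.1 this

lemma iteratedDeriv_inv_sub_one (n : ℕ) :
    iteratedDeriv n (fun s : ℂ => (s - 1)⁻¹) 2 = (-1) ^ n * (n.factorial : ℂ) := by
  have h := iteratedDeriv_comp_sub_const (𝕜 := ℂ) n (fun s : ℂ => s⁻¹) 1
  have h1 := congrFun h 2
  rw [h1, iteratedDeriv_eq_iterate]
  have := iter_deriv_inv (𝕜 := ℂ) n (2 - 1)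
  rw [this]
  norm_num

open ComplexOrder in
lemma LSeries_two_ge_one {a : ℕ → ℂ} (ha : 0 ≤ a) (ha1 : a 1 = 1)
    (hs : LSeriesSummable a 2) : 1 ≤ (LSeries a 2).re := by
  unfold LSeries
  rw [Complex.re_tsum hs]
  have hs' : Summable fun n => (LSeries.term a 2 n).re := (Complex.hasSum_re hs.hasSum).summable
  have h1 : (LSeries.term a 2 1).re = 1 := by simp [LSeries.term, ha1]
  rw [← h1]
  apply hs'.le_tsum 1
  intro n _
  have := LSeries.term_nonneg (ha n) 2
  push_cast at this
  exact (Complex.le_def.1 this).1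

open ComplexOrder in
lemma estermann_aux {G : ℂ → ℂ} {a : ℕ → ℂ} {K : ℝ} (hG : Differentiable ℂ G)
    (ha : 0 ≤ a) (ha1 : a 1 = 1) (hsum : ∀ s : ℂ, 1 < s.re → LSeriesSummable a s)
    (heq : ∀ s : ℂ, 1 < s.re → G s = (s - 1) * LSeries a s)
    (hb : ∀ s ∈ Metric.closedBall (2:ℂ) (3/2), ‖G s‖ ≤ K) {β : ℝ} (hβ : 7/8 ≤ β) (hβ1 : β < 1)
    (hre : 0 ≤ (G β).re) (M : ℕ) (hM : 1 ≤ M) :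
    1 - 16 * K * (3/4) ^ M ≤ (G 1).re * (2 - β) ^ M / (1 - β) := by
  set h := dslope G 1 with hh
  have hd : Differentiable ℂ h := differentiable_dslope hG 1
  set l := G 1 with hl
  have hK : 0 ≤ K := (norm_nonneg _).trans (hb 2 (by simp; norm_num))
  have hne : ∀ s : ℂ, s ≠ 1 → h s = (G s - l) / (s - 1) := by
    intro s hs
    rw [hh, dslope_of_ne _ hs, slope_def_field]
  -- the coefficients
  have habs : LSeries.abscissaOfAbsConv a < ((2:ℝ) : EReal) := by
    have : LSeries.abscissaOfAbsConv a ≤ ((3/2:ℝ) : EReal) := by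
      apply LSeries.abscissaOfAbsConv_le_of_forall_lt_LSeriesSummable
      intro y hy
      exact hsum y (by simp; linarith)
    refine this.trans_lt ?_
    exact_mod_cast (by norm_num : (3/2:ℝ) < 2)
  have hcoef : ∀ n : ℕ, (-1) ^ n * iteratedDeriv n h 2 =
      (-1) ^ n * iteratedDeriv n (LSeries a) 2 - l * n.factorial := by
    intro n
    have hev : h =ᶠ[𝓝 2] fun s => LSeries a s - l * (s - 1)⁻¹ := by
      have : ∀ᶠ z : ℂ in 𝓝 2, 1 < z.re :=
        (isOpen_lt continuous_const Complex.continuous_re).mem_nhds (by simp)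
      filter_upwards [this] with z hz
      have hz1 : z ≠ 1 := by rintro rfl; simp at hz
      have hz1' : z - 1 ≠ 0 := sub_ne_zero.2 hz1
      rw [hne z hz1, heq z hz]
      field_simp
    rw [hev.iteratedDeriv_eq]
    have c1 : ContDiffAt ℂ n (LSeries a) 2 := by
      have := LSeries_analyticOnNhd a 2 (by simpa using habs)
      exact this.contDiffAt
    have c2 : ContDiffAt ℂ n (fun s : ℂ => (s - 1)⁻¹) 2 := by
      apply ContDiffAt.inv
      · fun_prop
      · norm_num
    have c3 : ContDiffAt ℂ n (fun s : ℂ => l * (s - 1)⁻¹) 2 := contDiffAt_const.mul c2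
    have := iteratedDeriv_sub c1 c3
    have e : (fun s => LSeries a s - l * (s - 1)⁻¹) = LSeries a - fun s : ℂ => l * (s - 1)⁻¹ := rfl
    rw [e, this, iteratedDeriv_const_mul_field, iteratedDeriv_inv_sub_one]
    have : (-1:ℂ) ^ n * (-1) ^ n = 1 := by rw [← mul_pow]; simp
    linear_combination (- l * (n.factorial : ℂ)) * this
  have hbound : ∀ n : ℕ, ‖iteratedDeriv n h 2‖ ≤ n.factorial * (4 * K) / (3/2) ^ n := by
    intro n
    apply Complex.norm_iteratedDeriv_le_of_forall_mem_sphere_norm_le n (by norm_num)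
      hd.diffContOnCl
    intro z hz
    have hz' : ‖z - 2‖ = 3/2 := by simpa [dist_eq_norm] using hz
    have hz1 : 1/2 ≤ ‖z - 1‖ := by
      have : ‖z - 2‖ ≤ ‖z - 1‖ + ‖(1:ℂ)‖ := by
        have e : z - 2 = (z - 1) - 1 := by ring
        rw [e]; exact norm_sub_le _ _
      rw [norm_one] at this; linarith
    have hzne : z ≠ 1 := by rintro rfl; norm_num at hz1
    rw [hne z hzne, norm_div, div_le_iff₀ (by linarith)]
    have g1 := hb z (Metric.sphere_subset_closedBall hz)
    have g2 : ‖l‖ ≤ K := hb 1 (by simp [dist_eq_norm]; norm_num)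
    have g3 := norm_sub_le (G z) l
    nlinarith
  set y := 2 - β with hy
  have hy1 : 1 < y := by linarith
  have hy2 : y ≤ 9/8 := by linarith
  -- Taylor expansion
  have hts := Complex.hasSum_taylorSeries_on_ball (f := h) (c := 2) (r := 3/2) hd.differentiableOn
    (z := (β:ℂ)) (by
      rw [Metric.mem_ball, dist_eq_norm]
      have : (β:ℂ) - 2 = ((β - 2 : ℝ) : ℂ) := by push_cast; ring
      rw [this, Complex.norm_real, Real.norm_eq_abs, abs_lt]; constructor <;> linarith)
  set d : ℕ → ℝ := fun n => ((n.factorial:ℝ))⁻¹ * ((-1) ^ n * iteratedDeriv n h 2).re with hdd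
  have hre' := Complex.hasSum_re hts
  have hterm : ∀ n : ℕ, (((n.factorial:ℂ))⁻¹ • ((β:ℂ) - 2) ^ n • iteratedDeriv n h 2).re
      = y ^ n * d n := by
    intro n
    have : ((β:ℂ) - 2) ^ n = ((y ^ n : ℝ) : ℂ) * (-1) ^ n := by
      rw [hy]; push_cast; rw [← mul_pow]; congr 1; ring
    rw [this]
    simp only [smul_eq_mul]
    have e2 : ((n.factorial:ℂ))⁻¹ * (((y ^ n : ℝ) : ℂ) * (-1) ^ n * iteratedDeriv n h 2)
      = ((y ^ n * ((n.factorial:ℝ))⁻¹ : ℝ) : ℂ) * ((-1) ^ n * iteratedDeriv n h 2) := by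
      push_cast; ring
    rw [e2, Complex.re_ofReal_mul, hdd]; ring
  simp_rw [hterm] at hre'
  have hdge : ∀ n, - l.re ≤ d n := by
    intro n
    have hf : (0:ℝ) < n.factorial := by exact_mod_cast n.factorial_pos
    simp only [hdd, hcoef]
    have h1 := LSeries.iteratedDeriv_alternating ha habs n
    have h2 := (Complex.le_def.1 h1).1
    push_cast at h2
    rw [Complex.sub_re, mul_comm l, show ((n.factorial:ℂ)) = ((n.factorial:ℝ):ℂ) by push_cast; rfl,
      Complex.re_ofReal_mul, inv_mul_eq_div, le_div_iff₀ hf]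
    simp only [Complex.zero_re] at h2
    nlinarith
  have hd0 : 1 - l.re ≤ d 0 := by
    simp only [hdd, hcoef]
    have := LSeries_two_ge_one ha ha1 (hsum 2 (by simp))
    simp
    linarith
  have hdabs : ∀ n, |y ^ n * d n| ≤ 4 * K * (3/4) ^ n := by
    intro n
    have hf : (0:ℝ) < n.factorial := by exact_mod_cast n.factorial_pos
    have h1 : |d n| ≤ 4 * K / (3/2) ^ n := by
      simp only [hdd]
      rw [abs_mul, abs_of_pos (inv_pos.2 hf), inv_mul_eq_div, div_le_iff₀ hf]
      refine (Complex.abs_re_le_norm _).trans ?_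
      rw [norm_mul, norm_pow, norm_neg, norm_one, one_pow, one_mul]
      refine (hbound n).trans (le_of_eq ?_)
      ring
    rw [abs_mul, abs_of_pos (by positivity : 0 < y ^ n)]
    calc y ^ n * |d n| ≤ (9/8) ^ n * (4 * K / (3/2) ^ n) := by gcongr
      _ = 4 * K * (3/4) ^ n := by
        have e9 : (9/8:ℝ)^n / (3/2)^n = (3/4)^n := by rw [← div_pow]; norm_num
        rw [← e9]
        generalize (9/8:ℝ)^n = u
        generalize (3/2:ℝ)^n = v
        ring
  have hsm : Summable fun n => y ^ n * d n := hre'.summable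
  have hsplit := hsm.sum_add_tsum_nat_add M
  have htail : -(16 * K * (3/4) ^ M) ≤ ∑' n, y ^ (n + M) * d (n + M) := by
    have g : HasSum (fun n : ℕ => 4 * K * (3/4:ℝ) ^ (n + M)) (16 * K * (3/4) ^ M) := by
      have := (hasSum_geometric_of_lt_one (r := (3/4:ℝ)) (by norm_num) (by norm_num)).mul_left
        (4 * K * (3/4) ^ M)
      have e1 : (fun n : ℕ => 4 * K * (3/4:ℝ) ^ (n + M)) =
          fun n : ℕ => 4 * K * (3/4) ^ M * (3/4:ℝ) ^ n := by
        funext n; rw [pow_add]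
        generalize (3/4:ℝ)^n = u, (3/4:ℝ)^M = v
        ring
      have e2 : 16 * K * (3/4:ℝ) ^ M = 4 * K * (3/4) ^ M * (1 - 3/4)⁻¹ := by
        generalize (3/4:ℝ)^M = v
        norm_num; ring
      rw [e1, e2]; exact this
    have g2 : HasSum (fun n : ℕ => -(4 * K * (3/4:ℝ) ^ (n + M))) (-(16 * K * (3/4) ^ M)) := g.neg
    refine hasSum_le (fun n => ?_) g2 ((summable_nat_add_iff M).2 hsm).hasSum
    exact (abs_le.1 (hdabs (n + M))).1
  have hfin : 1 - l.re * ((y ^ M - 1) / (y - 1)) ≤ ∑ n ∈ Finset.range M, y ^ n * d n := by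
    obtain ⟨m, rfl⟩ : ∃ m, M = m + 1 := ⟨M - 1, by omega⟩
    rw [← geom_sum_eq (ne_of_gt hy1), Finset.sum_range_succ', Finset.sum_range_succ', mul_add,
      Finset.mul_sum]
    have : ∑ k ∈ Finset.range m, -(l.re * y ^ (k + 1)) ≤ ∑ k ∈ Finset.range m, y ^ (k+1) * d (k+1) := by
      apply Finset.sum_le_sum
      intro k _
      have h1 := hdge (k+1)
      have h2 : 0 < y ^ (k+1) := by positivity
      nlinarith
    rw [Finset.sum_neg_distrib] at this
    simp only [pow_zero, one_mul, mul_one]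
    linarith
  have hval : (h β).re = (l.re - (G β).re) / (1 - β) := by
    have hne1 : (β:ℂ) ≠ 1 := by
      intro e; have : β = 1 := by exact_mod_cast e
      linarith
    rw [hne β hne1]
    have : (G β - l) / ((β:ℂ) - 1) = (((1 - β)⁻¹ : ℝ) : ℂ) * (l - G β) := by
      have h3 : (β:ℂ) - 1 ≠ 0 := sub_ne_zero.2 hne1
      have h4 : (1:ℂ) - β ≠ 0 := sub_ne_zero.2 hne1.symm
      push_cast; field_simp; ring
    rw [this, Complex.re_ofReal_mul, Complex.sub_re]; ring
  rw [hre'.tsum_eq, hval] at hsplit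
  have hpos : 0 < 1 - β := by linarith
  have h9 : (l.re - (G β).re) / (1 - β) ≤ l.re / (1 - β) := by gcongr; linarith
  have h10 : y - 1 = 1 - β := by rw [hy]; ring
  rw [h10] at hfin
  have h11 : l.re * y ^ M / (1 - β) = l.re * ((y ^ M - 1) / (1 - β)) + l.re / (1 - β) := by
    field_simp; ring
  rw [h11]
  linarith

open ComplexOrder in
theorem estermann : ∃ c : ℝ, 0 < c ∧ ∀ (G : ℂ → ℂ) (a : ℕ → ℂ) (K : ℝ), Differentiable ℂ G →
    0 ≤ a → a 1 = 1 → (∀ s : ℂ, 1 < s.re → LSeriesSummable a s) →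
    (∀ s : ℂ, 1 < s.re → G s = (s - 1) * LSeries a s) → 1 ≤ K →
    (∀ s ∈ Metric.closedBall (2:ℂ) (3/2), ‖G s‖ ≤ K) → ∀ β : ℝ, 7/8 ≤ β → β < 1 →
    0 ≤ (G β).re → c * (1 - β) * K ^ (-(4 * (1 - β))) ≤ ‖G 1‖ := by
  refine ⟨1 / (2 * (32 ^ 4 * Real.exp 1)), by positivity, ?_⟩
  intro G a K hG ha ha1 hsum heq hK hb β hβ hβ1 hre
  have hl43 : 1/4 ≤ Real.log (4/3) := by
    have := Real.one_sub_inv_le_log_of_pos (show (0:ℝ) < 4/3 by norm_num)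
    norm_num at this ⊢; linarith
  have hlK : 0 < Real.log (32 * K) := Real.log_pos (by linarith)
  set M := ⌈Real.log (32 * K) / Real.log (4/3)⌉₊ with hM
  have hM1 : 1 ≤ M := Nat.ceil_pos.2 (by positivity)
  have hMge : Real.log (32 * K) ≤ M * Real.log (4/3) := by
    rw [← div_le_iff₀ (by linarith)]; exact Nat.le_ceil _
  have hMle : (M:ℝ) ≤ 4 * Real.log (32 * K) + 1 := by
    have h1 := (Nat.ceil_lt_add_one (a := Real.log (32 * K) / Real.log (4/3)) (by positivity)).le
    have h2 : Real.log (32 * K) / Real.log (4/3) ≤ 4 * Real.log (32 * K) := by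
      rw [div_le_iff₀ (by linarith)]; nlinarith
    linarith
  have h34 : 32 * K * (3/4) ^ M ≤ 1 := by
    have h1 : 32 * K ≤ (4/3) ^ M := by
      rw [← Real.log_le_log_iff (by positivity) (by positivity), Real.log_pow]; exact hMge
    calc 32 * K * (3/4) ^ M ≤ (4/3) ^ M * (3/4) ^ M := by gcongr
      _ = 1 := by rw [← mul_pow]; norm_num
  have key := estermann_aux hG ha ha1 hsum heq hb hβ hβ1 hre M hM1
  have hpos : 0 < 1 - β := by linarith
  have h1 : (1:ℝ)/2 * (1 - β) ≤ (G 1).re * (2 - β) ^ M := by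
    rw [← le_div_iff₀ hpos]; linarith
  have hy : (2 - β) ^ M ≤ 32 ^ 4 * Real.exp 1 * K ^ (4 * (1 - β)) := by
    have h2 : 2 - β ≤ Real.exp (1 - β) := by
      have := Real.add_one_le_exp (1 - β); linarith
    calc (2 - β) ^ M ≤ (Real.exp (1 - β)) ^ M := by gcongr; linarith
      _ = Real.exp (M * (1 - β)) := by rw [← Real.exp_nat_mul]
      _ ≤ Real.exp (4 * Real.log 32 + 1 + Real.log K * (4 * (1 - β))) := by
        apply Real.exp_le_exp.2
        rw [Real.log_mul (by norm_num) (by linarith)] at hMle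
        have : 0 < Real.log 32 := Real.log_pos (by norm_num)
        nlinarith
      _ = _ := by
        rw [Real.exp_add, Real.exp_add, Real.rpow_def_of_pos (by linarith)]
        congr 2
        rw [← Real.log_rpow (by norm_num), Real.exp_log (by positivity)]
        norm_num
  have hG1 : (G 1).re ≤ ‖G 1‖ := Complex.re_le_norm _
  have hKp : 0 < K ^ (4 * (1 - β)) := Real.rpow_pos_of_pos (by linarith) _
  rw [Real.rpow_neg (by linarith)]
  have h3 : (1:ℝ)/2 * (1 - β) ≤ ‖G 1‖ * (32 ^ 4 * Real.exp 1 * K ^ (4 * (1 - β))) := by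
    refine h1.trans ?_
    have h4 : 0 < (2 - β) ^ M := by apply pow_pos; linarith
    exact mul_le_mul hG1 hy h4.le (norm_nonneg _)
  have he := Real.exp_pos 1
  calc 1 / (2 * (32 ^ 4 * Real.exp 1)) * (1 - β) * (K ^ (4 * (1 - β)))⁻¹
      = ((1:ℝ)/2 * (1 - β)) / (32 ^ 4 * Real.exp 1 * K ^ (4 * (1 - β))) := by field_simp
    _ ≤ ‖G 1‖ := by rw [div_le_iff₀ (by positivity)]; exact h3

end SW

namespace SW
open MeasureTheory Set Filter Topology

/-- arithmetic function of a Dirichlet character -/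
noncomputable def TT {N : ℕ} (χ : DirichletCharacter ℂ N) : ArithmeticFunction ℂ :=
  toArithmeticFunction (fun n => χ n)

/-- arithmetic function of the twisted von Mangoldt function -/
noncomputable def TL {N : ℕ} (χ : DirichletCharacter ℂ N) : ArithmeticFunction ℂ :=
  toArithmeticFunction (fun n => χ n * ArithmeticFunction.vonMangoldt n)

def LD (f D : ArithmeticFunction ℂ) : Prop := ∀ n : ℕ, Complex.log n * f n = (D * f) n

lemma TT_apply {N : ℕ} (χ : DirichletCharacter ℂ N) {n : ℕ} (hn : n ≠ 0) : TT χ n = χ n := by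
  simp [TT, toArithmeticFunction, hn]

lemma TL_apply {N : ℕ} (χ : DirichletCharacter ℂ N) (n : ℕ) :
    TL χ n = χ n * ArithmeticFunction.vonMangoldt n := by
  rcases eq_or_ne n 0 with rfl | hn
  · simp
  · simp [TL, toArithmeticFunction, hn]

lemma LD_TT {N : ℕ} (χ : DirichletCharacter ℂ N) : LD (TT χ) (TL χ) := by
  intro n
  have h := congrFun (DirichletCharacter.convolution_twist_vonMangoldt χ) n
  rcases eq_or_ne n 0 with rfl | hn
  · simp
  rw [TT_apply χ hn, mul_comm]
  exact h.symm

lemma LD.mul {f g D E : ArithmeticFunction ℂ} (hf : LD f D) (hg : LD g E) :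
    LD (f * g) (D + E) := by
  intro n
  have e : (D + E) * (f * g) = (D * f) * g + f * (E * g) := by ring
  rw [e, ArithmeticFunction.add_apply, ArithmeticFunction.mul_apply, ArithmeticFunction.mul_apply,
    ArithmeticFunction.mul_apply, Finset.mul_sum, ← Finset.sum_add_distrib]
  apply Finset.sum_congr rfl
  intro p hp
  rw [← hf, ← hg]
  have hp' := Nat.mem_divisorsAntidiagonal.1 hp
  have h1 : p.1 ≠ 0 := by rintro h; simp [h] at hp'; omega
  have h2 : p.2 ≠ 0 := by rintro h; simp [h] at hp'; omega
  have : Complex.log n = Complex.log p.1 + Complex.log p.2 := by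
    rw [← hp'.1]
    rw [Complex.natCast_log.symm, Complex.natCast_log.symm, Complex.natCast_log.symm,
      ← Complex.ofReal_add]
    congr 1
    push_cast
    rw [Real.log_mul (by exact_mod_cast h1) (by exact_mod_cast h2)]
  rw [this]; ring

open ComplexOrder in
lemma LD.nonneg {f D : ArithmeticFunction ℂ} (h : LD f D) (h1 : f 1 = 1) (hD : ∀ n, 0 ≤ D n)
    (hD1 : D 1 = 0) : ∀ n, 0 ≤ f n := by
  intro n
  induction n using Nat.strong_induction_on with
  | _ n ih =>
    rcases Nat.lt_or_ge n 2 with hn | hn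
    · interval_cases n
      · simp
      · rw [h1]; exact zero_le_one
    · have hl : 0 < Real.log n := Real.log_pos (by exact_mod_cast hn)
      have h2 : 0 ≤ (D * f) n := by
        rw [ArithmeticFunction.mul_apply]
        apply Finset.sum_nonneg
        intro p hp
        have hp' := Nat.mem_divisorsAntidiagonal.1 hp
        by_cases h3 : p.1 = 1
        · rw [h3, hD1, zero_mul]
        · apply mul_nonneg (hD _)
          apply ih
          have : p.1 ≠ 0 := by rintro h; simp [h] at hp'; omega
          have h4 : 2 ≤ p.1 := by omega
          have : p.2 ≠ 0 := by rintro h; simp [h] at hp'; omega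
          nlinarith [hp'.1, Nat.pos_of_ne_zero this]
      rw [← h n, ← Complex.natCast_log] at h2
      have h5 : f n = (((Real.log n)⁻¹ : ℝ) : ℂ) * ((Real.log n : ℂ) * f n) := by
        rw [← mul_assoc, ← Complex.ofReal_mul, inv_mul_cancel₀ hl.ne']; simp
      rw [h5]
      apply mul_nonneg _ h2
      exact_mod_cast (inv_pos.2 hl).le

lemma TT_summable {N : ℕ} (χ : DirichletCharacter ℂ N) {s : ℂ} (hs : 1 < s.re) :
    LSeriesSummable (TT χ) s := by
  refine (LSeriesSummable_congr s ?_).2 (DirichletCharacter.LSeriesSummable_of_one_lt_re χ hs)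
  intro n hn
  exact TT_apply χ hn

lemma TT_LSeries {N : ℕ} [NeZero N] (χ : DirichletCharacter ℂ N) {s : ℂ} (hs : 1 < s.re) :
    LSeries (TT χ) s = DirichletCharacter.LFunction χ s := by
  rw [DirichletCharacter.LFunction_eq_LSeries χ hs]
  refine LSeries_congr ?_ s
  intro n hn
  exact TT_apply χ hn

/-- product of two characters of different moduli -/
noncomputable def prodChar {N M : ℕ} (χ : DirichletCharacter ℂ N) (ψ : DirichletCharacter ℂ M) :
    DirichletCharacter ℂ (N * M) :=
  DirichletCharacter.changeLevel (Dvd.intro _ rfl) χ *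
    DirichletCharacter.changeLevel (Dvd.intro_left _ rfl) ψ

lemma prodChar_apply {N M : ℕ} (χ : DirichletCharacter ℂ N) (ψ : DirichletCharacter ℂ M) (n : ℕ) :
    prodChar χ ψ n = χ n * ψ n := by
  by_cases h : n.Coprime (N * M)
  · have hc : IsCoprime (n:ℤ) ((N * M : ℕ) : ℤ) := Nat.isCoprime_iff_coprime.2 h
    have e1 := DirichletCharacter.changeLevel_eq_cast_of_dvd' χ (Dvd.intro M rfl : N ∣ N * M) hc
    have e2 := DirichletCharacter.changeLevel_eq_cast_of_dvd' ψ
      (Dvd.intro_left N rfl : M ∣ N * M) hc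
    simp only [Int.cast_natCast] at e1 e2
    rw [prodChar, MulChar.mul_apply, e1, e2]
  · have h0 : prodChar χ ψ n = 0 :=
      MulChar.map_nonunit _ (by rwa [ZMod.isUnit_iff_coprime])
    rw [h0]
    rw [Nat.coprime_mul_iff_right, not_and_or] at h
    rcases h with h | h
    · rw [MulChar.map_nonunit χ (by rwa [ZMod.isUnit_iff_coprime]), zero_mul]
    · rw [MulChar.map_nonunit ψ (by rwa [ZMod.isUnit_iff_coprime]), mul_zero]

lemma prodChar_ne_one {N M : ℕ} (hNM : N.Coprime M) (hM : M ≠ 0)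
    (χ : DirichletCharacter ℂ N) {ψ : DirichletCharacter ℂ M}
    (hψ : ψ ≠ 1) : prodChar χ ψ ≠ 1 := by
  have : NeZero M := ⟨hM⟩
  intro h
  apply hψ
  ext u
  obtain ⟨n, hn1, hn2⟩ := Nat.chineseRemainder hNM 1 (u : ZMod M).val
  have e1 : (n : ZMod N) = 1 := by
    have := (ZMod.natCast_eq_natCast_iff n 1 N).2 hn1
    simpa using this
  have e2 : (n : ZMod M) = u := by
    have := (ZMod.natCast_eq_natCast_iff n _ M).2 hn2
    simpa using this
  have hp := prodChar_apply χ ψ n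
  rw [e1, e2, map_one, one_mul] at hp
  rw [← hp, h]
  have hc : n.Coprime (N * M) := by
    rw [Nat.coprime_mul_iff_right]
    constructor
    · rw [← ZMod.isUnit_iff_coprime, e1]; exact isUnit_one
    · rw [← ZMod.isUnit_iff_coprime, e2]; exact u.isUnit
  rw [MulChar.one_apply ((ZMod.isUnit_iff_coprime n (N*M)).2 hc)]
  simp

open ComplexOrder in
lemma one_add_nonneg {N : ℕ} {χ : DirichletCharacter ℂ N} (h2 : χ ^ 2 = 1) (n : ZMod N) :
    0 ≤ 1 + χ n := by
  rcases MulChar.isQuadratic_iff_sq_eq_one.mpr h2 n with h | h | h <;> rw [h] <;> norm_num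

/-- the coefficients in the argument of Siegel -/
noncomputable def siegelA {N M : ℕ} (χ : DirichletCharacter ℂ N) (ψ : DirichletCharacter ℂ M) :
    ArithmeticFunction ℂ :=
  (TT (1 : DirichletCharacter ℂ 1) * TT χ) * (TT ψ * TT (prodChar χ ψ))

lemma one_mod_one (n : ZMod 1) : (1 : DirichletCharacter ℂ 1) n = 1 := by
  apply MulChar.one_apply; exact isUnit_of_subsingleton _

lemma siegelA_one {N M : ℕ} (χ : DirichletCharacter ℂ N) (ψ : DirichletCharacter ℂ M) :
    siegelA χ ψ 1 = 1 := by
  simp [siegelA, TT_apply, one_mod_one]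

open ComplexOrder in
lemma siegelA_nonneg {N M : ℕ} {χ : DirichletCharacter ℂ N} {ψ : DirichletCharacter ℂ M}
    (h1 : χ ^ 2 = 1) (h2 : ψ ^ 2 = 1) (n : ℕ) : 0 ≤ siegelA χ ψ n := by
  have hone := siegelA_one χ ψ
  have hLD := ((LD_TT (1 : DirichletCharacter ℂ 1)).mul (LD_TT χ)).mul
    ((LD_TT ψ).mul (LD_TT (prodChar χ ψ)))
  refine hLD.nonneg hone ?_ ?_ n
  · intro n
    simp only [ArithmeticFunction.add_apply, TL_apply, prodChar_apply]
    have e : (1 : DirichletCharacter ℂ 1) (n : ZMod 1) = 1 := by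
      apply MulChar.one_apply; exact isUnit_of_subsingleton _
    rw [e]
    have : (1 * (ArithmeticFunction.vonMangoldt n : ℂ) + χ n * (ArithmeticFunction.vonMangoldt n)) +
      (ψ n * (ArithmeticFunction.vonMangoldt n) + χ n * ψ n * (ArithmeticFunction.vonMangoldt n))
      = ((1 + χ n) * (1 + ψ n)) * (ArithmeticFunction.vonMangoldt n : ℂ) := by ring
    rw [this]
    refine mul_nonneg (mul_nonneg (one_add_nonneg h1 _) (one_add_nonneg h2 _)) ?_
    exact_mod_cast ArithmeticFunction.vonMangoldt_nonneg
  · simp [TL_apply]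

end SW

namespace SW
open MeasureTheory Set Filter Topology

lemma ball_re {s : ℂ} (hs : s ∈ Metric.closedBall (2:ℂ) (3/2)) : 1/2 ≤ s.re ∧ ‖s‖ ≤ 7/2 ∧
    ‖s - 1‖ ≤ 5/2 := by
  rw [Metric.mem_closedBall, dist_eq_norm] at hs
  refine ⟨?_, ?_, ?_⟩
  · have := (Complex.abs_re_le_norm (s - 2)).trans hs
    rw [Complex.sub_re] at this
    have := (abs_le.1 this).1
    simp at this
    linarith
  · have e : s = (s - 2) + 2 := by ring
    have := norm_add_le (s - 2) 2
    rw [← e] at this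
    have h2 : ‖(2:ℂ)‖ = 2 := by simp
    linarith
  · have e : s - 1 = (s - 2) + 1 := by ring
    have := norm_add_le (s - 2) 1
    rw [← e] at this
    have h2 : ‖(1:ℂ)‖ = 1 := by simp
    linarith

lemma norm_LFunction_ball {N : ℕ} [NeZero N] {χ : DirichletCharacter ℂ N} (hχ : χ ≠ 1) {s : ℂ}
    (hs : s ∈ Metric.closedBall (2:ℂ) (3/2)) : ‖DirichletCharacter.LFunction χ s‖ ≤ 7 * N := by
  obtain ⟨h1, h2, -⟩ := ball_re hs
  have h := norm_LFunction_le hχ (θ := 1) (by norm_num) le_rfl (s := s) (by linarith)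
  refine h.trans ?_
  rw [Real.rpow_one, sub_self, sub_zero]
  have hN : (0:ℝ) ≤ N := Nat.cast_nonneg _
  calc ‖s‖ * (N / s.re) ≤ 7/2 * (N / (1/2)) := by gcongr
    _ = 7 * N := by ring

lemma norm_Zf_ball {s : ℂ} (hs : s ∈ Metric.closedBall (2:ℂ) (3/2)) : ‖Zf s‖ ≤ 21 := by
  obtain ⟨h1, h2, h3⟩ := ball_re hs
  have h := norm_Zf_sub_one_le h1
  have e : Zf s = (Zf s - 1) + 1 := by ring
  rw [e]
  refine (norm_add_le _ _).trans ?_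
  rw [norm_one]
  have : ‖s - 1‖ * (1 + 2 * ‖s‖) ≤ 5/2 * (1 + 2 * (7/2)) := by gcongr
  linarith

lemma zetaMul_eq {N : ℕ} (χ : DirichletCharacter ℂ N) :
    χ.zetaMul = TT (1 : DirichletCharacter ℂ 1) * TT χ := by
  unfold DirichletCharacter.zetaMul
  have : TT (1 : DirichletCharacter ℂ 1) = (ArithmeticFunction.zeta : ArithmeticFunction ℂ) := by
    ext n
    rcases eq_or_ne n 0 with rfl | hn
    · simp
    · rw [TT_apply _ hn, one_mod_one]; simp [hn]
  rw [this]; rfl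

/-- Case B bound -/
lemma siegel_B (δ' : ℝ) (hδ : 0 < δ') (hδ8 : δ' ≤ 1/8)
    (hZ : ∀ x : ℝ, 1 - δ' ≤ x → x ≤ 1 → Zf x ≠ 0)
    (hno : ∀ (q : ℕ) [NeZero q], q.Prime → ∀ χ : DirichletCharacter ℂ q, χ ≠ 1 → χ ^ 2 = 1 →
      ∀ β : ℝ, 1 - δ' < β → β < 1 → DirichletCharacter.LFunction χ β ≠ 0) :
    ∃ c : ℝ, 0 < c ∧ ∀ (q : ℕ) [NeZero q], q.Prime → ∀ χ : DirichletCharacter ℂ q, χ ≠ 1 →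
      χ ^ 2 = 1 → c * (q:ℝ) ^ (-(2 * δ')) ≤ ‖DirichletCharacter.LFunction χ 1‖ := by
  obtain ⟨c, hc, H⟩ := estermann
  refine ⟨c * (δ'/2) * 147 ^ (-(2 * δ')), by positivity, ?_⟩
  intro q _ hq χ hχ h2
  set G : ℂ → ℂ := fun s => Zf s * DirichletCharacter.LFunction χ s with hG
  have hGd : Differentiable ℂ G :=
    Zf_differentiable.mul (DirichletCharacter.differentiable_LFunction hχ)
  have hq1 : (1:ℝ) ≤ q := by exact_mod_cast hq.one_lt.le
  set β : ℝ := 1 - δ'/2 with hβ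
  have heq : ∀ s : ℂ, 1 < s.re → G s = (s - 1) * LSeries χ.zetaMul s := by
    intro s hs
    have hs1 : s ≠ 1 := by rintro rfl; simp at hs
    rw [zetaMul_eq, ArithmeticFunction.LSeries_mul'
      (TT_summable _ hs) (TT_summable χ hs),
      TT_LSeries χ hs, TT_LSeries _ hs, DirichletCharacter.LFunction_modOne_eq]
    simp only [hG]
    rw [Zf_of_ne hs1]; ring
  have hone : χ.zetaMul 1 = 1 := χ.isMultiplicative_zetaMul.1
  have hne : ∀ x : ℝ, β ≤ x → G x ≠ 0 := by
    intro x hx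
    apply mul_ne_zero
    · rcases le_or_gt x 1 with h | h
      · exact hZ x (by linarith) h
      · rw [Zf_of_ne (by norm_cast; exact ne_of_gt h)]
        apply mul_ne_zero
        · rw [sub_ne_zero]; norm_cast; exact ne_of_gt h
        · exact riemannZeta_ne_zero_of_one_le_re (by simp; exact h.le)
    · rcases lt_or_ge x 1 with h | h
      · exact hno q hq χ hχ h2 x (by linarith) h
      · exact DirichletCharacter.LFunction_ne_zero_of_one_le_re χ (Or.inl hχ) (by simpa using h)
  have him : ∀ x : ℝ, 0 < x → (G x).im = 0 := by
    intro x hx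
    simp only [hG, Complex.mul_im, Zf_im_eq_zero hx, LFunction_im_eq_zero hχ h2 hx]
    simp
  have hG2 : 1 ≤ (G 2).re := by
    rw [heq 2 (by simp)]
    have := LSeries_two_ge_one (a := χ.zetaMul) (fun n => DirichletCharacter.zetaMul_nonneg h2 n)
      hone (DirichletCharacter.LSeriesSummable_zetaMul χ (by simp))
    norm_num
    exact this
  have hpos : 0 ≤ (G β).re := by
    by_contra hneg
    push Not at hneg
    have hcont : ContinuousOn (fun x : ℝ => (G x).re) (Icc β 2) := by
      apply Continuous.continuousOn
      exact Complex.continuous_re.comp (hGd.continuous.comp Complex.continuous_ofReal)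
    have hmem : (0:ℝ) ∈ Icc ((fun x : ℝ => (G x).re) β) ((fun x : ℝ => (G x).re) 2) := by
      constructor
      · exact hneg.le
      · simp only [Complex.ofReal_ofNat]; linarith
    obtain ⟨x, hx, hx0⟩ := intermediate_value_Icc (by linarith : β ≤ 2) hcont hmem
    apply hne x hx.1
    apply Complex.ext
    · exact hx0
    · exact him x (by linarith [hx.1])
  have hfin := H G (χ.zetaMul) (147 * q) hGd (fun n => DirichletCharacter.zetaMul_nonneg h2 n) hone
    (fun s hs => DirichletCharacter.LSeriesSummable_zetaMul χ hs) heq (by linarith) (by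
      intro s hs
      simp only [hG, norm_mul]
      calc _ ≤ 21 * (7 * (q:ℝ)) := by
            gcongr
            · exact norm_Zf_ball hs
            · exact norm_LFunction_ball hχ hs
        _ = 147 * q := by ring) β (by linarith) (by linarith) hpos
  have hG1 : G 1 = DirichletCharacter.LFunction χ 1 := by simp only [hG, Zf_one, one_mul]
  rw [hG1] at hfin
  refine le_trans (le_of_eq ?_) hfin
  rw [hβ, Real.mul_rpow (by norm_num) (by linarith)]
  rw [show 1 - (1 - δ'/2) = δ'/2 by ring, show 4 * (δ'/2) = 2 * δ' by ring]
  ring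

/-- Case A bound -/
lemma siegel_A (δ' θ : ℝ) (hδ : 0 < δ') (hδ8 : δ' ≤ 1/8) (hθ : 0 < θ) (hθ1 : θ ≤ 1)
    (q₁ : ℕ) [NeZero q₁] (hq₁ : q₁.Prime) (χ₁ : DirichletCharacter ℂ q₁) (hχ₁ : χ₁ ≠ 1)
    (h₁2 : χ₁ ^ 2 = 1) (β : ℝ) (hβ : 1 - δ' < β) (hβ1 : β < 1)
    (hz : DirichletCharacter.LFunction χ₁ β = 0) :
    ∃ c : ℝ, 0 < c ∧ ∀ (q : ℕ) [NeZero q], q.Prime → ∀ χ : DirichletCharacter ℂ q, χ ≠ 1 →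
      χ ^ 2 = 1 → c * (q:ℝ) ^ (-(8 * δ' + θ)) ≤ ‖DirichletCharacter.LFunction χ 1‖ := by
  obtain ⟨c, hc, H⟩ := estermann
  -- bound for q = q₁
  obtain ⟨χ₀, -, hχ₀⟩ := Finset.exists_min_image (Finset.univ : Finset (DirichletCharacter ℂ q₁))
    (fun χ => if χ = 1 then (1:ℝ) else ‖DirichletCharacter.LFunction χ 1‖) ⟨1, Finset.mem_univ _⟩
  set m : ℝ := if χ₀ = 1 then (1:ℝ) else ‖DirichletCharacter.LFunction χ₀ 1‖ with hm
  have hmpos : 0 < m := by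
    rw [hm]
    split_ifs with h
    · norm_num
    · exact norm_pos_iff.2 (DirichletCharacter.LFunction_apply_one_ne_zero h)
  have hq1' : (1:ℝ) ≤ q₁ := by exact_mod_cast hq₁.one_lt.le
  set L₁ := ‖DirichletCharacter.LFunction χ₁ 1‖ with hL₁
  have hL₁pos : 0 < L₁ := norm_pos_iff.2 (DirichletCharacter.LFunction_apply_one_ne_zero hχ₁)
  set c₂ := c * (1 - β) * (7203 * (q₁:ℝ) ^ 2) ^ (-(4 * δ')) / (L₁ * ((q₁:ℝ) ^ θ / θ)) with hc₂
  have h1β : 0 < 1 - β := by linarith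
  have hc₂pos : 0 < c₂ := by positivity
  refine ⟨min m c₂, lt_min hmpos hc₂pos, ?_⟩
  intro q _ hq χ hχ h2
  have hq1 : (1:ℝ) ≤ q := by exact_mod_cast hq.one_lt.le
  by_cases hqq : q = q₁
  · subst hqq
    have h3 := hχ₀ χ (Finset.mem_univ _)
    simp only [hχ, if_false] at h3
    refine le_trans ?_ h3
    calc min m c₂ * (q:ℝ) ^ (-(8 * δ' + θ)) ≤ m * 1 := by
          gcongr
          · exact min_le_left _ _
          · exact Real.rpow_le_one_of_one_le_of_nonpos hq1 (by linarith)
      _ = m := mul_one _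
  · have hcop : q₁.Coprime q := (Nat.coprime_primes hq₁ hq).2 (Ne.symm hqq)
    have hψ : prodChar χ₁ χ ≠ 1 := prodChar_ne_one hcop hq.ne_zero χ₁ hχ
    have : NeZero (q₁ * q) := ⟨mul_ne_zero hq₁.ne_zero hq.ne_zero⟩
    set G : ℂ → ℂ := fun s => (Zf s * DirichletCharacter.LFunction χ₁ s) *
      (DirichletCharacter.LFunction χ s * DirichletCharacter.LFunction (prodChar χ₁ χ) s) with hG
    have hGd : Differentiable ℂ G :=
      (Zf_differentiable.mul (DirichletCharacter.differentiable_LFunction hχ₁)).mul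
        ((DirichletCharacter.differentiable_LFunction hχ).mul
          (DirichletCharacter.differentiable_LFunction hψ))
    have hsum : ∀ s : ℂ, 1 < s.re → LSeriesSummable (siegelA χ₁ χ) s := by
      intro s hs
      exact ArithmeticFunction.LSeriesSummable_mul
        (ArithmeticFunction.LSeriesSummable_mul (TT_summable _ hs) (TT_summable _ hs))
        (ArithmeticFunction.LSeriesSummable_mul (TT_summable _ hs) (TT_summable _ hs))
    have heq : ∀ s : ℂ, 1 < s.re → G s = (s - 1) * LSeries (siegelA χ₁ χ) s := by
      intro s hs
      have hs1 : s ≠ 1 := by rintro rfl; simp at hs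
      unfold siegelA
      rw [ArithmeticFunction.LSeries_mul'
        (ArithmeticFunction.LSeriesSummable_mul (TT_summable _ hs) (TT_summable _ hs))
        (ArithmeticFunction.LSeriesSummable_mul (TT_summable _ hs) (TT_summable _ hs)),
        ArithmeticFunction.LSeries_mul' (TT_summable _ hs) (TT_summable _ hs),
        ArithmeticFunction.LSeries_mul' (TT_summable _ hs) (TT_summable _ hs),
        TT_LSeries _ hs, TT_LSeries _ hs, TT_LSeries _ hs, TT_LSeries _ hs,
        DirichletCharacter.LFunction_modOne_eq]
      simp only [hG]
      rw [Zf_of_ne hs1]; ring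
    have hG0 : G β = 0 := by simp only [hG, hz]; simp
    have hfin := H G (siegelA χ₁ χ) (7203 * (q₁:ℝ)^2 * (q:ℝ)^2) hGd
      (fun n => siegelA_nonneg h₁2 h2 n) (siegelA_one _ _) hsum heq (by
        have : (1:ℝ) ≤ (q₁:ℝ)^2 := one_le_pow₀ hq1'
        have : (1:ℝ) ≤ (q:ℝ)^2 := one_le_pow₀ hq1
        nlinarith) (by
        intro s hs
        simp only [hG, norm_mul]
        have b4 := norm_LFunction_ball hψ hs
        push_cast at b4
        calc _ ≤ (21 * (7 * (q₁:ℝ))) * ((7 * (q:ℝ)) * (7 * ((q₁:ℝ) * q))) := by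
              gcongr
              · exact norm_Zf_ball hs
              · exact norm_LFunction_ball hχ₁ hs
              · exact norm_LFunction_ball hχ hs
          _ = _ := by ring) β (by linarith) hβ1 (by rw [hG0]; simp)
    have hL4 : ‖DirichletCharacter.LFunction (prodChar χ₁ χ) 1‖ ≤ (q₁:ℝ) ^ θ / θ * (q:ℝ) ^ θ := by
      have := norm_LFunction_le hψ hθ.le hθ1 (s := 1) (by simp; exact hθ)
      refine this.trans (le_of_eq ?_)
      push_cast
      rw [Real.mul_rpow (by linarith) (by linarith)]
      simp; ring
    have hG1 : ‖G 1‖ = L₁ * (‖DirichletCharacter.LFunction χ 1‖ *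
        ‖DirichletCharacter.LFunction (prodChar χ₁ χ) 1‖) := by
      simp only [hG, Zf_one, one_mul, norm_mul, hL₁]
    have hlow : c * (1 - β) * ((7203 * (q₁:ℝ)^2) ^ (-(4 * δ')) * (q:ℝ) ^ (-(8 * δ'))) ≤ ‖G 1‖ := by
      refine le_trans ?_ hfin
      gcongr
      have e : (q:ℝ) ^ (-(8 * δ')) = ((q:ℝ)^2) ^ (-(4 * δ')) := by
        rw [← Real.rpow_natCast, ← Real.rpow_mul (by linarith)]; congr 1; push_cast; ring
      rw [e, ← Real.mul_rpow (by positivity) (by positivity)]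
      apply Real.rpow_le_rpow_of_exponent_le
      · have : (1:ℝ) ≤ (q₁:ℝ)^2 := one_le_pow₀ hq1'
        have : (1:ℝ) ≤ (q:ℝ)^2 := one_le_pow₀ hq1
        nlinarith
      · linarith
    have hqθ : 0 < (q:ℝ) ^ θ := by positivity
    have h5 : c₂ * (L₁ * ((q₁:ℝ) ^ θ / θ)) * (q:ℝ) ^ (-(8 * δ')) ≤
        L₁ * ‖DirichletCharacter.LFunction χ 1‖ * ((q₁:ℝ) ^ θ / θ * (q:ℝ) ^ θ) := by
      have e : c₂ * (L₁ * ((q₁:ℝ) ^ θ / θ)) = c * (1 - β) * (7203 * (q₁:ℝ) ^ 2) ^ (-(4 * δ')) := by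
        rw [hc₂]; apply div_mul_cancel₀; positivity
      rw [e, mul_assoc]
      refine hlow.trans ?_
      rw [hG1, ← mul_assoc]
      gcongr
    have h6 : c₂ * (q:ℝ) ^ (-(8 * δ' + θ)) ≤ ‖DirichletCharacter.LFunction χ 1‖ := by
      have e : (q:ℝ) ^ (-(8 * δ' + θ)) = (q:ℝ) ^ (-(8 * δ')) / (q:ℝ) ^ θ := by
        rw [← Real.rpow_sub (by linarith)]; congr 1; ring
      rw [e, ← mul_div_assoc, div_le_iff₀ hqθ]
      have hP : 0 < L₁ * ((q₁:ℝ) ^ θ / θ) := by positivity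
      refine le_of_mul_le_mul_left ?_ hP
      calc _ = _ := by ring
        _ ≤ _ := h5
        _ = _ := by ring
    refine le_trans ?_ h6
    gcongr
    exact min_le_right _ _

theorem siegel (δ : ℝ) (hδ : 0 < δ) : ∃ c : ℝ, 0 < c ∧ ∀ (q : ℕ) [NeZero q], q.Prime →
    ∀ χ : DirichletCharacter ℂ q, χ ≠ 1 → χ ^ 2 = 1 →
      c * (q:ℝ) ^ (-δ) ≤ ‖DirichletCharacter.LFunction χ 1‖ := by
  have hev : ∀ᶠ x : ℝ in 𝓝 1, Zf x ≠ 0 := by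
    have hc : Continuous (fun x : ℝ => Zf x) :=
      Zf_differentiable.continuous.comp Complex.continuous_ofReal
    apply hc.continuousAt.eventually_ne
    rw [Complex.ofReal_one, Zf_one]; exact one_ne_zero
  obtain ⟨ε, hε, hεZ⟩ := Metric.eventually_nhds_iff.1 hev
  set δ' := min (min (ε/2) (1/8)) (min (δ/16) (δ/2)) with hδ'
  have hδ'pos : 0 < δ' := by positivity
  have d1 : δ' ≤ ε/2 := (min_le_left _ _).trans (min_le_left _ _)
  have d2 : δ' ≤ 1/8 := (min_le_left _ _).trans (min_le_right _ _)
  have d3 : δ' ≤ δ/16 := (min_le_right _ _).trans (min_le_left _ _)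
  have hmono : ∀ {e : ℝ}, e ≤ δ → ∀ q : ℕ, q.Prime → (q:ℝ) ^ (-δ) ≤ (q:ℝ) ^ (-e) := by
    intro e he q hq
    apply Real.rpow_le_rpow_of_exponent_le
    · exact_mod_cast hq.one_lt.le
    · linarith
  by_cases hA : ∃ (q₁ : ℕ) (_ : NeZero q₁) (_ : q₁.Prime) (χ₁ : DirichletCharacter ℂ q₁) (β : ℝ),
      χ₁ ≠ 1 ∧ χ₁ ^ 2 = 1 ∧ 1 - δ' < β ∧ β < 1 ∧ DirichletCharacter.LFunction χ₁ β = 0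
  · obtain ⟨q₁, _, hq₁, χ₁, β, h1, h2, h3, h4, h5⟩ := hA
    have hmin : min (δ/2) 1 ≤ δ/2 := min_le_left _ _
    obtain ⟨c, hc, H⟩ := siegel_A δ' (min (δ/2) 1) hδ'pos d2 (by positivity) (min_le_right _ _) q₁
      hq₁ χ₁ h1 h2 β h3 h4 h5
    refine ⟨c, hc, fun q _ hq χ hχ hχ2 => le_trans ?_ (H q hq χ hχ hχ2)⟩
    exact mul_le_mul_of_nonneg_left (hmono (e := 8 * δ' + min (δ/2) 1) (by linarith) q hq) hc.le
  · push Not at hA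
    obtain ⟨c, hc, H⟩ := siegel_B δ' hδ'pos d2 (by
      intro x hx1 hx2
      apply hεZ
      rw [Real.dist_eq, abs_lt]; constructor <;> linarith) (by
      intro q _ hq χ h1 h2 β h3 h4
      exact hA q inferInstance hq χ β h1 h2 h3 h4)
    refine ⟨c, hc, fun q _ hq χ hχ hχ2 => le_trans ?_ (H q hq χ hχ hχ2)⟩
    exact mul_le_mul_of_nonneg_left (hmono (e := 2 * δ') (by linarith) q hq) hc.le

end SW

namespace SW
open MeasureTheory Set Filter Topology

lemma lower_of_341 {H : ℂ → ℂ} (hH : Differentiable ℂ H) {t M : ℝ} (hM : 1 ≤ M)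
    (h341 : ∀ x : ℝ, 0 < x → x ≤ 2 → x ^ 3 ≤ M * ‖H (1 + x + Complex.I * t)‖ ^ 4)
    (hd : ∀ z : ℂ, z.im = t → 1 - 1 / M ≤ z.re → z.re ≤ 3 → ‖deriv H z‖ ≤ M)
    {s : ℂ} (hst : s.im = t) (hs1 : 1 - 1 / (256 * M ^ 5) ≤ s.re) (hs3 : s.re ≤ 3) :
    1 ≤ 256 * M ^ 5 * ‖H s‖ := by
  have hM0 : 0 < M := by linarith
  set x₀ : ℝ := 1 / (256 * M ^ 5) with hx₀
  have hx₀pos : 0 < x₀ := by positivity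
  have hM5 : 1 ≤ M ^ 5 := one_le_pow₀ hM
  have hx₀M : x₀ ≤ 1 / M := by
    rw [hx₀]; apply one_div_le_one_div_of_le hM0
    have : M ≤ M ^ 5 := le_self_pow₀ hM (by norm_num)
    linarith
  have hx₀1 : x₀ ≤ 1/256 := by
    rw [hx₀]; apply one_div_le_one_div_of_le (by norm_num); linarith
  have hx₀eq : x₀ * (256 * M ^ 5) = 1 := by rw [hx₀]; field_simp
  have big : ∀ x : ℝ, x₀ ≤ x → x ≤ 2 → 1 ≤ 64 * M ^ 4 * ‖H (1 + x + Complex.I * t)‖ := by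
    intro x hx hx2
    have h1 := h341 x (by linarith) hx2
    set n := ‖H (1 + x + Complex.I * t)‖ with hn
    have hn0 : 0 ≤ n := norm_nonneg _
    by_contra hlt
    push Not at hlt
    have h2 : (64 * M ^ 4 * n) ^ 4 < 1 := pow_lt_one₀ (by positivity) hlt (by norm_num)
    have h3 : x₀ ^ 3 ≤ x ^ 3 := by gcongr
    have h4 : (x₀ * (256 * M ^ 5)) ^ 3 = 1 := by rw [hx₀eq]; norm_num
    have h5 : (64 * M ^ 4 * n) ^ 4 = (256 * M ^ 5) ^ 3 * (M * n ^ 4) := by ring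
    have h6 : (256 * M ^ 5) ^ 3 * x₀ ^ 3 ≤ (256 * M ^ 5) ^ 3 * (M * n ^ 4) := by
      gcongr; linarith
    nlinarith
  have h45 : M ^ 4 ≤ M ^ 5 := pow_le_pow_right₀ hM (by norm_num)
  have hes : s = 1 + ((s.re - 1 : ℝ) : ℂ) + Complex.I * t := by
    apply Complex.ext <;> simp [hst]
  rcases le_or_gt (1 + x₀) s.re with h | h
  · have := big (s.re - 1) (by linarith) (by linarith)
    rw [← hes] at this
    refine this.trans ?_
    have := norm_nonneg (H s)
    gcongr
    norm_num
  · set z : ℂ := 1 + (x₀ : ℂ) + Complex.I * t with hz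
    have hzre : z.re = 1 + x₀ := by simp [hz]
    have hzim : z.im = t := by simp [hz]
    have hb := big x₀ le_rfl (by linarith)
    have hmv := Convex.norm_image_sub_le_of_norm_deriv_le (f := H) (C := M)
      (s := {w : ℂ | w.im = t ∧ (1 - 1 / M ≤ w.re ∧ w.re ≤ 3)}) (x := z) (y := s)
      (fun w _ => hH w) (fun w hw => hd w hw.1 hw.2.1 hw.2.2) (by
        apply Convex.inter
        · exact convex_hyperplane (f := Complex.im) Complex.imLm.isLinear t
        · apply Convex.inter
          · exact convex_halfSpace_re_ge _
          · exact convex_halfSpace_re_le _)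
      ⟨hzim, by rw [hzre]; constructor <;> [(have : 0 < 1 / M := by positivity); skip] <;> linarith⟩
      ⟨hst, by linarith, hs3⟩
    have hsz : ‖s - z‖ ≤ 2 * x₀ := by
      have : s - z = ((s.re - (1 + x₀) : ℝ) : ℂ) := by
        apply Complex.ext
        · rw [Complex.sub_re, hzre, Complex.ofReal_re]
        · rw [Complex.sub_im, hzim, hst, Complex.ofReal_im]; ring
      rw [this, Complex.norm_real, Real.norm_eq_abs, abs_le]
      constructor <;> linarith
    have h1 : ‖H z‖ ≤ ‖H s‖ + ‖H s - H z‖ := by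
      have := norm_sub_le (H s) (H s - H z)
      rwa [sub_sub_cancel] at this
    have h2 : ‖H s - H z‖ ≤ M * (2 * x₀) := hmv.trans (by gcongr)
    have h3 : 64 * M ^ 4 * (M * (2 * x₀)) = 1/2 := by
      have : 64 * M ^ 4 * (M * (2 * x₀)) = x₀ * (256 * M ^ 5) / 2 := by ring
      rw [this, hx₀eq]
    have h4 : 1 ≤ 64 * M ^ 4 * ‖H s‖ + 1/2 := by
      rw [← h3, ← mul_add]
      refine hb.trans ?_
      gcongr
      linarith
    have h5 : 64 * M ^ 4 * ‖H s‖ ≤ 64 * M ^ 5 * ‖H s‖ := by gcongr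
    nlinarith

lemma zeta_one_add_le {x : ℝ} (hx : 0 < x) (hx2 : x ≤ 2) (t : ℝ) :
    ‖riemannZeta (1 + x + Complex.I * t)‖ ≤ 1 / ‖(x:ℂ) + Complex.I * t‖ + (7 + 2 * |t|) := by
  have hne : (1 + x + Complex.I * t : ℂ) ≠ 1 := by
    intro h
    have := congrArg Complex.re h
    simp at this
    linarith
  have h := norm_zeta_le (s := 1 + x + Complex.I * t) (by simp; linarith) hne
  have e : (1 + x + Complex.I * t : ℂ) - 1 = x + Complex.I * t := by ring
  rw [e] at h
  refine h.trans ?_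
  have : ‖(1 + x + Complex.I * t : ℂ)‖ ≤ 1 + x + |t| := by
    refine (norm_add_le _ _).trans ?_
    refine add_le_add ((norm_add_le _ _).trans ?_) ?_
    · simp [abs_of_pos hx]
    · simp
  linarith

lemma norm_x_add_ge {x : ℝ} (hx : 0 < x) (t : ℝ) :
    x ≤ ‖(x:ℂ) + Complex.I * t‖ ∧ |t| ≤ ‖(x:ℂ) + Complex.I * t‖ := by
  constructor
  · have := Complex.abs_re_le_norm ((x:ℂ) + Complex.I * t)
    simp at this
    exact (le_abs_self x).trans this
  · have := Complex.abs_im_le_norm ((x:ℂ) + Complex.I * t)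
    simpa using this

lemma triv_le {q : ℕ} [NeZero q] (hq : q.Prime) {x : ℝ} (hx : 0 < x) (hx2 : x ≤ 2) (t : ℝ) :
    ‖DirichletCharacter.LFunctionTrivChar q (1 + x + Complex.I * t)‖ ≤
      2 * (1 / ‖(x:ℂ) + Complex.I * t‖ + (7 + 2 * |t|)) := by
  have hne : (1 + x + Complex.I * t : ℂ) ≠ 1 := by
    intro h
    have := congrArg Complex.re h
    simp at this
    linarith
  rw [DirichletCharacter.LFunctionTrivChar_eq_mul_riemannZeta hne, norm_mul]
  gcongr
  · rw [hq.primeFactors, Finset.prod_singleton]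
    refine (norm_sub_le _ _).trans ?_
    rw [norm_one]
    have : ‖(q:ℂ) ^ (-(1 + x + Complex.I * t : ℂ))‖ ≤ 1 := by
      rw [Complex.norm_natCast_cpow_of_pos hq.pos]
      apply Real.rpow_le_one_of_one_le_of_nonpos
      · exact_mod_cast hq.one_lt.le
      · simp; linarith
    linarith
  · exact zeta_one_add_le hx hx2 t

lemma triv_le_real {q : ℕ} [NeZero q] (hq : q.Prime) {x : ℝ} (hx : 0 < x) (hx2 : x ≤ 2) :
    ‖DirichletCharacter.LFunctionTrivChar q (1 + x)‖ ≤ 30 / x := by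
  have h := triv_le hq hx hx2 0
  simp only [Complex.ofReal_zero, mul_zero, add_zero, abs_zero] at h
  refine h.trans ?_
  rw [Complex.norm_real, Real.norm_eq_abs, abs_of_pos hx]
  rw [le_div_iff₀ hx]
  field_simp
  linarith

lemma LFunction_341 {q : ℕ} [NeZero q] (hq : q.Prime) (χ : DirichletCharacter ℂ q) {x : ℝ}
    (hx : 0 < x) (hx2 : x ≤ 2) (t : ℝ) :
    x ^ 3 ≤ 27000 * (‖DirichletCharacter.LFunction χ (1 + x + Complex.I * t)‖ ^ 4 *
      ‖DirichletCharacter.LFunction (χ ^ 2) (1 + x + 2 * Complex.I * t)‖) := by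
  have h := DirichletCharacter.norm_LFunction_product_ge_one χ hx t
  rw [norm_mul, norm_mul, norm_pow, norm_pow] at h
  have h1 := triv_le_real hq hx hx2
  set a := ‖DirichletCharacter.LFunction χ (1 + x + Complex.I * t)‖
  set b := ‖DirichletCharacter.LFunction (χ ^ 2) (1 + x + 2 * Complex.I * t)‖
  have hb : 0 ≤ b := norm_nonneg _
  have ha : 0 ≤ a := norm_nonneg _
  have h2 : 1 ≤ (30 / x) ^ 3 * a ^ 4 * b := by
    refine h.le.trans ?_
    gcongr
  have h3 : (30 / x) ^ 3 * a ^ 4 * b = 27000 * (a ^ 4 * b) / x ^ 3 := by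
    field_simp; ring
  rw [h3, le_div_iff₀ (by positivity)] at h2
  linarith

lemma norm_deriv_LFunction_le {N : ℕ} [NeZero N] {χ : DirichletCharacter ℂ N} (hχ : χ ≠ 1) {θ : ℝ}
    (hθ : 0 < θ) (hθ1 : θ ≤ 1) {s : ℂ} (hs : 1 - θ/4 ≤ s.re) (hs3 : s.re ≤ 3) :
    ‖deriv (DirichletCharacter.LFunction χ) s‖ ≤ 8 / θ ^ 2 * N ^ θ * (4 + |s.im|) := by
  have hns : ‖s‖ ≤ 3 + |s.im| := by
    refine (Complex.norm_le_abs_re_add_abs_im s).trans ?_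
    gcongr
    rw [abs_le]; constructor <;> linarith
  have := Complex.norm_deriv_le_of_forall_mem_sphere_norm_le (c := s) (R := θ/4)
    (f := DirichletCharacter.LFunction χ) (C := (4 + |s.im|) * (N ^ θ / (θ/2))) (by linarith)
    (DirichletCharacter.differentiable_LFunction hχ).diffContOnCl (by
      intro z hz
      have hz' : ‖z - s‖ = θ/4 := by simpa [dist_eq_norm] using hz
      have hre : |(z - s).re| ≤ θ/4 := hz' ▸ Complex.abs_re_le_norm _
      rw [Complex.sub_re, abs_le] at hre
      have hzn : ‖z‖ ≤ 4 + |s.im| := by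
        have := norm_add_le (z - s) s
        rw [sub_add_cancel] at this
        linarith
      refine (norm_LFunction_le hχ hθ.le hθ1 (s := z) (by linarith)).trans ?_
      have hd : (N:ℝ) ^ θ / (z.re - (1 - θ)) ≤ N ^ θ / (θ/2) := by
        gcongr; linarith
      have h0 : 0 ≤ (N:ℝ) ^ θ / (z.re - (1 - θ)) := by
        apply div_nonneg (by positivity); linarith
      exact mul_le_mul hzn hd h0 (by positivity))
  refine this.trans (le_of_eq ?_)
  field_simp
  ring

end SW

namespace SW
open MeasureTheory Set Filter Topology

/-- lower bound and derivative bound near the 1-line -/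
def Good (H : ℂ → ℂ) (C : ℝ) (A : ℕ) : Prop :=
  1 ≤ C ∧ Differentiable ℂ H ∧ ∀ s : ℂ, 1 - 1 / (C * (4 + |s.im|) ^ A) ≤ s.re → s.re ≤ 3 →
    1 ≤ C * (4 + |s.im|) ^ A * ‖H s‖ ∧ ‖deriv H s‖ ≤ C * (4 + |s.im|) ^ A

set_option maxHeartbeats 2000000 in
theorem good_L (δ : ℝ) (hδ : 0 < δ) : ∃ C : ℝ, 1 ≤ C ∧ ∀ (q : ℕ) [NeZero q], q.Prime →
    ∀ χ : DirichletCharacter ℂ q, χ ≠ 1 →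
      Good (DirichletCharacter.LFunction χ) (C * (q:ℝ) ^ δ) 5 := by
  set θ := min (δ/15) 1 with hθ
  have hθ0 : 0 < θ := by positivity
  have hθ1 : θ ≤ 1 := min_le_right _ _
  have hθδ : 15 * θ ≤ δ := by have : θ ≤ δ/15 := min_le_left _ _; linarith
  obtain ⟨c', hc', H⟩ := siegel θ hθ0
  set c := min c' 1 with hc
  have hc0 : 0 < c := by positivity
  have hc1 : c ≤ 1 := min_le_right _ _
  have hcc : c ≤ c' := min_le_left _ _
  set C₁ : ℝ := 40000000 / (c * θ ^ 2) with hC₁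
  have hcθ : c * θ ^ 2 ≤ 1 := by
    have : θ ^ 2 ≤ 1 := pow_le_one₀ hθ0.le hθ1
    nlinarith
  have hcθ0 : 0 < c * θ ^ 2 := by positivity
  have hC₁big : 40000000 ≤ C₁ := by
    rw [hC₁, le_div_iff₀ hcθ0]; nlinarith
  have hC₁θ : 40000000 / θ ^ 2 ≤ C₁ := by
    rw [hC₁]
    gcongr
    nlinarith [sq_nonneg θ]
  have hθθ : 1 / θ ≤ 1 / θ ^ 2 := by
    apply one_div_le_one_div_of_le (by positivity)
    nlinarith
  refine ⟨256 * C₁ ^ 5, ?_, ?_⟩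
  · have : 1 ≤ C₁ ^ 5 := one_le_pow₀ (by linarith)
    linarith
  intro q _ hq χ hχ
  have hq1 : (1:ℝ) ≤ q := by exact_mod_cast hq.one_lt.le
  have hqδ : 1 ≤ (q:ℝ) ^ δ := Real.one_le_rpow hq1 hδ.le
  set Q := (q:ℝ) ^ θ with hQ
  have hQ1 : 1 ≤ Q := Real.one_le_rpow hq1 hθ0.le
  have hQδ : Q ^ 15 ≤ (q:ℝ) ^ δ := by
    rw [hQ, ← Real.rpow_natCast, ← Real.rpow_mul (by linarith)]
    apply Real.rpow_le_rpow_of_exponent_le hq1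
    push_cast; linarith
  refine ⟨?_, DirichletCharacter.differentiable_LFunction hχ, ?_⟩
  · have : 1 ≤ C₁ ^ 5 := one_le_pow₀ (by linarith)
    exact one_le_mul_of_one_le_of_one_le (by linarith) hqδ
  intro s hs1 hs3
  set t := s.im with ht
  set T := 4 + |t| with hT
  have hT4 : 4 ≤ T := by have := abs_nonneg t; linarith
  set M := C₁ * Q ^ 3 * T with hM
  have hQ3 : 1 ≤ Q ^ 3 := one_le_pow₀ hQ1
  have hQQ3 : Q ≤ Q ^ 3 := le_self_pow₀ hQ1 (by norm_num)
  have hMC : C₁ ≤ M := by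
    rw [hM, mul_assoc]
    have : 1 ≤ Q ^ 3 * T := one_le_mul_of_one_le_of_one_le hQ3 (by linarith)
    exact le_mul_of_one_le_right (by linarith) this
  have hM1 : 1 ≤ M := by linarith
  have hMQ : 40000000 / θ ^ 2 * Q * T ≤ M := by
    rw [hM]; gcongr
  -- B ≥ 256 M^5
  have hB : 256 * M ^ 5 ≤ 256 * C₁ ^ 5 * (q:ℝ) ^ δ * T ^ 5 := by
    calc 256 * M ^ 5 = 256 * C₁ ^ 5 * Q ^ 15 * T ^ 5 := by rw [hM]; ring
      _ ≤ _ := by gcongr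
  set B := 256 * C₁ ^ 5 * (q:ℝ) ^ δ * T ^ 5 with hBdef
  have hM5 : M ≤ M ^ 5 := le_self_pow₀ hM1 (by norm_num)
  have hMB : M ≤ B := by linarith
  have hBinv : 1 / B ≤ 1 / (256 * M ^ 5) := one_div_le_one_div_of_le (by positivity) hB
  have hMinv : 1 / (256 * M ^ 5) ≤ 1 / M := one_div_le_one_div_of_le (by positivity) (by linarith)
  have hMθ : 1 / M ≤ θ / 4 := by
    rw [div_le_div_iff₀ (by linarith) (by norm_num)]
    have : 40000000 / θ ^ 2 ≤ M := hC₁θ.trans hMC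
    have h2 : 40000000 / θ ^ 2 * θ ≤ θ * M := by
      rw [mul_comm θ]; gcongr
    have h3 : 40000000 ≤ 40000000 / θ ^ 2 * θ := by
      have : 40000000 / θ ^ 2 * θ = 40000000 / θ := by field_simp
      rw [this, le_div_iff₀ hθ0]; linarith
    linarith
  have hderiv : ∀ z : ℂ, z.im = t → 1 - 1 / M ≤ z.re → z.re ≤ 3 →
      ‖deriv (DirichletCharacter.LFunction χ) z‖ ≤ M := by
    intro z hz h1 h3
    refine (norm_deriv_LFunction_le hχ hθ0 hθ1 (by linarith) h3).trans ?_
    refine le_trans ?_ hMQ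
    rw [hz, ← hT, ← hQ]
    gcongr
    norm_num
  refine ⟨?_, (hderiv s rfl (by linarith) hs3).trans hMB⟩
  suffices h : 1 ≤ 256 * M ^ 5 * ‖DirichletCharacter.LFunction χ s‖ by
    refine h.trans ?_
    gcongr
  have key : (∀ x : ℝ, 0 < x → x ≤ 2 →
      27000 * ‖DirichletCharacter.LFunction (χ ^ 2) (1 + x + 2 * Complex.I * t)‖ ≤ M) →
      1 ≤ 256 * M ^ 5 * ‖DirichletCharacter.LFunction χ s‖ := by
    intro hk
    refine lower_of_341 (t := t) (DirichletCharacter.differentiable_LFunction hχ) hM1 ?_ hderiv rfl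
      (by linarith) hs3
    intro x hx hx2
    refine (LFunction_341 hq χ hx hx2 t).trans ?_
    have h1 := hk x hx hx2
    calc _ = (27000 * ‖DirichletCharacter.LFunction (χ ^ 2) (1 + x + 2 * Complex.I * t)‖) *
          ‖DirichletCharacter.LFunction χ (1 + x + Complex.I * t)‖ ^ 4 := by ring
      _ ≤ _ := by gcongr
  by_cases h2 : χ ^ 2 = 1
  · set τ : ℝ := c * θ ^ 2 / 160 / Q ^ 2 with hτ
    have hτ0 : 0 < τ := by positivity
    have hτ1 : τ ≤ 1 / 160 := by
      rw [hτ, div_div, div_le_div_iff₀ (by positivity) (by norm_num)]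
      have : 1 ≤ Q ^ 2 := one_le_pow₀ hQ1
      linarith
    have hτM : 36000000 / τ / 160 ≤ M / T := by
      have e1 : 36000000 / τ / 160 = 36000000 / (c * θ ^ 2) * Q ^ 2 := by
        rw [hτ]; field_simp
      have e2 : M / T = C₁ * Q ^ 3 := by rw [hM]; field_simp
      rw [e1, e2, hC₁]
      have : Q ^ 2 ≤ Q ^ 3 := pow_le_pow_right₀ hQ1 (by norm_num)
      gcongr
      norm_num
    have hτM' : 225000 / τ * T ≤ M := by
      rw [le_div_iff₀ (by linarith)] at hτM
      calc 225000 / τ * T = 36000000 / τ / 160 * T := by ring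
        _ ≤ M := hτM
    have htriv : ∀ x : ℝ, 0 < x → x ≤ 2 → ‖DirichletCharacter.LFunction (χ ^ 2)
        (1 + x + 2 * Complex.I * t)‖ ≤
        2 * (1 / ‖(x:ℂ) + Complex.I * ((2 * t : ℝ) : ℂ)‖ + (7 + 2 * |2 * t|)) := by
      intro x hx hx2
      have := triv_le hq hx hx2 (2 * t)
      rw [h2]
      have e : (1 + x + 2 * Complex.I * t : ℂ) = 1 + x + Complex.I * ((2 * t : ℝ) : ℂ) := by
        push_cast; ring
      rw [e]
      exact this
    have h2t : |2 * t| = 2 * |t| := by rw [abs_mul]; norm_num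
    have hTτ : T ≤ T / τ / 160 := by
      rw [div_div, le_div_iff₀ (by positivity)]
      exact mul_le_of_le_one_right (by linarith) (by linarith)
    rcases le_or_gt τ |t| with htτ | htτ
    · apply key
      intro x hx hx2
      have h3 := htriv x hx hx2
      have h4 := (norm_x_add_ge hx (2 * t)).2
      have h5 : 1 / ‖(x:ℂ) + Complex.I * ((2 * t : ℝ) : ℂ)‖ ≤ 1 / τ := by
        apply one_div_le_one_div_of_le hτ0
        linarith
      have h6 : 1 / τ ≤ T / τ / 4 := by
        rw [div_div, div_le_div_iff₀ hτ0 (by positivity)]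
        have := mul_le_mul_of_nonneg_right hT4 hτ0.le
        linarith
      have h7 : 225000 / τ * T = 225000 * (T / τ) := by ring
      have h8 : 0 < T / τ := by positivity
      rw [h7] at hτM'
      linarith
    · -- |t| < τ
      have hDB : 1 / (256 * M ^ 5) ≤ τ := by
        have h3 : 225000 / τ ≤ M := by
          have : 0 < 225000 / τ := by positivity
          exact (le_mul_of_one_le_right this.le (by linarith)).trans hτM'
        have h4 : 1 / τ ≤ 256 * M ^ 5 := by
          have : 1 / τ ≤ 225000 / τ := by gcongr; norm_num
          linarith
        rw [one_div_le (by positivity) hτ0]; exact h4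
      rcases le_or_gt s.re (1 + τ) with hsr | hsr
      · -- Siegel
        have hsie := H q hq χ hχ h2
        have hT5 : T ≤ 5 := by linarith
        have hmv := Convex.norm_image_sub_le_of_norm_deriv_le (f := DirichletCharacter.LFunction χ)
          (C := 8 / θ ^ 2 * Q * 5)
          (s := {w : ℂ | (1 - θ/4 ≤ w.re ∧ w.re ≤ 3) ∧ (-1 ≤ w.im ∧ w.im ≤ 1)}) (x := 1) (y := s)
          (fun w _ => DirichletCharacter.differentiable_LFunction hχ w) (fun w hw => by
            refine (norm_deriv_LFunction_le hχ hθ0 hθ1 hw.1.1 hw.1.2).trans ?_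
            rw [← hQ]
            gcongr
            have : |w.im| ≤ 1 := abs_le.2 hw.2
            linarith) (by
            apply Convex.inter
            · apply Convex.inter
              · exact convex_halfSpace_re_ge _
              · exact convex_halfSpace_re_le _
            · apply Convex.inter
              · exact convex_halfSpace_im_ge _
              · exact convex_halfSpace_im_le _)
          (by simp; linarith)
          (by
            have := abs_lt.1 htτ
            refine ⟨⟨by linarith, hs3⟩, ?_, ?_⟩ <;> rw [← ht] <;> linarith)
        have hsn : ‖s - 1‖ ≤ 2 * τ := by
          refine (Complex.norm_le_abs_re_add_abs_im _).trans ?_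
          have h3 : |(s - 1).re| ≤ τ := by
            rw [Complex.sub_re, Complex.one_re, abs_le]; constructor <;> linarith
          have h4 : |(s - 1).im| ≤ τ := by
            rw [Complex.sub_im, Complex.one_im, sub_zero]; exact htτ.le
          linarith
        have h3 : ‖DirichletCharacter.LFunction χ s - DirichletCharacter.LFunction χ 1‖ ≤
            c / Q / 2 := by
          refine hmv.trans ?_
          calc 8 / θ ^ 2 * Q * 5 * ‖s - 1‖ ≤ 8 / θ ^ 2 * Q * 5 * (2 * τ) := by gcongr
            _ = c / Q / 2 := by rw [hτ]; field_simp; norm_num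
        have h4 : c / Q ≤ ‖DirichletCharacter.LFunction χ 1‖ := by
          refine le_trans ?_ hsie
          rw [Real.rpow_neg (by linarith), ← hQ, div_eq_mul_inv]
          gcongr
        have h5 : c / Q / 2 ≤ ‖DirichletCharacter.LFunction χ s‖ := by
          have := norm_sub_le (DirichletCharacter.LFunction χ s)
            (DirichletCharacter.LFunction χ s - DirichletCharacter.LFunction χ 1)
          rw [sub_sub_cancel] at this
          linarith
        have h6 : 2 * Q / c ≤ M := by
          have e1 : 2 * Q / c ≤ C₁ * Q := by
            rw [div_le_iff₀ hc0, hC₁]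
            have : 40000000 / (c * θ ^ 2) * Q * c = 40000000 / θ ^ 2 * Q := by field_simp
            rw [this]
            gcongr
            rw [le_div_iff₀ (by positivity)]
            have : θ ^ 2 ≤ 1 := pow_le_one₀ hθ0.le hθ1
            linarith
          have e2 : C₁ * Q ≤ M := by
            rw [hM, mul_assoc]
            gcongr
            exact hQQ3.trans (le_mul_of_one_le_right (by positivity) (by linarith))
          linarith
        calc (1:ℝ) = 2 * Q / c * (c / Q / 2) := by field_simp
          _ ≤ (256 * M ^ 5) * ‖DirichletCharacter.LFunction χ s‖ := by
            apply mul_le_mul _ h5 (by positivity) (by positivity)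
            linarith
      · -- Re s > 1 + τ
        have hx : 0 < s.re - 1 := by linarith
        have hx2 : s.re - 1 ≤ 2 := by linarith
        have h3 := LFunction_341 hq χ hx hx2 t
        have h4 := htriv _ hx hx2
        have h5 := (norm_x_add_ge hx (2 * t)).1
        have hes : s = 1 + ((s.re - 1 : ℝ) : ℂ) + Complex.I * t := by
          apply Complex.ext <;> simp [ht]
        rw [← hes] at h3
        set x := s.re - 1 with hxdef
        set n := ‖DirichletCharacter.LFunction χ s‖ with hn
        have hn0 : 0 ≤ n := norm_nonneg _
        have h6 : 1 / ‖(x:ℂ) + Complex.I * ((2 * t : ℝ) : ℂ)‖ ≤ 1 / x :=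
          one_div_le_one_div_of_le hx h5
        have h7 : ‖DirichletCharacter.LFunction (χ ^ 2) (1 + x + 2 * Complex.I * t)‖ ≤ 46 / x := by
          have : (11:ℝ) ≤ 22 / x := by rw [le_div_iff₀ hx]; linarith
          have e : 46 / x = 2 * (1 / x + 22 / x) := by ring
          rw [e]
          linarith
        have h8 : x ^ 3 ≤ 27000 * (n ^ 4 * (46 / x)) := h3.trans (by gcongr)
        have h9 : x ^ 4 ≤ (36 * n) ^ 4 := by
          have : 27000 * (n ^ 4 * (46 / x)) = 1242000 * n ^ 4 / x := by ring
          rw [this, le_div_iff₀ hx] at h8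
          have := pow_nonneg hn0 4
          have e1 : (36 * n) ^ 4 = 1679616 * n ^ 4 := by ring
          have e2 : x ^ 4 = x ^ 3 * x := by ring
          rw [e1, e2]
          linarith
        have h10 : x ≤ 36 * n := le_of_pow_le_pow_left₀ (by norm_num) (by positivity) h9
        have h11 : τ ≤ 36 * n := by linarith
        have h12 : 36 / τ ≤ M := by
          have : 36 / τ ≤ 225000 / τ := by gcongr; norm_num
          have h0 : 0 < 225000 / τ := by positivity
          exact this.trans ((le_mul_of_one_le_right h0.le (by linarith)).trans hτM')
        calc (1:ℝ) = 36 / τ * (τ / 36) := by field_simp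
          _ ≤ (256 * M ^ 5) * n := by
            apply mul_le_mul _ (by linarith) (by positivity) (by positivity)
            linarith
  · apply key
    intro x hx hx2
    have h3 := norm_LFunction_le h2 hθ0.le hθ1 (s := 1 + x + 2 * Complex.I * t) (by simp; linarith)
    have h4 : ‖(1 + x + 2 * Complex.I * t : ℂ)‖ ≤ 2 * T := by
      refine (norm_add_le _ _).trans ?_
      have a1 : ‖(1 + x : ℂ)‖ ≤ 3 := by
        refine (norm_add_le _ _).trans ?_
        simp [abs_of_pos hx]; linarith
      have a2 : ‖(2 * Complex.I * t : ℂ)‖ = 2 * |t| := by simp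
      rw [a2]; linarith
    have h5 : Q / ((1 + x + 2 * Complex.I * t : ℂ).re - (1 - θ)) ≤ Q / θ := by
      gcongr
      simp; linarith
    have h6 : 0 ≤ Q / ((1 + x + 2 * Complex.I * t : ℂ).re - (1 - θ)) := by
      apply div_nonneg (by positivity)
      simp; linarith
    have h7 : ‖DirichletCharacter.LFunction (χ ^ 2) (1 + x + 2 * Complex.I * t)‖ ≤ 2 * T * (Q / θ) :=
      h3.trans (mul_le_mul h4 h5 h6 (by positivity))
    calc _ ≤ 27000 * (2 * T * (Q / θ)) := by gcongr
      _ = 54000 * (1 / θ) * Q * T := by ring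
      _ ≤ 54000 * (1 / θ ^ 2) * Q * T := by gcongr
      _ ≤ 40000000 / θ ^ 2 * Q * T := by
        rw [mul_one_div]; gcongr; norm_num
      _ ≤ M := hMQ

end SW

namespace SW
open MeasureTheory Set Filter Topology

lemma norm_le_of_re_le {s : ℂ} {a : ℝ} (h1 : -a ≤ s.re) (h2 : s.re ≤ a) : ‖s‖ ≤ a + |s.im| := by
  refine (Complex.norm_le_abs_re_add_abs_im s).trans ?_
  gcongr
  exact abs_le.2 ⟨h1, h2⟩

lemma norm_deriv_Zf_le {s : ℂ} (hs : 3/4 ≤ s.re) (hs3 : s.re ≤ 3) :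
    ‖deriv Zf s‖ ≤ 16 * (4 + |s.im|) ^ 2 := by
  have hns : ‖s‖ ≤ 3 + |s.im| := norm_le_of_re_le (by linarith) hs3
  have h0 := abs_nonneg s.im
  have := Complex.norm_deriv_le_of_forall_mem_sphere_norm_le (c := s) (R := 1/4)
    (f := Zf) (C := 4 * (4 + |s.im|) ^ 2) (by norm_num)
    Zf_differentiable.diffContOnCl (by
      intro z hz
      have hz' : ‖z - s‖ = 1/4 := by simpa [dist_eq_norm] using hz
      have hre : |(z - s).re| ≤ 1/4 := hz' ▸ Complex.abs_re_le_norm _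
      rw [Complex.sub_re, abs_le] at hre
      have hzn : ‖z‖ ≤ 3.25 + |s.im| := by
        have := norm_add_le (z - s) s
        rw [sub_add_cancel] at this
        linarith
      have h1 := norm_Zf_sub_one_le (s := z) (by linarith)
      have h2 : ‖z - 1‖ ≤ 4.25 + |s.im| := by
        refine (norm_sub_le _ _).trans ?_
        rw [norm_one]; linarith
      have h3 : ‖Zf z‖ ≤ ‖Zf z - 1‖ + 1 := by
        have := norm_add_le (Zf z - 1) 1
        rwa [sub_add_cancel, norm_one] at this
      have h4 : ‖z - 1‖ * (1 + 2 * ‖z‖) ≤ (4.25 + |s.im|) * (1 + 2 * (3.25 + |s.im|)) := by gcongr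
      nlinarith)
  refine this.trans (le_of_eq ?_)
  ring

lemma zeta_341 {x : ℝ} (hx : 0 < x) (hx2 : x ≤ 2) (t : ℝ) :
    x ^ 3 ≤ 3375 * (‖riemannZeta (1 + x + Complex.I * t)‖ ^ 4 *
      ‖riemannZeta (1 + x + Complex.I * ((2 * t : ℝ) : ℂ))‖) := by
  have h := DirichletCharacter.norm_LFunction_product_ge_one (1 : DirichletCharacter ℂ 1) hx t
  rw [DirichletCharacter.LFunctionTrivChar, one_pow, DirichletCharacter.LFunction_modOne_eq,
    norm_mul, norm_mul, norm_pow, norm_pow] at h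
  have e : (1 + x + 2 * Complex.I * t : ℂ) = 1 + x + Complex.I * ((2 * t : ℝ) : ℂ) := by
    push_cast; ring
  rw [e] at h
  have h1 := zeta_one_add_le hx hx2 0
  simp only [Complex.ofReal_zero, mul_zero, add_zero, abs_zero] at h1
  have h1' : ‖riemannZeta (1 + x)‖ ≤ 15 / x := by
    refine h1.trans ?_
    rw [Complex.norm_real, Real.norm_eq_abs, abs_of_pos hx]
    rw [le_div_iff₀ hx]
    field_simp
    linarith
  set a := ‖riemannZeta (1 + x + Complex.I * t)‖
  set b := ‖riemannZeta (1 + x + Complex.I * ((2 * t : ℝ) : ℂ))‖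
  have hb : 0 ≤ b := norm_nonneg _
  have ha : 0 ≤ a := norm_nonneg _
  have h2 : 1 ≤ (15 / x) ^ 3 * a ^ 4 * b := by
    refine h.le.trans ?_
    gcongr
  have h3 : (15 / x) ^ 3 * a ^ 4 * b = 3375 * (a ^ 4 * b) / x ^ 3 := by
    field_simp; ring
  rw [h3, le_div_iff₀ (by positivity)] at h2
  linarith

lemma norm_zeta_le_Zf {s : ℂ} {r : ℝ} (hr : 0 < r) (h : 1 / r ≤ ‖s - 1‖) :
    ‖riemannZeta s‖ ≤ r * ‖Zf s‖ := by
  have h0 : 0 < 1 / r := by positivity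
  have hne : s ≠ 1 := by
    rintro rfl
    simp only [sub_self, norm_zero] at h
    linarith
  rw [Zf_of_ne hne, norm_mul, ← mul_assoc]
  apply le_mul_of_one_le_left (norm_nonneg _)
  calc (1:ℝ) = r * (1 / r) := by field_simp
    _ ≤ _ := by gcongr

theorem good_Z : ∃ C : ℝ, 1 ≤ C ∧ Good Zf C 10 := by
  set C₁ : ℝ := 3000000000 with hC₁
  refine ⟨256 * C₁ ^ 5, by norm_num [hC₁], by norm_num [hC₁], Zf_differentiable, ?_⟩
  intro s hs1 hs3
  set t := s.im with ht
  set T := 4 + |t| with hT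
  have hT4 : 4 ≤ T := by have := abs_nonneg t; linarith
  set M := C₁ * T ^ 2 with hM
  have hT2 : T ≤ T ^ 2 := le_self_pow₀ (by linarith) (by norm_num)
  have hMC : C₁ ≤ M := le_mul_of_one_le_right (by norm_num [hC₁]) (by linarith)
  have hM1 : 1 ≤ M := by refine le_trans ?_ hMC; norm_num [hC₁]
  have hB : 256 * M ^ 5 = 256 * C₁ ^ 5 * T ^ 10 := by rw [hM]; ring
  rw [← hB] at hs1 ⊢
  have hM5 : M ≤ M ^ 5 := le_self_pow₀ hM1 (by norm_num)
  have hMinv : 1 / (256 * M ^ 5) ≤ 1 / M := one_div_le_one_div_of_le (by positivity) (by linarith)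
  have hMs : 1 / M ≤ 1 / 3000000000 := one_div_le_one_div_of_le (by norm_num) hMC
  have hderiv : ∀ z : ℂ, z.im = t → 1 - 1 / M ≤ z.re → z.re ≤ 3 → ‖deriv Zf z‖ ≤ M := by
    intro z hz h1 h3
    refine (norm_deriv_Zf_le (by linarith) h3).trans ?_
    rw [hz, ← hT, hM, hC₁]
    gcongr
    norm_num
  refine ⟨?_, (hderiv s rfl (by linarith) hs3).trans (by linarith)⟩
  have h2t : |2 * t| = 2 * |t| := by rw [abs_mul]; norm_num
  rcases le_or_gt (1/20) |t| with htτ | htτ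
  · refine lower_of_341 (t := t) Zf_differentiable hM1 ?_ hderiv rfl hs1 hs3
    intro x hx hx2
    have h3 := zeta_341 hx hx2 t
    have h4 := zeta_one_add_le hx hx2 (2 * t)
    have h5 : 1 / ‖(x:ℂ) + Complex.I * ((2 * t : ℝ) : ℂ)‖ ≤ 1 / (1/10) := by
      apply one_div_le_one_div_of_le (by norm_num)
      have := (norm_x_add_ge hx (2 * t)).2
      linarith
    have h6 : ‖riemannZeta (1 + x + Complex.I * ((2 * t : ℝ) : ℂ))‖ ≤ 5 * T := by
      refine h4.trans ?_
      have h5' : (1:ℝ)/(1/10) = 10 := by norm_num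
      rw [h5'] at h5
      linarith
    have h7 : ‖riemannZeta (1 + x + Complex.I * t)‖ ≤ 20 * ‖Zf (1 + x + Complex.I * t)‖ := by
      apply norm_zeta_le_Zf (by norm_num)
      have := (norm_x_add_ge hx t).2
      have e : (1 + x + Complex.I * t : ℂ) - 1 = x + Complex.I * t := by ring
      rw [e]; linarith
    calc x ^ 3 ≤ _ := h3
      _ ≤ 3375 * ((20 * ‖Zf (1 + x + Complex.I * t)‖) ^ 4 * (5 * T)) := by gcongr
      _ = 2700000000 * T * ‖Zf (1 + x + Complex.I * t)‖ ^ 4 := by ring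
      _ ≤ M * ‖Zf (1 + x + Complex.I * t)‖ ^ 4 := by
        gcongr
        rw [hM, hC₁]
        linarith
  · have him : |(s-1).im| ≤ 1/20 := by
      rw [Complex.sub_im, Complex.one_im, sub_zero]; exact htτ.le
    have hMM : 3000000000 ≤ 256 * M ^ 5 := by linarith
    rcases le_or_gt s.re (1 + 1/20) with hsr | hsr
    · have h3 : |(s - 1).re| ≤ 1/20 := by
        rw [Complex.sub_re, Complex.one_re, abs_le]; constructor <;> linarith
      have h4 : ‖s - 1‖ ≤ 1/10 := by
        refine (Complex.norm_le_abs_re_add_abs_im _).trans ?_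
        linarith
      have h5 : ‖s‖ ≤ 1.1 := by
        have := norm_add_le (s - 1) 1
        rw [sub_add_cancel, norm_one] at this
        linarith
      have h6 := norm_Zf_sub_one_le (s := s) (by linarith)
      have h7 : ‖s - 1‖ * (1 + 2 * ‖s‖) ≤ 1/10 * (1 + 2 * 1.1) := by gcongr
      have h8 : 1 ≤ ‖Zf s‖ + ‖Zf s - 1‖ := by
        have := norm_sub_le (Zf s) (Zf s - 1)
        rwa [sub_sub_cancel, norm_one] at this
      have h9 : 1/2 ≤ ‖Zf s‖ := by linarith
      calc (1:ℝ) ≤ 3000000000 * (1/2) := by norm_num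
        _ ≤ _ := by gcongr
    · have hx : 0 < s.re - 1 := by linarith
      have hx2 : s.re - 1 ≤ 2 := by linarith
      have h3 := zeta_341 hx hx2 t
      have h4 := zeta_one_add_le hx hx2 (2 * t)
      have h5 := (norm_x_add_ge hx (2 * t)).1
      have h5' := (norm_x_add_ge hx t).1
      have hes : s = 1 + ((s.re - 1 : ℝ) : ℂ) + Complex.I * t := by
        apply Complex.ext <;> simp [ht]
      rw [← hes] at h3
      set x := s.re - 1 with hxdef
      have h6 : 1 / ‖(x:ℂ) + Complex.I * ((2 * t : ℝ) : ℂ)‖ ≤ 1 / (1/20) := by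
        apply one_div_le_one_div_of_le (by norm_num); linarith
      have h7 : ‖riemannZeta (1 + x + Complex.I * ((2 * t : ℝ) : ℂ))‖ ≤ 30 := by
        refine h4.trans ?_
        have h6' : (1:ℝ)/(1/20) = 20 := by norm_num
        rw [h6'] at h6
        linarith
      have h8 : ‖riemannZeta s‖ ≤ 20 * ‖Zf s‖ := by
        apply norm_zeta_le_Zf (by norm_num)
        have e : s - 1 = x + Complex.I * t := by rw [hes]; ring
        rw [e]; linarith
      have h9 : x ^ 3 ≤ 3375 * ((20 * ‖Zf s‖) ^ 4 * 30) := h3.trans (by gcongr)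
      have h10 : (1/20:ℝ) ^ 3 ≤ x ^ 3 := by
        gcongr; linarith
      have h11 : (1:ℝ) ≤ (10000 * ‖Zf s‖) ^ 4 := by
        have e1 : 3375 * ((20 * ‖Zf s‖) ^ 4 * 30) = 16200000000 * ‖Zf s‖ ^ 4 := by ring
        have e2 : (10000 * ‖Zf s‖) ^ 4 = 10000000000000000 * ‖Zf s‖ ^ 4 := by ring
        rw [e1] at h9
        rw [e2]
        norm_num at h10
        linarith
      have h12 : 1 ≤ 10000 * ‖Zf s‖ := by
        by_contra hlt
        push Not at hlt
        have := pow_lt_one₀ (by positivity) hlt (show 4 ≠ 0 by norm_num)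
        linarith
      refine h12.trans ?_
      gcongr
      linarith

/-- Bound for the third derivative of the logarithmic derivative. -/
theorem Good.third {H : ℂ → ℂ} {C : ℝ} {A : ℕ} (h : Good H C A) {s : ℂ} (hs1 : 1 ≤ s.re)
    (hs2 : s.re ≤ 2) :
    ‖iteratedDeriv 3 (fun z => - deriv H z / H z) s‖ ≤ 6 * C ^ 5 * (8 + 2 * |s.im|) ^ (5 * A) := by
  obtain ⟨hC, hH, hG⟩ := h
  set B := C * (8 + 2 * |s.im|) ^ A with hB
  have h0 := abs_nonneg s.im
  have hB1 : 1 ≤ B := one_le_mul_of_one_le_of_one_le hC (one_le_pow₀ (by linarith))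
  have hR : 1 / B ≤ 1 := by rw [div_le_one (by linarith)]; exact hB1
  have key : ∀ z ∈ Metric.closedBall s (1/B), 1 ≤ B * ‖H z‖ ∧ ‖deriv H z‖ ≤ B := by
    intro z hz
    rw [Metric.mem_closedBall, dist_eq_norm] at hz
    have hre := (Complex.abs_re_le_norm _).trans hz
    have him := (Complex.abs_im_le_norm _).trans hz
    rw [Complex.sub_re, abs_le] at hre
    rw [Complex.sub_im] at him
    have h1 : |z.im| ≤ 1 + |s.im| := by
      have := abs_add_le (z.im - s.im) s.im
      rw [sub_add_cancel] at this
      linarith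
    have h2 : C * (4 + |z.im|) ^ A ≤ B := by
      have h2' : 4 + |z.im| ≤ 8 + 2 * |s.im| := by linarith
      exact mul_le_mul_of_nonneg_left (pow_le_pow_left₀ (by positivity) h2' A) (by linarith)
    have hp : 0 < C * (4 + |z.im|) ^ A := by
      have := abs_nonneg z.im
      positivity
    have h3 := hG z (by
      have := one_div_le_one_div_of_le hp h2
      linarith) (by linarith)
    exact ⟨h3.1.trans (by gcongr), h3.2.trans h2⟩
  have hne : ∀ z ∈ Metric.closedBall s (1/B), H z ≠ 0 := by
    intro z hz h
    have := (key z hz).1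
    rw [h, norm_zero, mul_zero] at this
    linarith
  have hd : DiffContOnCl ℂ (fun z => - deriv H z / H z) (Metric.ball s (1/B)) := by
    apply DifferentiableOn.diffContOnCl
    rw [closure_ball _ (by positivity)]
    apply DifferentiableOn.div _ hH.differentiableOn hne
    apply DifferentiableOn.neg
    have : Differentiable ℂ (deriv H) := by
      have hc : ContDiff ℂ 2 H := hH.contDiff
      exact (hc.iterate_deriv' 1 1).differentiable (by norm_num)
    exact this.differentiableOn
  have := Complex.norm_iteratedDeriv_le_of_forall_mem_sphere_norm_le 3 (R := 1/B) (C := B ^ 2)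
    (by positivity) hd (by
      intro z hz
      have hk := key z (Metric.sphere_subset_closedBall hz)
      have hn := norm_pos_iff.2 (hne z (Metric.sphere_subset_closedBall hz))
      rw [norm_div, norm_neg, div_le_iff₀ hn]
      calc ‖deriv H z‖ ≤ B * 1 := by rw [mul_one]; exact hk.2
        _ ≤ B * (B * ‖H z‖) := by gcongr; exact hk.1
        _ = _ := by ring)
  refine this.trans (le_of_eq ?_)
  have e : (Nat.factorial 3 : ℝ) = 6 := by norm_num [Nat.factorial]
  rw [e, one_div, inv_pow, div_inv_eq_mul]
  calc 6 * B ^ 2 * B ^ 3 = 6 * B ^ 5 := by ring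
    _ = _ := by rw [hB, mul_pow, ← pow_mul, mul_comm A 5]; ring

end SW

namespace SW
open MeasureTheory Set Filter Topology

/-- An L-series that converges absolutely for `Re s > 1` and is of polynomial growth up to the
line `Re s = 1`. -/
def Tame (f : ℕ → ℂ) (K : ℝ) (m : ℕ) : Prop :=
  0 ≤ K ∧ (∀ s : ℂ, 1 < s.re → LSeriesSummable f s) ∧
    ∀ s : ℂ, 1 < s.re → s.re ≤ 2 → ‖LSeries f s‖ ≤ K * (8 + 2 * |s.im|) ^ m

lemma abscissa_le_one {f : ℕ → ℂ} (h : ∀ s : ℂ, 1 < s.re → LSeriesSummable f s) :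
    LSeries.abscissaOfAbsConv f ≤ 1 := by
  apply LSeries.abscissaOfAbsConv_le_of_forall_lt_LSeriesSummable
  intro y hy
  apply h
  simpa using hy

lemma tame_of {f : ℕ → ℂ} {F : ℂ → ℂ} {K : ℝ} {m : ℕ} (hK : 0 ≤ K)
    (h : ∀ s : ℂ, 1 < s.re → LSeriesSummable f s)
    (hF : ∀ s : ℂ, 1 < s.re → LSeries f s = F s)
    (hb : ∀ s : ℂ, 1 < s.re → s.re ≤ 2 → ‖iteratedDeriv 3 F s‖ ≤ K * (8 + 2 * |s.im|) ^ m) :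
    Tame (LSeries.logMul^[3] f) K m := by
  have ha := abscissa_le_one h
  have hlt : ∀ s : ℂ, 1 < s.re → LSeries.abscissaOfAbsConv f < s.re := fun s hs =>
    ha.trans_lt (by exact_mod_cast hs)
  refine ⟨hK, fun s hs => ?_, fun s hs hs2 => ?_⟩
  · apply LSeriesSummable_of_abscissaOfAbsConv_lt_re
    rw [LSeries.absicssaOfAbsConv_logPowMul]
    exact hlt s hs
  · have h1 := LSeries_iteratedDeriv 3 (hlt s hs)
    have h2 : LSeries f =ᶠ[𝓝 s] F := by
      have : {z : ℂ | 1 < z.re} ∈ 𝓝 s :=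
        (isOpen_lt continuous_const Complex.continuous_re).mem_nhds hs
      filter_upwards [this] with z hz using hF z hz
    rw [h2.iteratedDeriv_eq 3] at h1
    have h3 := hb s hs hs2
    rw [h1, norm_mul, norm_pow, norm_neg, norm_one, one_pow, one_mul] at h3
    exact h3

theorem tame_chi : ∃ C : ℝ, 0 ≤ C ∧ ∀ q : ℕ, [NeZero q] → q.Prime →
    ∀ χ : DirichletCharacter ℂ q, χ ≠ 1 →
    Tame (LSeries.logMul^[3] ((fun n : ℕ => χ n) * fun n => (ArithmeticFunction.vonMangoldt n : ℂ)))
      (C * (q:ℝ) ^ (1/4 : ℝ)) 25 := by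
  obtain ⟨C, hC, h⟩ := good_L (1/20) (by norm_num)
  refine ⟨6 * C ^ 5, by positivity, fun q _ hq χ hχ => ?_⟩
  have hg := h q hq χ hχ
  refine tame_of (F := fun z => - deriv (DirichletCharacter.LFunction χ) z /
    DirichletCharacter.LFunction χ z) (by positivity)
    (fun s hs => DirichletCharacter.LSeriesSummable_twist_vonMangoldt χ hs) ?_ ?_
  · intro s hs
    rw [DirichletCharacter.LSeries_twist_vonMangoldt_eq χ hs,
      DirichletCharacter.deriv_LFunction_eq_deriv_LSeries χ hs,
      DirichletCharacter.LFunction_eq_LSeries χ hs]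
  · intro s hs hs2
    refine (hg.third hs.le hs2).trans (le_of_eq ?_)
    rw [mul_pow, ← Real.rpow_natCast (_ ^ (_:ℝ)) 5, ← Real.rpow_mul (by positivity)]
    norm_num
    left; ring

lemma norm_dslope_Zf_le {s : ℂ} (hs : 3/4 ≤ s.re) : ‖dslope Zf 1 s‖ ≤ 2 + 2 * ‖s‖ := by
  by_cases h : s = 1
  · subst h
    rw [dslope_same, norm_one]
    refine (Zf_differentiable 1).hasDerivAt.le_of_lip' (by norm_num) ?_
    have h1 : {z : ℂ | 1/2 < z.re} ∈ 𝓝 (1:ℂ) :=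
      (isOpen_lt continuous_const Complex.continuous_re).mem_nhds (by norm_num)
    have h2 : {z : ℂ | ‖z‖ < 3/2} ∈ 𝓝 (1:ℂ) :=
      (isOpen_lt continuous_norm continuous_const).mem_nhds (by norm_num)
    filter_upwards [h1, h2] with z hz hz2
    rw [Zf_one]
    refine (norm_Zf_sub_one_le (le_of_lt hz)).trans ?_
    rw [mul_comm]
    have : ‖z‖ < 3/2 := hz2
    exact mul_le_mul_of_nonneg_right (by linarith) (norm_nonneg _)
  · rw [dslope_of_ne _ h, slope_def_field, Zf_one, norm_div, div_le_iff₀ (norm_pos_iff.2 (sub_ne_zero.2 h))]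
    refine (norm_Zf_sub_one_le (by linarith)).trans ?_
    rw [mul_comm]
    gcongr
    norm_num

lemma third_dslope_Zf {s : ℂ} (hs1 : 1 ≤ s.re) (hs2 : s.re ≤ 2) :
    ‖iteratedDeriv 3 (dslope Zf 1) s‖ ≤ 384 * (8 + 2 * |s.im|) := by
  have := Complex.norm_iteratedDeriv_le_of_forall_mem_sphere_norm_le 3 (R := 1/4)
    (C := 8 + 2 * |s.im|) (f := dslope Zf 1) (c := s)
    (by norm_num) (differentiable_dslope Zf_differentiable 1).diffContOnCl (by
      intro z hz
      have hz' : ‖z - s‖ = 1/4 := by simpa [dist_eq_norm] using hz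
      have hre : |(z - s).re| ≤ 1/4 := hz' ▸ Complex.abs_re_le_norm _
      rw [Complex.sub_re, abs_le] at hre
      have h1 := norm_dslope_Zf_le (s := z) (by linarith)
      have hns : ‖s‖ ≤ 2 + |s.im| := norm_le_of_re_le (by linarith) hs2
      have := norm_add_le (z - s) s
      rw [sub_add_cancel] at this
      linarith)
  refine this.trans (le_of_eq ?_)
  have e : (Nat.factorial 3 : ℝ) = 6 := by norm_num [Nat.factorial]
  rw [e]; ring

theorem tame_one : ∃ C : ℝ, Tame (LSeries.logMul^[3]
    ((fun n => (ArithmeticFunction.vonMangoldt n : ℂ)) - 1)) C 50 := by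
  obtain ⟨C, hC, hg⟩ := good_Z
  refine ⟨6 * C ^ 5 + 384, tame_of (F := (fun z => - deriv Zf z / Zf z) - dslope Zf 1)
    (by positivity) ?_ ?_ ?_⟩
  · intro s hs
    exact (ArithmeticFunction.LSeriesSummable_vonMangoldt hs).sub (LSeriesSummable_one_iff.2 hs)
  · intro s hs
    rw [LSeries_sub (ArithmeticFunction.LSeriesSummable_vonMangoldt hs) (LSeriesSummable_one_iff.2 hs),
      ArithmeticFunction.LSeries_vonMangoldt_eq_deriv_riemannZeta_div hs,
      LSeries_one_eq_riemannZeta hs]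
    have h1 : s ≠ 1 := by rintro rfl; simp at hs
    have h1' : s - 1 ≠ 0 := sub_ne_zero.2 h1
    have hz : riemannZeta s ≠ 0 := riemannZeta_ne_zero_of_one_le_re hs.le
    have hd : deriv Zf s = riemannZeta s + (s - 1) * deriv riemannZeta s := by
      have he : Zf =ᶠ[𝓝 s] fun z => (z - 1) * riemannZeta z := by
        filter_upwards [isOpen_ne.mem_nhds h1] with z hz using Zf_of_ne hz
      rw [he.deriv_eq]
      have := ((hasDerivAt_id s).sub_const 1).mul (differentiableAt_riemannZeta h1).hasDerivAt
      rw [show (fun z => (z - 1) * riemannZeta z) = (fun z => id z - 1) * riemannZeta from rfl,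
        this.deriv]
      simp
    simp only [Pi.sub_apply]
    rw [dslope_of_ne _ h1, slope_def_field, Zf_one, hd, Zf_of_ne h1]
    field_simp
    ring
  · intro s hs hs2
    have h0 := abs_nonneg s.im
    have hdd : Differentiable ℂ (dslope Zf 1) := differentiable_dslope Zf_differentiable 1
    have hnz : Zf s ≠ 0 := by
      have h1 : s ≠ 1 := by rintro rfl; simp at hs
      rw [Zf_of_ne h1]
      exact mul_ne_zero (sub_ne_zero.2 h1) (riemannZeta_ne_zero_of_one_le_re hs.le)
    have hc : ContDiff ℂ ((3:ℕ) + (1:ℕ)) Zf := Zf_differentiable.contDiff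
    have hc' : ContDiff ℂ (3:ℕ) (deriv Zf) := hc.iterate_deriv' 3 1
    rw [iteratedDeriv_sub]
    · refine (norm_sub_le _ _).trans ?_
      have h3 := hg.third hs.le hs2
      have h4 := third_dslope_Zf hs.le hs2
      have h5 : 8 + 2 * |s.im| ≤ (8 + 2 * |s.im|) ^ 50 := le_self_pow₀ (by linarith) (by norm_num)
      rw [show 5 * 10 = 50 from rfl] at h3
      linarith
    · exact hc'.neg.contDiffAt.div (Zf_differentiable.contDiff).contDiffAt hnz
    · exact hdd.contDiff.contDiffAt

end SW

namespace SW
open MeasureTheory Set Filter Topology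
open scoped FourierTransform SchwartzMap ContDiff

lemma schwartz_weight (w : 𝓢(ℝ, ℂ)) (m : ℕ) :
    Integrable (fun t : ℝ => ‖w t‖ * (8 + 2 * |t|) ^ m) := by
  have h1 := (w.integrable_pow_mul volume m).const_mul (2 ^ (m-1) * 2 ^ m)
  have h2 := (w.integrable (μ := volume)).norm.const_mul (2 ^ (m-1) * 8 ^ m)
  refine (h1.add h2).mono' ?_ ?_
  · apply Continuous.aestronglyMeasurable
    have := w.continuous
    fun_prop
  · filter_upwards with t
    have h := add_pow_le (show (0:ℝ) ≤ 8 by norm_num) (show (0:ℝ) ≤ 2 * |t| by positivity) m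
    have h0 := norm_nonneg (w t)
    rw [Real.norm_eq_abs, abs_of_nonneg (by positivity)]
    refine (mul_le_mul_of_nonneg_left h h0).trans (le_of_eq ?_)
    simp only [Pi.add_apply, Real.norm_eq_abs]
    rw [mul_pow]; ring

lemma term_mul_exp (f : ℕ → ℂ) (c t L : ℝ) (n : ℕ) :
    LSeries.term f c n * Complex.exp (((-(t * (Real.log n - L)) : ℝ) : ℂ) * Complex.I) =
      Complex.exp ((t * L : ℝ) * Complex.I) * LSeries.term f (c + t * Complex.I) n := by
  rcases Nat.eq_zero_or_pos n with rfl | hn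
  · simp
  · have hn0 : (n:ℂ) ≠ 0 := by exact_mod_cast hn.ne'
    rw [LSeries.term_of_ne_zero hn.ne', LSeries.term_of_ne_zero hn.ne', Complex.cpow_add _ _ hn0,
      Complex.cpow_def_of_ne_zero hn0 (t * Complex.I), ← Complex.natCast_log]
    have e : Complex.exp (((-(t * (Real.log n - L)) : ℝ) : ℂ) * Complex.I) =
        Complex.exp ((t * L : ℝ) * Complex.I) / Complex.exp (Real.log n * (t * Complex.I)) := by
      rw [← Complex.exp_sub]; congr 1; push_cast; ring
    rw [e]
    field_simp

lemma smooth_sum_c (w : 𝓢(ℝ, ℂ)) {f : ℕ → ℂ} {K : ℝ} {m : ℕ} (hf : Tame f K m) (L : ℝ)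
    {c : ℝ} (hc : 1 < c) (hc2 : c ≤ 2) :
    ‖∑' n, LSeries.term f c n * (𝓕 (w : ℝ → ℂ)) ((Real.log n - L) / (2 * Real.pi))‖ ≤
      K * ∫ t : ℝ, ‖w t‖ * (8 + 2 * |t|) ^ m := by
  obtain ⟨hK, hs, hb⟩ := hf
  have hsum := hs (c : ℂ) (by simpa using hc)
  have hwint := w.integrable (μ := (volume : Measure ℝ))
  set F : ℕ → ℝ → ℂ := fun n t => LSeries.term f c n *
    (Complex.exp (((-(t * (Real.log n - L)) : ℝ) : ℂ) * Complex.I) * w t) with hF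
  have hnF : ∀ n t, ‖F n t‖ = ‖LSeries.term f c n‖ * ‖w t‖ := by
    intro n t
    rw [hF]
    simp only [norm_mul]
    rw [Complex.norm_exp_ofReal_mul_I, one_mul]
  have hFint : ∀ n, Integrable (F n) := by
    intro n
    refine (hwint.norm.const_mul ‖LSeries.term f c n‖).mono' ?_ ?_
    · apply Continuous.aestronglyMeasurable
      have := w.continuous
      rw [hF]; fun_prop
    · filter_upwards with t
      rw [hnF]
  have hmain := hasSum_integral_of_summable_integral_norm hFint (by
    simp_rw [hnF, integral_const_mul]
    exact hsum.norm.mul_right _)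
  have hterm : ∀ n, LSeries.term f c n * (𝓕 (w : ℝ → ℂ)) ((Real.log n - L) / (2 * Real.pi)) =
      ∫ t, F n t := by
    intro n
    rw [hF, integral_const_mul, Real.fourier_real_eq_integral_exp_smul]
    congr 1
    apply integral_congr_ae
    filter_upwards with t
    simp only [smul_eq_mul]
    congr 4
    have := Real.pi_ne_zero
    field_simp
  simp_rw [hterm]
  rw [hmain.tsum_eq, ← integral_const_mul]
  apply norm_integral_le_of_norm_le ((schwartz_weight w m).const_mul K)
  filter_upwards with t
  have e : ∑' n, F n t = Complex.exp ((t * L : ℝ) * Complex.I) * LSeries f (c + t * Complex.I) * w t := by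
    rw [LSeries, ← tsum_mul_left, ← tsum_mul_right]
    congr 1; ext n
    rw [← term_mul_exp, hF]; ring
  rw [e, norm_mul, norm_mul, Complex.norm_exp_ofReal_mul_I, one_mul]
  have := hb (c + t * Complex.I) (by simpa using hc) (by simpa using hc2)
  simp only [Complex.add_im, Complex.ofReal_im, Complex.mul_im, Complex.ofReal_re, Complex.I_im,
    mul_one, Complex.I_re, mul_zero, add_zero, zero_add] at this
  calc _ ≤ K * (8 + 2 * |t|) ^ m * ‖w t‖ := by gcongr
    _ = _ := by ring

theorem smooth_sum {g : ℝ → ℂ} (hg : ContDiff ℝ ∞ g) (hgs : HasCompactSupport g) (m : ℕ) :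
    ∃ Cg : ℝ, 0 ≤ Cg ∧ ∀ (f : ℕ → ℂ) (K : ℝ), Tame f K m → ∀ (L : ℝ) (N : ℕ),
      (∀ n : ℕ, N < n → g (Real.log n - L) = 0) →
      ‖∑ n ∈ Finset.Icc 1 N, f n / n * g (Real.log n - L)‖ ≤ Cg * K := by
  have hpi := Real.pi_pos
  set G : ℝ → ℂ := fun u => g ((2 * Real.pi) * u) with hG
  have hGc : ContDiff ℝ ∞ G := hg.comp (contDiff_const.mul contDiff_id)
  have hGs : HasCompactSupport G :=
    hgs.comp_homeomorph (Homeomorph.mulLeft₀ (2 * Real.pi) (by positivity))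
  set S : 𝓢(ℝ, ℂ) := hGs.toSchwartzMap hGc with hS
  set w : 𝓢(ℝ, ℂ) := 𝓕⁻ S with hw
  have hFw : ∀ u, (𝓕 (w : ℝ → ℂ)) (u / (2 * Real.pi)) = g u := by
    intro u
    rw [← SchwartzMap.fourier_coe, hw, FourierTransform.fourier_fourierInv_eq]
    change G _ = _
    rw [hG]
    simp only
    congr 1
    field_simp
  refine ⟨∫ t : ℝ, ‖w t‖ * (8 + 2 * |t|) ^ m, integral_nonneg fun t => by positivity, ?_⟩
  intro f K hf L N hN
  have h1 : ∀ c : ℝ, 1 < c → c ≤ 2 →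
      ‖∑ n ∈ Finset.Icc 1 N, f n / (n:ℂ) ^ (c:ℂ) * g (Real.log n - L)‖ ≤
      K * ∫ t : ℝ, ‖w t‖ * (8 + 2 * |t|) ^ m := by
    intro c hc hc2
    have := smooth_sum_c w hf L hc hc2
    simp_rw [hFw] at this
    rw [tsum_eq_sum (s := Finset.Icc 1 N)] at this
    · convert this using 2
      apply Finset.sum_congr rfl
      intro n hn
      rw [LSeries.term_of_ne_zero (by have := (Finset.mem_Icc.1 hn).1; omega)]
    · intro n hn
      rcases Nat.eq_zero_or_pos n with rfl | hn0
      · simp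
      · rw [hN n (by simp only [Finset.mem_Icc, not_and] at hn; have := hn hn0; omega), mul_zero]
  have h2 : Tendsto (fun c : ℝ => ‖∑ n ∈ Finset.Icc 1 N, f n / (n:ℂ) ^ (c:ℂ) * g (Real.log n - L)‖)
      (𝓝[>] 1) (𝓝 ‖∑ n ∈ Finset.Icc 1 N, f n / (n:ℂ) ^ ((1:ℝ):ℂ) * g (Real.log n - L)‖) := by
    apply Tendsto.mono_left _ nhdsWithin_le_nhds
    apply Tendsto.norm
    apply tendsto_finsetSum
    intro n hn
    have hn0 : (n:ℂ) ≠ 0 := by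
      have := (Finset.mem_Icc.1 hn).1
      exact_mod_cast (by omega : n ≠ 0)
    apply Tendsto.mul_const
    apply Tendsto.div tendsto_const_nhds
    · exact ((Complex.continuous_ofReal.const_cpow (Or.inl hn0)).tendsto 1)
    · exact (Complex.cpow_ne_zero_iff_of_exponent_ne_zero (by simp)).2 hn0
  have h3 := le_of_tendsto h2 (b := K * ∫ t : ℝ, ‖w t‖ * (8 + 2 * |t|) ^ m) (by
    filter_upwards [Ioc_mem_nhdsGT (show (1:ℝ) < 2 by norm_num)] with c hc
    exact h1 c hc.1 hc.2)
  rw [mul_comm]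
  simpa using h3

end SW

namespace SW
open MeasureTheory Set Filter Topology
open scoped ContDiff ArithmeticFunction.vonMangoldt

/-- The weight `(log n)^3 / n * φ (log n - L)`. -/
noncomputable def wt (φ : ℝ → ℝ) (L : ℝ) (n : ℕ) : ℝ :=
  Real.log n ^ 3 / n * φ (Real.log n - L)

/-- cut-off functions supported in `[-1,1]` with values in `[0,1]` -/
structure Cut (φ : ℝ → ℝ) : Prop where
  smooth : ContDiff ℝ ∞ φ
  nonneg : ∀ u, 0 ≤ φ u
  le_one : ∀ u, φ u ≤ 1
  supp : ∀ u, 1 ≤ |u| → φ u = 0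

lemma wt_nonneg {φ : ℝ → ℝ} (hφ : Cut φ) (L : ℝ) (n : ℕ) : 0 ≤ wt φ L n := by
  have := hφ.nonneg (Real.log n - L)
  have := Real.log_natCast_nonneg n
  unfold wt; positivity

lemma Cut.hasCompactSupport {φ : ℝ → ℝ} (hφ : Cut φ) : HasCompactSupport φ := by
  apply HasCompactSupport.intro (isCompact_Icc (a := -1) (b := 1))
  intro x hx
  apply hφ.supp
  by_contra h
  push Not at h
  exact hx ⟨(abs_lt.1 h).1.le, (abs_lt.1 h).2.le⟩

lemma floor_exp_lt {L : ℝ} {n : ℕ} (h : ⌊Real.exp (L + 1)⌋₊ < n) : L + 1 < Real.log n := by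
  have h1 := (Nat.floor_lt (Real.exp_pos _).le).1 h
  rw [Real.lt_log_iff_exp_lt ((Real.exp_pos _).trans h1)]
  exact h1

lemma smooth_wt {φ : ℝ → ℝ} (hφ : Cut φ) (m : ℕ) :
    ∃ Cg : ℝ, 0 ≤ Cg ∧ ∀ (f : ℕ → ℂ) (K : ℝ), Tame (LSeries.logMul^[3] f) K m → ∀ (L : ℝ),
      ‖∑ n ∈ Finset.Ioc 0 ⌊Real.exp (L + 1)⌋₊, f n * (wt φ L n : ℂ)‖ ≤ Cg * K := by
  obtain ⟨C, hC, h⟩ := smooth_sum (g := fun u => (φ u : ℂ))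
    (Complex.ofRealCLM.contDiff.comp hφ.smooth)
    (hφ.hasCompactSupport.comp_left (g := fun x : ℝ => (x:ℂ)) (by simp)) m
  refine ⟨C, hC, fun f K hf L => ?_⟩
  have := h _ K hf L ⌊Real.exp (L + 1)⌋₊ (by
    intro n hn
    have h1 := floor_exp_lt hn
    rw [hφ.supp]
    · simp
    · rw [le_abs]; left; linarith)
  convert this using 2
  rw [show Finset.Icc 1 ⌊Real.exp (L + 1)⌋₊ = Finset.Ioc 0 ⌊Real.exp (L + 1)⌋₊ by
    ext; simp [Nat.succ_le_iff]]
  apply Finset.sum_congr rfl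
  intro n hn
  change _ = Complex.log n * (Complex.log n * (Complex.log n * f n)) / n * _
  rw [← Complex.natCast_log, wt]
  push_cast
  ring

/-- non-prime prime powers contribute little -/
lemma nonprime_le {φ : ℝ → ℝ} (hφ : Cut φ) : ∀ᶠ L : ℝ in atTop,
    ∑ n ∈ Finset.Ioc 0 ⌊Real.exp (L + 1)⌋₊ with ¬ n.Prime, Λ n * wt φ L n ≤ 1 := by
  have hlim : Tendsto (fun L : ℝ => 2 * Real.exp 2 * ((L+1) ^ 4 * Real.exp (-((1/2) * (L+1))))) atTop
      (𝓝 (2 * Real.exp 2 * 0)) := by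
    apply Tendsto.const_mul
    have h1 := Real.tendsto_pow_mul_exp_neg_atTop_nhds_zero 4
    have h2 : Tendsto (fun L : ℝ => (1/2) * (L + 1)) atTop atTop :=
      (tendsto_atTop_add_const_right _ _ tendsto_id).const_mul_atTop (by norm_num)
    have h3 := (h1.comp h2).const_mul 16
    rw [mul_zero] at h3
    refine h3.congr fun L => ?_
    simp only [Function.comp]
    ring_nf
  rw [mul_zero] at hlim
  filter_upwards [hlim.eventually (ge_mem_nhds (show (0:ℝ) < 1 by norm_num)), eventually_ge_atTop 0]
    with L hL hL0
  set N := ⌊Real.exp (L + 1)⌋₊ with hN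
  have hterm : ∀ n ∈ Finset.Ioc 0 N, Λ n * wt φ L n ≤ Λ n * ((L+1) ^ 3 * Real.exp (1 - L)) := by
    intro n hn
    rw [Finset.mem_Ioc] at hn
    apply mul_le_mul_of_nonneg_left _ ArithmeticFunction.vonMangoldt_nonneg
    have hn0 : (0:ℝ) < n := by exact_mod_cast hn.1
    have hlog0 := Real.log_natCast_nonneg n
    rcases le_or_gt 1 |Real.log n - L| with hb | hb
    · rw [wt, hφ.supp _ hb, mul_zero]
      positivity
    · rw [abs_lt] at hb
      have h1 : Real.exp (L - 1) ≤ n := by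
        rw [← Real.le_log_iff_exp_le hn0]; linarith
      have h2 : (1:ℝ) / n ≤ Real.exp (1 - L) := by
        rw [show 1 - L = -(L - 1) by ring, Real.exp_neg, ← one_div]
        exact one_div_le_one_div_of_le (Real.exp_pos _) h1
      rw [wt, div_eq_mul_one_div]
      calc _ ≤ (L+1) ^ 3 * Real.exp (1 - L) * 1 := by
            apply mul_le_mul _ (hφ.le_one _) (hφ.nonneg _) (by positivity)
            gcongr
            linarith
        _ = _ := by ring
  calc _ ≤ ∑ n ∈ Finset.Ioc 0 N with ¬ n.Prime, Λ n * ((L+1) ^ 3 * Real.exp (1 - L)) :=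
        Finset.sum_le_sum fun n hn => hterm n (Finset.mem_filter.1 hn).1
    _ = (Chebyshev.psi (Real.exp (L+1)) - Chebyshev.theta (Real.exp (L+1))) *
        ((L+1) ^ 3 * Real.exp (1 - L)) := by
        rw [Chebyshev.psi_sub_theta_eq_sum_not_prime, Finset.sum_mul]
    _ ≤ (2 * √(Real.exp (L+1)) * Real.log (Real.exp (L+1))) * ((L+1) ^ 3 * Real.exp (1 - L)) := by
        gcongr
        apply Chebyshev.psi_sub_theta_le
        exact Real.one_le_exp (by linarith)
    _ = 2 * Real.exp 2 * ((L+1) ^ 4 * Real.exp (-((1/2) * (L+1)))) := by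
        rw [Real.log_exp, ← Real.exp_half]
        have : Real.exp ((L+1)/2) * Real.exp (1 - L) = Real.exp 2 * Real.exp (-((1/2) * (L+1))) := by
          rw [← Real.exp_add, ← Real.exp_add]; congr 1; ring
        linear_combination 2 * (L+1)^4 * this
    _ ≤ 1 := hL

/-- the expected main term -/
noncomputable def mainM (φ : ℝ → ℝ) (L : ℝ) : ℝ := ∑ n ∈ Finset.Ioc 0 ⌊Real.exp (L + 1)⌋₊, wt φ L n

lemma smooth_ap {φ : ℝ → ℝ} (hφ : Cut φ) : ∃ C : ℝ, 0 ≤ C ∧ ∀ᶠ L : ℝ in atTop,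
    ∀ q : ℕ, q.Prime → Real.log q ≤ L - 1 → ∀ a : ZMod q, IsUnit a →
    |∑ n ∈ Finset.Ioc 0 ⌊Real.exp (L + 1)⌋₊, ArithmeticFunction.vonMangoldt.residueClass a n * wt φ L n
      - mainM φ L / (q - 1)| ≤ C * (q:ℝ) ^ (1/4:ℝ) := by
  obtain ⟨C₁, hC₁, hchi⟩ := tame_chi
  obtain ⟨C₂, hone⟩ := tame_one
  obtain ⟨C₃, hC₃, hs25⟩ := smooth_wt hφ 25
  obtain ⟨C₄, hC₄, hs50⟩ := smooth_wt hφ 50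
  have hC₂ : 0 ≤ C₂ := hone.1
  refine ⟨C₃ * C₁ + C₄ * C₂ + 1, by positivity, ?_⟩
  filter_upwards [nonprime_le hφ] with L hL q hq hqL a ha
  haveI : NeZero q := ⟨hq.ne_zero⟩
  set N := ⌊Real.exp (L + 1)⌋₊ with hN
  set V : DirichletCharacter ℂ q → ℂ := fun χ =>
    ∑ n ∈ Finset.Ioc 0 N, (χ n * Λ n) * (wt φ L n : ℂ) with hV
  have hq1 : (1:ℝ) ≤ (q:ℝ) ^ (1/4:ℝ) := Real.one_le_rpow (by exact_mod_cast hq.one_le) (by norm_num)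
  have hVχ : ∀ χ, χ ≠ 1 → ‖V χ‖ ≤ C₃ * (C₁ * (q:ℝ) ^ (1/4:ℝ)) := fun χ hχ =>
    hs25 _ _ (hchi q hq χ hχ) L
  have hVone : ‖V 1 - mainM φ L‖ ≤ C₄ * C₂ + 1 := by
    have h1 := hs50 _ _ hone L
    have h2 : ∑ n ∈ Finset.Ioc 0 N with ¬ n.Coprime q, Λ n * wt φ L n ≤ 1 := by
      refine le_trans ?_ hL
      rw [Finset.sum_filter, Finset.sum_filter]
      apply Finset.sum_le_sum
      intro n hn
      have hnn : 0 ≤ Λ n * wt φ L n := mul_nonneg ArithmeticFunction.vonMangoldt_nonneg (wt_nonneg hφ L n)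
      by_cases hp : n.Prime
      · by_cases hc : n.Coprime q
        · simp [hc, hp]
        · have : n = q := by
            by_contra hne
            exact hc ((Nat.coprime_primes hp hq).2 hne)
          subst this
          have : wt φ L n = 0 := by
            rw [wt, hφ.supp, mul_zero]
            rw [le_abs]; right; linarith
          simp [this]
      · rw [if_pos hp]
        by_cases hc : n.Coprime q
        · rw [if_neg (not_not.2 hc)]; exact hnn
        · rw [if_pos hc]
    have h3 : V 1 - mainM φ L = ∑ n ∈ Finset.Ioc 0 N, (((fun n => (Λ n : ℂ)) - 1) n) * (wt φ L n : ℂ)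
        - ((∑ n ∈ Finset.Ioc 0 N with ¬ n.Coprime q, Λ n * wt φ L n : ℝ) : ℂ) := by
      rw [hV, mainM, Finset.sum_filter]
      push_cast
      rw [← Finset.sum_sub_distrib, ← Finset.sum_sub_distrib]
      apply Finset.sum_congr rfl
      intro n hn
      by_cases hc : n.Coprime q
      · have : IsUnit (n : ZMod q) := (ZMod.isUnit_iff_coprime n q).2 hc
        rw [MulChar.one_apply this, if_neg (not_not.2 hc)]
        simp only [Pi.sub_apply, Pi.one_apply]
        push_cast
        ring
      · have : ¬ IsUnit (n : ZMod q) := fun h => hc ((ZMod.isUnit_iff_coprime n q).1 h)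
        rw [MulChar.map_nonunit _ this, if_pos hc]
        simp only [Pi.sub_apply, Pi.one_apply]
        push_cast
        ring
    rw [h3]
    refine (norm_sub_le _ _).trans (add_le_add h1 ?_)
    rw [Complex.norm_real, Real.norm_eq_abs, abs_of_nonneg]
    · exact h2
    · exact Finset.sum_nonneg fun n _ =>
        mul_nonneg ArithmeticFunction.vonMangoldt_nonneg (wt_nonneg hφ L n)
  have htot : (q.totient : ℝ) = q - 1 := by
    rw [Nat.totient_prime hq, Nat.cast_sub hq.one_le, Nat.cast_one]
  have hq2 : (2:ℝ) ≤ q := by exact_mod_cast hq.two_le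
  have key : ((∑ n ∈ Finset.Ioc 0 N, ArithmeticFunction.vonMangoldt.residueClass a n * wt φ L n
      - mainM φ L / (q - 1) : ℝ) : ℂ) = (q.totient : ℂ)⁻¹ *
      ((∑ χ ∈ Finset.univ.erase (1 : DirichletCharacter ℂ q), χ a⁻¹ * V χ) + (V 1 - mainM φ L)) := by
    have e1 : (∑ χ ∈ Finset.univ.erase (1 : DirichletCharacter ℂ q), χ a⁻¹ * V χ) + V 1 =
        ∑ χ : DirichletCharacter ℂ q, χ a⁻¹ * V χ := by
      rw [← Finset.sum_erase_add _ _ (Finset.mem_univ (1 : DirichletCharacter ℂ q))]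
      congr 1
      rw [MulChar.one_apply, one_mul]
      have := ZMod.inv_mul_of_unit a ha
      exact IsUnit.of_mul_eq_one _ this
    rw [← add_sub_assoc, e1, mul_sub, ← htot]
    push_cast
    congr 1
    · simp_rw [ArithmeticFunction.vonMangoldt.residueClass_apply ha, hV, Finset.mul_sum]
      rw [Finset.sum_comm]
      apply Finset.sum_congr rfl
      intro n hn
      rw [Finset.sum_mul]
      apply Finset.sum_congr rfl
      intro χ _
      ring
    · rw [div_eq_inv_mul]
  have hcard : ((Finset.univ.erase (1 : DirichletCharacter ℂ q)).card : ℝ) ≤ q - 1 := by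
    rw [← htot, ← DirichletCharacter.card_eq_totient_of_hasEnoughRootsOfUnity ℂ q,
      Nat.card_eq_fintype_card]
    exact_mod_cast Finset.card_le_univ _
  rw [← Real.norm_eq_abs, ← Complex.norm_real, key, norm_mul, norm_inv, Complex.norm_natCast, htot]
  have hsum : ‖∑ χ ∈ Finset.univ.erase (1 : DirichletCharacter ℂ q), χ a⁻¹ * V χ‖ ≤
      (q - 1) * (C₃ * (C₁ * (q:ℝ) ^ (1/4:ℝ))) := by
    refine (norm_sum_le_of_le (n := fun _ => C₃ * (C₁ * (q:ℝ) ^ (1/4:ℝ))) _ ?_).trans ?_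
    · intro χ hχ
      rw [norm_mul]
      have h1 := hVχ χ (Finset.ne_of_mem_erase hχ)
      have h2 := DirichletCharacter.norm_le_one χ a⁻¹
      calc _ ≤ 1 * (C₃ * (C₁ * (q:ℝ) ^ (1/4:ℝ))) := by gcongr
        _ = _ := one_mul _
    · rw [Finset.sum_const, nsmul_eq_mul]
      gcongr
  rw [inv_mul_le_iff₀ (by linarith)]
  refine (norm_add_le _ _).trans ((add_le_add hsum hVone).trans ?_)
  have h5 : C₄ * C₂ + 1 ≤ (q - 1) * ((C₄ * C₂ + 1) * (q:ℝ) ^ (1/4:ℝ)) := by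
    have : 0 ≤ C₄ * C₂ + 1 := by positivity
    calc C₄ * C₂ + 1 = 1 * ((C₄ * C₂ + 1) * 1) := by ring
      _ ≤ _ := by gcongr <;> linarith
  linarith

end SW

namespace SW
open MeasureTheory Set Filter Topology
open scoped ContDiff ArithmeticFunction.vonMangoldt

/-- sum over primes in a progression with smooth weight -/
noncomputable def primeT (φ : ℝ → ℝ) (L : ℝ) (q a : ℕ) : ℝ :=
  ∑ n ∈ Finset.Ioc 0 ⌊Real.exp (L + 1)⌋₊ with (n.Prime ∧ n % q = a), Real.log n * wt φ L n

lemma smooth_primes {φ : ℝ → ℝ} (hφ : Cut φ) : ∃ C : ℝ, 0 ≤ C ∧ ∀ᶠ L : ℝ in atTop,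
    ∀ q : ℕ, q.Prime → Real.log q ≤ L - 1 → ∀ a : ℕ, 0 < a → a < q →
    |primeT φ L q a - mainM φ L / (q - 1)| ≤ C * (q:ℝ) ^ (1/4:ℝ) := by
  obtain ⟨C, hC, h⟩ := smooth_ap hφ
  refine ⟨C + 1, by linarith, ?_⟩
  filter_upwards [h, nonprime_le hφ] with L hL hE q hq hqL a ha haq
  haveI : NeZero q := ⟨hq.ne_zero⟩
  have hu : IsUnit (a : ZMod q) := by
    rw [ZMod.isUnit_iff_coprime]
    exact (Nat.coprime_of_lt_prime ha.ne' haq hq).symm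
  have h1 := hL q hq hqL a hu
  set N := ⌊Real.exp (L + 1)⌋₊ with hN
  set T := ∑ n ∈ Finset.Ioc 0 N, ArithmeticFunction.vonMangoldt.residueClass (a : ZMod q) n * wt φ L n
  have hd : 0 ≤ T - primeT φ L q a ∧ T - primeT φ L q a ≤
      ∑ n ∈ Finset.Ioc 0 N with ¬ n.Prime, Λ n * wt φ L n := by
    rw [primeT, Finset.sum_filter, Finset.sum_filter, ← Finset.sum_sub_distrib]
    have hmod : ∀ n : ℕ, ((n : ZMod q) = a) ↔ n % q = a := by
      intro n
      rw [ZMod.natCast_eq_natCast_iff', Nat.mod_eq_of_lt haq]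
    have hnn : ∀ n, 0 ≤ Λ n * wt φ L n := fun n =>
      mul_nonneg ArithmeticFunction.vonMangoldt_nonneg (wt_nonneg hφ L n)
    have hterm : ∀ n, ArithmeticFunction.vonMangoldt.residueClass (a : ZMod q) n * wt φ L n -
        (if n.Prime ∧ n % q = a then Real.log n * wt φ L n else 0) =
        if (¬ n.Prime ∧ n % q = a) then Λ n * wt φ L n else 0 := by
      intro n
      rw [ArithmeticFunction.vonMangoldt.residueClass, Set.indicator_apply]
      simp only [Set.mem_setOf_eq, hmod]
      by_cases hm : n % q = a
      · by_cases hp : n.Prime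
        · simp [hm, hp, ArithmeticFunction.vonMangoldt_apply_prime hp]
        · simp [hm, hp]
      · simp [hm]
    simp_rw [hterm]
    constructor
    · apply Finset.sum_nonneg
      intro n _
      split_ifs
      · exact hnn n
      · exact le_rfl
    · apply Finset.sum_le_sum
      intro n _
      by_cases hp : n.Prime
      · simp [hp]
      · by_cases hm : n % q = a
        · simp [hp, hm]
        · simpa [hp, hm] using hnn n
  have hq1 : (1:ℝ) ≤ (q:ℝ) ^ (1/4:ℝ) := Real.one_le_rpow (by exact_mod_cast hq.one_le) (by norm_num)
  rw [abs_le] at h1 ⊢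
  constructor <;> linarith [h1.1, h1.2, hd.1, hd.2]

lemma harm_upper {a b : ℕ} (ha : 1 ≤ a) (hab : a ≤ b) :
    ∑ n ∈ Finset.Ioc a b, (1:ℝ) / n ≤ Real.log b - Real.log a := by
  induction b, hab using Nat.le_induction with
  | base => simp
  | succ b hb ih =>
    rw [Finset.sum_Ioc_succ_top (by omega)]
    have hb0 : (0:ℝ) < b := by exact_mod_cast (by omega : 0 < b)
    have h := Real.one_sub_inv_le_log_of_pos (x := ((b + 1 : ℕ) : ℝ) / b) (by positivity)
    rw [Real.log_div (by positivity) (by positivity)] at h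
    have e : 1 - (((b + 1 : ℕ) : ℝ) / b)⁻¹ = 1 / ((b+1 : ℕ) : ℝ) := by
      push_cast; field_simp; ring
    rw [e] at h
    linarith

lemma harm_lower {a b : ℕ} (hab : a ≤ b) :
    Real.log (b + 1) - Real.log (a + 1) ≤ ∑ n ∈ Finset.Ioc a b, (1:ℝ) / n := by
  induction b, hab using Nat.le_induction with
  | base => simp
  | succ b hb ih =>
    rw [Finset.sum_Ioc_succ_top (by omega)]
    have h := Real.log_le_sub_one_of_pos (x := ((b:ℝ) + 2) / (b + 1)) (by positivity)
    rw [Real.log_div (by positivity) (by positivity)] at h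
    have e : ((b:ℝ) + 2) / (b + 1) - 1 = 1 / ((b+1 : ℕ) : ℝ) := by
      push_cast; field_simp; ring
    rw [e] at h
    have e2 : ((b + 1 : ℕ) : ℝ) + 1 = b + 2 := by push_cast; ring
    rw [e2]
    linarith

lemma mainM_le {φ : ℝ → ℝ} (hφ : Cut φ) {α β L : ℝ} (hαβ : α ≤ β)
    (hs : ∀ u, φ u ≠ 0 → α < u ∧ u < β) (hL : 1 ≤ L + α) :
    mainM φ L ≤ (L + β) ^ 3 * (β - α + 2 * Real.exp (-(L + α))) := by
  set a := ⌊Real.exp (L + α)⌋₊ with ha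
  set b := ⌊Real.exp (L + β)⌋₊ with hb
  have hE2 : 2 ≤ Real.exp (L + α) := by
    have := Real.add_one_le_exp (L + α); linarith
  have ha1 : 1 ≤ a := by
    rw [ha, Nat.one_le_floor_iff]; linarith
  have hab : a ≤ b := Nat.floor_le_floor (Real.exp_le_exp.2 (by linarith))
  have hb1 : (0:ℝ) < b := by exact_mod_cast (by omega : 0 < b)
  have ha0 : (0:ℝ) < a := by exact_mod_cast (by omega : 0 < a)
  have h1 : mainM φ L ≤ ∑ n ∈ Finset.Ioc a b, (L + β) ^ 3 * ((1:ℝ) / n) := by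
    rw [mainM]
    calc _ ≤ ∑ n ∈ Finset.Ioc 0 ⌊Real.exp (L + 1)⌋₊, if n ∈ Finset.Ioc a b then
          (L + β) ^ 3 * ((1:ℝ) / n) else 0 := by
          apply Finset.sum_le_sum
          intro n hn
          have hn0 : (0:ℝ) < n := by exact_mod_cast (Finset.mem_Ioc.1 hn).1
          by_cases h0 : φ (Real.log n - L) = 0
          · rw [wt, h0, mul_zero]
            split_ifs
            · have : 0 ≤ L + β := by linarith
              positivity
            · exact le_rfl
          · have h2 := hs _ h0
            rw [if_pos]
            · rw [wt, div_eq_mul_one_div]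
              have := Real.log_natCast_nonneg n
              have h3 := hφ.le_one (Real.log n - L)
              have h4 := hφ.nonneg (Real.log n - L)
              have h5 : 0 ≤ L + β := by linarith
              calc _ ≤ ((L + β) ^ 3 * (1 / n)) * 1 := by
                    gcongr
                    linarith
                _ = _ := mul_one _
            · rw [Finset.mem_Ioc]
              constructor
              · rw [ha, Nat.floor_lt (Real.exp_pos _).le, ← Real.lt_log_iff_exp_lt hn0]; linarith
              · apply Nat.le_floor
                rw [← Real.log_le_iff_le_exp hn0]; linarith
      _ ≤ _ := by
          rw [← Finset.sum_filter]
          apply Finset.sum_le_sum_of_subset_of_nonneg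
          · intro n hn
            exact (Finset.mem_filter.1 hn).2
          · intro n _ _
            have : 0 ≤ L + β := by linarith
            positivity
  rw [← Finset.mul_sum] at h1
  refine h1.trans (mul_le_mul_of_nonneg_left ?_ (pow_nonneg (by linarith) 3))
  refine (harm_upper ha1 hab).trans ?_
  have h3 : Real.log b ≤ L + β := by
    rw [Real.log_le_iff_le_exp hb1]
    exact Nat.floor_le (Real.exp_pos _).le
  have h4 : L + α - 2 * Real.exp (-(L + α)) ≤ Real.log a := by
    have hx : Real.exp (-(L+α)) ≤ 1/2 := by
      rw [Real.exp_neg, ← one_div]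
      exact one_div_le_one_div_of_le (by norm_num) hE2
    set x := Real.exp (-(L+α)) with hxd
    have hx0 : 0 < x := Real.exp_pos _
    have hax : Real.exp (L + α) * (1 - x) ≤ a := by
      have e : Real.exp (L + α) * x = 1 := by rw [hxd, ← Real.exp_add]; simp
      have := Nat.lt_floor_add_one (Real.exp (L + α))
      rw [mul_sub, e]
      rw [← ha] at this
      linarith
    have h5 := Real.log_le_log (by have := Real.exp_pos (L + α); apply mul_pos this; linarith) hax
    rw [Real.log_mul (Real.exp_pos _).ne' (by linarith), Real.log_exp] at h5
    have h6 := Real.one_sub_inv_le_log_of_pos (x := 1 - x) (by linarith)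
    have h7 : (1 - x)⁻¹ ≤ 1 + 2 * x := by
      rw [inv_le_iff_one_le_mul₀ (by linarith)]
      nlinarith
    linarith
  linarith

lemma mainM_ge {φ : ℝ → ℝ} (hφ : Cut φ) {α β L : ℝ} (hα : 0 ≤ α) (hαβ : α ≤ β) (hβ : β ≤ 1)
    (hs : ∀ u, α ≤ u → u ≤ β → φ u = 1) (hL : 0 ≤ L) :
    L ^ 3 * (β - α - Real.exp (-L)) ≤ mainM φ L := by
  set a := ⌊Real.exp (L + α)⌋₊ with ha
  set b := ⌊Real.exp (L + β)⌋₊ with hb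
  have hab : a ≤ b := Nat.floor_le_floor (Real.exp_le_exp.2 (by linarith))
  have h1 : ∑ n ∈ Finset.Ioc a b, L ^ 3 * ((1:ℝ) / n) ≤ mainM φ L := by
    rw [mainM]
    calc _ ≤ ∑ n ∈ Finset.Ioc a b, wt φ L n := by
          apply Finset.sum_le_sum
          intro n hn
          rw [Finset.mem_Ioc] at hn
          have hn0 : (0:ℝ) < n := by exact_mod_cast (by omega : 0 < n)
          have h2 : L + α ≤ Real.log n := by
            rw [Real.le_log_iff_exp_le hn0]
            exact ((Nat.floor_lt (Real.exp_pos _).le).1 hn.1).le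
          have h3 : Real.log n ≤ L + β := by
            rw [Real.log_le_iff_le_exp hn0]
            exact (Nat.le_floor_iff (Real.exp_pos _).le).1 hn.2
          rw [wt, hs _ (by linarith) (by linarith), mul_one, div_eq_mul_one_div (Real.log n ^ 3)]
          gcongr
          linarith
      _ ≤ _ := by
          apply Finset.sum_le_sum_of_subset_of_nonneg
          · apply Finset.Ioc_subset_Ioc (Nat.zero_le _)
            exact Nat.floor_le_floor (Real.exp_le_exp.2 (by linarith))
          · intro n _ _
            exact wt_nonneg hφ L n
  rw [← Finset.mul_sum] at h1
  refine le_trans (mul_le_mul_of_nonneg_left ?_ (pow_nonneg hL 3)) h1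
  refine le_trans ?_ (harm_lower hab)
  have h3 : L + β ≤ Real.log (b + 1) := by
    rw [Real.le_log_iff_exp_le (by positivity)]
    exact (Nat.lt_floor_add_one _).le
  have h4 : Real.log (a + 1) ≤ L + α + Real.exp (-L) := by
    rw [Real.log_le_iff_le_exp (by positivity), Real.exp_add]
    have h5 : (a:ℝ) ≤ Real.exp (L + α) := Nat.floor_le (Real.exp_pos _).le
    have h6 := Real.add_one_le_exp (Real.exp (-L))
    have h7 : 1 ≤ Real.exp (L + α) * Real.exp (-L) := by
      rw [← Real.exp_add]; exact Real.one_le_exp (by linarith)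
    have := mul_le_mul_of_nonneg_left h6 (Real.exp_pos (L+α)).le
    linarith
  linarith

end SW

namespace SW
open MeasureTheory Set Filter Topology
open scoped ContDiff ArithmeticFunction.vonMangoldt

/-- counting function -/
noncomputable def cntP (q a : ℕ) (x : ℝ) : ℝ :=
  ∑ n ∈ Finset.Ioc 0 ⌊x⌋₊, if (n.Prime ∧ n % q = a) then (1:ℝ) else 0

lemma cntP_sub (q a : ℕ) {L h : ℝ} (hh : 0 ≤ h) :
    cntP q a (Real.exp (L + h)) - cntP q a (Real.exp L) =
      ∑ n ∈ Finset.Ioc ⌊Real.exp L⌋₊ ⌊Real.exp (L + h)⌋₊, if (n.Prime ∧ n % q = a) then (1:ℝ) else 0 := by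
  rw [cntP, cntP, sub_eq_iff_eq_add', Finset.sum_Ioc_consecutive _ (Nat.zero_le _)]
  exact Nat.floor_le_floor (Real.exp_le_exp.2 (by linarith))

lemma mem_window {L h : ℝ} {n : ℕ} (hn : 0 < n) :
    n ∈ Finset.Ioc ⌊Real.exp L⌋₊ ⌊Real.exp (L + h)⌋₊ ↔ L < Real.log n ∧ Real.log n ≤ L + h := by
  have hn0 : (0:ℝ) < n := by exact_mod_cast hn
  rw [Finset.mem_Ioc, Nat.floor_lt (Real.exp_pos _).le, Nat.le_floor_iff (Real.exp_pos _).le,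
    Real.lt_log_iff_exp_lt hn0, Real.log_le_iff_le_exp hn0]

lemma count_le {φ : ℝ → ℝ} (hφ : Cut φ) (q a : ℕ) {L h : ℝ} (hh : 0 ≤ h) (hh1 : h ≤ 1) (hL : 0 < L)
    (h1 : ∀ u, 0 ≤ u → u ≤ h → φ u = 1) :
    cntP q a (Real.exp (L + h)) - cntP q a (Real.exp L) ≤
      Real.exp (L + h) / L ^ 4 * primeT φ L q a := by
  rw [cntP_sub q a hh, primeT, Finset.sum_filter, Finset.mul_sum]
  have hsub : Finset.Ioc ⌊Real.exp L⌋₊ ⌊Real.exp (L + h)⌋₊ ⊆ Finset.Ioc 0 ⌊Real.exp (L + 1)⌋₊ :=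
    Finset.Ioc_subset_Ioc (Nat.zero_le _) (Nat.floor_le_floor (Real.exp_le_exp.2 (by linarith)))
  have hnn : ∀ n : ℕ, 0 ≤ Real.exp (L + h) / L ^ 4 *
      (if (n.Prime ∧ n % q = a) then Real.log n * wt φ L n else 0) := by
    intro n
    have := wt_nonneg hφ L n
    have := Real.log_natCast_nonneg n
    split_ifs <;> positivity
  refine le_trans ?_ (Finset.sum_le_sum_of_subset_of_nonneg hsub fun n _ _ => hnn n)
  apply Finset.sum_le_sum
  intro n hn
  by_cases hc : n.Prime ∧ n % q = a
  · rw [if_pos hc, if_pos hc]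
    have hn0 : (0:ℝ) < n := by exact_mod_cast hc.1.pos
    have hw := (mem_window hc.1.pos).1 hn
    rw [wt, h1 _ (by linarith) (by linarith), mul_one]
    have h4 : (n:ℝ) ≤ Real.exp (L + h) := by rw [← Real.log_le_iff_le_exp hn0]; exact hw.2
    have e : Real.exp (L + h) / L ^ 4 * (Real.log n * (Real.log n ^ 3 / n)) =
        (Real.exp (L + h) / n) * (Real.log n ^ 4 / L ^ 4) := by
      field_simp
    rw [e]
    apply one_le_mul_of_one_le_of_one_le
    · rwa [one_le_div hn0]
    · rw [one_le_div (by positivity)]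
      exact pow_le_pow_left₀ hL.le hw.1.le 4
  · rw [if_neg hc, if_neg hc, mul_zero]

lemma le_count {φ : ℝ → ℝ} (hφ : Cut φ) (q a : ℕ) {L h : ℝ} (hh : 0 ≤ h) (hL : 0 < L)
    (h1 : ∀ u, φ u ≠ 0 → 0 < u ∧ u < h) :
    Real.exp L / (L + h) ^ 4 * primeT φ L q a ≤
    cntP q a (Real.exp (L + h)) - cntP q a (Real.exp L) := by
  rw [cntP_sub q a hh, primeT, Finset.sum_filter, Finset.mul_sum]
  have hLh : 0 < L + h := by linarith
  calc _ ≤ ∑ n ∈ Finset.Ioc 0 ⌊Real.exp (L + 1)⌋₊,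
        if n ∈ Finset.Ioc ⌊Real.exp L⌋₊ ⌊Real.exp (L + h)⌋₊ then
          (if (n.Prime ∧ n % q = a) then (1:ℝ) else 0) else 0 := by
        apply Finset.sum_le_sum
        intro n hn
        by_cases hc : n.Prime ∧ n % q = a
        · simp only [if_pos hc]
          have hn0 : (0:ℝ) < n := by exact_mod_cast hc.1.pos
          by_cases h0 : φ (Real.log n - L) = 0
          · rw [wt, h0, mul_zero, mul_zero, mul_zero]
            split_ifs <;> norm_num
          · have h2 := h1 _ h0
            rw [if_pos ((mem_window hc.1.pos).2 ⟨by linarith, by linarith⟩)]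
            have h4 : Real.exp L ≤ n := by rw [← Real.le_log_iff_exp_le hn0]; linarith
            have e : Real.exp L / (L + h) ^ 4 * (Real.log n * wt φ L n) =
              (Real.exp L / n) * (Real.log n ^ 4 / (L + h) ^ 4) * φ (Real.log n - L) := by
              rw [wt]; field_simp
            rw [e]
            have hl := Real.log_natCast_nonneg n
            have h5 : Real.exp L / n ≤ 1 := by rwa [div_le_one hn0]
            have h6 : Real.log n ^ 4 / (L + h) ^ 4 ≤ 1 := by
              rw [div_le_one (by positivity)]
              exact pow_le_pow_left₀ hl (by linarith) 4
            apply mul_le_one₀ _ (hφ.nonneg _) (hφ.le_one _)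
            exact mul_le_one₀ h5 (by positivity) h6
        · simp only [if_neg hc, mul_zero, ite_self, le_refl]
    _ ≤ _ := by
        rw [← Finset.sum_filter]
        apply Finset.sum_le_sum_of_subset_of_nonneg
        · intro n hn
          exact (Finset.mem_filter.1 hn).2
        · intro n _ _
          split_ifs <;> norm_num

lemma log_inv_integrable {a b : ℝ} (ha : 1 < a) (hab : a ≤ b) :
    IntervalIntegrable (fun t : ℝ => 1 / Real.log t) volume a b := by
  apply ContinuousOn.intervalIntegrable
  rw [uIcc_of_le hab]
  apply ContinuousOn.div continuousOn_const
  · apply Real.continuousOn_log.mono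
    intro x hx
    have := hx.1
    simp only [mem_compl_iff, mem_singleton_iff]
    linarith
  · intro x hx
    exact (Real.log_pos (ha.trans_le hx.1)).ne'

lemma integral_bounds {L h : ℝ} (hL : 0 < L) (hh : 0 ≤ h) :
    Real.exp L * (Real.exp h - 1) / (L + h) ≤ ∫ t in (Real.exp L)..(Real.exp (L + h)), 1 / Real.log t ∧
    ∫ t in (Real.exp L)..(Real.exp (L + h)), 1 / Real.log t ≤ Real.exp L * (Real.exp h - 1) / L := by
  have h1 : 1 < Real.exp L := Real.one_lt_exp_iff.2 hL
  have hle : Real.exp L ≤ Real.exp (L + h) := Real.exp_le_exp.2 (by linarith)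
  have h_integ := log_inv_integrable h1 hle
  have hb : ∀ t ∈ Icc (Real.exp L) (Real.exp (L + h)), L ≤ Real.log t ∧ Real.log t ≤ L + h := by
    intro t ht
    have ht0 : 0 < t := by linarith [ht.1]
    rw [Real.le_log_iff_exp_le ht0, Real.log_le_iff_le_exp ht0]
    exact ht
  constructor
  · have := intervalIntegral.integral_mono_on hle (intervalIntegrable_const (c := 1 / (L + h))) h_integ
      (fun t ht => one_div_le_one_div_of_le (by linarith [(hb t ht).1]) (hb t ht).2)
    rw [intervalIntegral.integral_const, smul_eq_mul] at this
    refine le_trans (le_of_eq ?_) this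
    rw [Real.exp_add]; ring
  · have := intervalIntegral.integral_mono_on hle h_integ (intervalIntegrable_const (c := 1 / L))
      (fun t ht => one_div_le_one_div_of_le hL (hb t ht).1)
    rw [intervalIntegral.integral_const, smul_eq_mul] at this
    refine le_trans this (le_of_eq ?_)
    rw [Real.exp_add]; ring

lemma cut_bump {c r R : ℝ} (hr : 0 < r) (hrR : r < R) (hc : |c| + R ≤ 1) : ∃ φ, Cut φ ∧
    (∀ u, |u - c| ≤ r → φ u = 1) ∧ ∀ u, φ u ≠ 0 → |u - c| < R := by
  set b : ContDiffBump c := ⟨r, R, hr, hrR⟩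
  refine ⟨b, ⟨b.contDiff, fun u => b.nonneg, fun u => b.le_one, ?_⟩, ?_, ?_⟩
  · intro u hu
    apply b.zero_of_le_dist
    rw [Real.dist_eq]
    change R ≤ _
    have := abs_sub_abs_le_abs_sub u c
    linarith
  · intro u hu
    apply b.one_of_mem_closedBall
    rw [Metric.mem_closedBall, Real.dist_eq]
    exact hu
  · intro u hu
    by_contra hlt
    push Not at hlt
    apply hu
    apply b.zero_of_le_dist
    rw [Real.dist_eq]
    exact hlt

lemma err_le {C L : ℝ} {q : ℕ} (hC : 0 ≤ C) (hL : 0 < L) (hq : 1 ≤ q) (hqL : (q:ℝ) < 2 * L ^ 2) :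
    C * (q:ℝ) ^ (1/4:ℝ) * (q - 1) ≤ 4 * C * L ^ (-(1/2) : ℝ) * L ^ 3 := by
  have hq1 : (1:ℝ) ≤ q := by exact_mod_cast hq
  have h1 : (q:ℝ) ^ (1/4:ℝ) * (q - 1) ≤ (q:ℝ) ^ (5/4:ℝ) := by
    calc (q:ℝ) ^ (1/4:ℝ) * (q - 1) ≤ (q:ℝ) ^ (1/4:ℝ) * (q:ℝ) ^ (1:ℝ) := by
          rw [Real.rpow_one]; gcongr; linarith
      _ = _ := by rw [← Real.rpow_add (by linarith)]; norm_num
  have h2 : (q:ℝ) ^ (5/4:ℝ) ≤ (2 * L ^ 2) ^ (5/4:ℝ) := by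
    apply Real.rpow_le_rpow (by linarith) hqL.le (by norm_num)
  have h3 : (2 * L ^ 2) ^ (5/4:ℝ) ≤ 4 * (L ^ (-(1/2) : ℝ) * L ^ 3) := by
    rw [Real.mul_rpow (by norm_num) (by positivity)]
    have e1 : (L ^ 2) ^ (5/4:ℝ) = L ^ (-(1/2) : ℝ) * L ^ 3 := by
      rw [← Real.rpow_natCast L 2, ← Real.rpow_natCast L 3, ← Real.rpow_mul hL.le, ← Real.rpow_add hL]
      norm_num
    rw [e1]
    have e2 : (2:ℝ) ^ (5/4:ℝ) ≤ 4 := by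
      calc (2:ℝ) ^ (5/4:ℝ) ≤ (2:ℝ) ^ (2:ℝ) := Real.rpow_le_rpow_of_exponent_le (by norm_num) (by norm_num)
        _ = 4 := by norm_num
    gcongr
  calc _ = C * ((q:ℝ) ^ (1/4:ℝ) * (q - 1)) := by ring
    _ ≤ C * (4 * (L ^ (-(1/2) : ℝ) * L ^ 3)) := mul_le_mul_of_nonneg_left (h1.trans (h2.trans h3)) hC
    _ = _ := by ring

lemma tendsto_inv_const (a : ℝ) : Tendsto (fun L : ℝ => a / L) atTop (𝓝 0) :=
  tendsto_const_nhds.div_atTop tendsto_id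

lemma tendsto_rpow_half (C : ℝ) : Tendsto (fun L : ℝ => 4 * C * L ^ (-(1/2) : ℝ)) atTop (𝓝 0) := by
  have := (tendsto_rpow_neg_atTop (show (0:ℝ) < 1/2 by norm_num)).const_mul (4 * C)
  rwa [mul_zero] at this

lemma log_q_le : ∀ᶠ L : ℝ in atTop, ∀ q : ℕ, 1 ≤ q → (q:ℝ) < 2 * L ^ 2 → Real.log q ≤ L - 1 := by
  have h := (Real.tendsto_pow_mul_exp_neg_atTop_nhds_zero 2).const_mul (2 * Real.exp 1)
  rw [mul_zero] at h
  filter_upwards [h.eventually (ge_mem_nhds (show (0:ℝ) < 1 by norm_num))] with L hL q hq hqL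
  have hq0 : (0:ℝ) < q := by exact_mod_cast hq
  rw [Real.log_le_iff_le_exp hq0]
  have e : 2 * Real.exp 1 * (L ^ 2 * Real.exp (-L)) = 2 * L ^ 2 * Real.exp (-(L - 1)) := by
    rw [show -(L-1) = 1 + -L by ring, Real.exp_add]; ring
  rw [e, Real.exp_neg, mul_inv_le_iff₀ (Real.exp_pos _), one_mul] at hL
  linarith

end SW

namespace SW
open MeasureTheory Set Filter Topology

lemma window_upper {ε h : ℝ} (hε : 0 < ε) (hε1 : ε ≤ 1) (hh : h = ε / 8) : ∀ᶠ L : ℝ in atTop,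
    ∀ q : ℕ, q.Prime → (q:ℝ) < 2 * L ^ 2 → ∀ a : ℕ, 0 < a → a < q →
    (cntP q a (Real.exp (L + h)) - cntP q a (Real.exp L)) * (q - 1) ≤
      (1 + ε) * ∫ t in (Real.exp L)..(Real.exp (L + h)), 1 / Real.log t := by
  have hh0 : 0 < h := by rw [hh]; positivity
  have hh1 : h ≤ 1/8 := by rw [hh]; linarith
  set η := h * ε / 8 with hη
  have hη0 : 0 < η := by positivity
  have hη1 : η ≤ 1/8 := by
    rw [hη]
    have : h * ε ≤ 1/8 * 1 := by gcongr
    linarith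
  obtain ⟨φ, hφ, hφ1, hφ2⟩ := cut_bump (c := h/2) (r := h/2) (R := h/2 + η) (by linarith)
    (by linarith) (by rw [abs_of_pos (by linarith)]; linarith)
  obtain ⟨C, hC, hpr⟩ := smooth_primes hφ
  have hexp : Real.exp h ≤ 1 + h + h ^ 2 := by
    have := Real.abs_exp_sub_one_sub_id_le (x := h) (by rw [abs_of_pos hh0]; linarith)
    have := (abs_le.1 this).2
    linarith
  have hlim : Tendsto (fun L : ℝ => Real.exp h * ((1 + h / L) * ((1 + (h + η) / L) ^ 3 *
      (h + 2 * η + 2 * Real.exp (-(L - η))) + 4 * C * L ^ (-(1/2) : ℝ)))) atTop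
      (𝓝 (Real.exp h * ((1 + 0) * ((1 + 0) ^ 3 * (h + 2 * η + 2 * 0) + 0)))) := by
    refine ((tendsto_const_nhds.add (tendsto_inv_const h)).mul
      (((((tendsto_const_nhds.add (tendsto_inv_const _)).pow 3).mul
      (tendsto_const_nhds.add (Tendsto.const_mul _ ?_)))).add (tendsto_rpow_half C))).const_mul _
    exact Real.tendsto_exp_neg_atTop_nhds_zero.comp
      (tendsto_atTop_add_const_right _ (-η) tendsto_id)
  have hlt : Real.exp h * ((1 + 0) * ((1 + 0) ^ 3 * (h + 2 * η + 2 * 0) + 0)) < (1 + ε) * h := by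
    have e : Real.exp h * ((1 + 0) * ((1 + 0) ^ 3 * (h + 2 * η + 2 * 0) + 0)) =
        Real.exp h * (1 + ε / 4) * h := by rw [hη]; ring
    rw [e]
    apply mul_lt_mul_of_pos_right _ hh0
    calc Real.exp h * (1 + ε / 4) ≤ (1 + h + h ^ 2) * (1 + ε / 4) := by gcongr
      _ < 1 + ε := by
        rw [hh]
        nlinarith [mul_pos hε hε, mul_pos (mul_pos hε hε) hε, mul_nonneg hε.le (sub_nonneg.2 hε1),
          mul_nonneg (mul_pos hε hε).le (sub_nonneg.2 hε1)]
  filter_upwards [hpr, log_q_le, hlim.eventually (gt_mem_nhds hlt), eventually_ge_atTop 2]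
    with L hL hlog hU hL2 q hq hqL a ha haq
  have hL0 : 0 < L := by linarith
  have h1 := hL q hq (hlog q hq.one_le hqL) a ha haq
  have hq1 : (0:ℝ) < q - 1 := by
    have : (2:ℝ) ≤ q := by exact_mod_cast hq.two_le
    linarith
  have h2 := count_le hφ q a hh0.le (by linarith) hL0 (fun u hu1 hu2 => hφ1 u (by
    rw [abs_le]; constructor <;> linarith))
  have h3 := mainM_le hφ (α := -η) (β := h + η) (L := L) (by linarith) (fun u hu => by
    have := abs_lt.1 (hφ2 u hu)
    constructor <;> linarith [this.1, this.2]) (by linarith)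
  have h4 := err_le hC hL0 hq.one_le hqL
  have h5 := (abs_le.1 h1).2
  have h6 : primeT φ L q a * (q - 1) ≤ mainM φ L + 4 * C * L ^ (-(1/2) : ℝ) * L ^ 3 := by
    have e : mainM φ L / (q - 1) * (q - 1) = mainM φ L := by field_simp
    have := mul_le_mul_of_nonneg_right h5 hq1.le
    rw [sub_mul, e] at this
    linarith
  have hI := (integral_bounds hL0 hh0.le).1
  have hA : 0 < Real.exp L / (L + h) := by positivity
  have hB : 0 < Real.exp (L + h) / L ^ 4 := by positivity
  calc _ ≤ Real.exp (L + h) / L ^ 4 * primeT φ L q a * (q - 1) := by gcongr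
    _ = Real.exp (L + h) / L ^ 4 * (primeT φ L q a * (q - 1)) := by ring
    _ ≤ Real.exp (L + h) / L ^ 4 * ((L + (h + η)) ^ 3 * (h + η - -η + 2 * Real.exp (-(L + -η))) +
          4 * C * L ^ (-(1/2) : ℝ) * L ^ 3) := by
        apply mul_le_mul_of_nonneg_left _ hB.le
        linarith
    _ = Real.exp L / (L + h) * (Real.exp h * ((1 + h / L) * ((1 + (h + η) / L) ^ 3 *
      (h + 2 * η + 2 * Real.exp (-(L - η))) + 4 * C * L ^ (-(1/2) : ℝ)))) := by
        rw [Real.exp_add, show -(L + -η) = -(L - η) by ring]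
        have : L + h ≠ 0 := by positivity
        field_simp
        ring
    _ ≤ Real.exp L / (L + h) * ((1 + ε) * h) := by gcongr
    _ ≤ (1 + ε) * (Real.exp L * (Real.exp h - 1) / (L + h)) := by
        have : h ≤ Real.exp h - 1 := by linarith [Real.add_one_le_exp h]
        calc Real.exp L / (L + h) * ((1 + ε) * h) = Real.exp L / (L + h) * (1 + ε) * h := by ring
          _ ≤ Real.exp L / (L + h) * (1 + ε) * (Real.exp h - 1) := by gcongr
          _ = _ := by ring
    _ ≤ _ := by gcongr

lemma window_lower {ε h : ℝ} (hε : 0 < ε) (hε1 : ε ≤ 1) (hh : h = ε / 8) : ∀ᶠ L : ℝ in atTop,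
    ∀ q : ℕ, q.Prime → (q:ℝ) < 2 * L ^ 2 → ∀ a : ℕ, 0 < a → a < q →
    (1 - ε) * ∫ t in (Real.exp L)..(Real.exp (L + h)), 1 / Real.log t ≤
    (cntP q a (Real.exp (L + h)) - cntP q a (Real.exp L)) * (q - 1) := by
  have hh0 : 0 < h := by rw [hh]; positivity
  have hh1 : h ≤ 1/8 := by rw [hh]; linarith
  set η := h * ε / 8 with hη
  have hη0 : 0 < η := by positivity
  have hη1 : η ≤ h / 8 := by
    rw [hη]
    have : h * ε ≤ h * 1 := by gcongr
    linarith
  obtain ⟨φ, hφ, hφ1, hφ2⟩ := cut_bump (c := h/2) (r := h/2 - η) (R := h/2) (by linarith)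
    (by linarith) (by rw [abs_of_pos (by linarith)]; linarith)
  obtain ⟨C, hC, hpr⟩ := smooth_primes hφ
  have hexp : Real.exp h ≤ 1 + h + h ^ 2 := by
    have := Real.abs_exp_sub_one_sub_id_le (x := h) (by rw [abs_of_pos hh0]; linarith)
    have := (abs_le.1 this).2
    linarith
  have hlim : Tendsto (fun L : ℝ => (1 / (1 + h / L)) ^ 4 *
      (h - 2 * η - Real.exp (-L) - 4 * C * L ^ (-(1/2) : ℝ))) atTop
      (𝓝 ((1 / (1 + 0)) ^ 4 * (h - 2 * η - 0 - 0))) := by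
    refine ((tendsto_const_nhds.div (tendsto_const_nhds.add (tendsto_inv_const h)) (by norm_num)).pow 4).mul
      ((tendsto_const_nhds.sub Real.tendsto_exp_neg_atTop_nhds_zero).sub (tendsto_rpow_half C))
  have hlt : (1 - ε) * (Real.exp h - 1) < (1 / (1 + 0)) ^ 4 * (h - 2 * η - 0 - 0) := by
    have e : (1 / (1 + 0)) ^ 4 * (h - 2 * η - 0 - 0) = (1 - ε / 4) * h := by rw [hη]; ring
    rw [e]
    calc (1 - ε) * (Real.exp h - 1) ≤ (1 - ε) * (h + h ^ 2) := by gcongr <;> linarith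
      _ = (1 - ε) * (1 + h) * h := by ring
      _ < (1 - ε / 4) * h := by
        apply mul_lt_mul_of_pos_right _ hh0
        rw [hh]
        nlinarith
  filter_upwards [hpr, log_q_le, hlim.eventually (lt_mem_nhds hlt), eventually_ge_atTop 2]
    with L hL hlog hU hL2 q hq hqL a ha haq
  have hL0 : 0 < L := by linarith
  have h1 := hL q hq (hlog q hq.one_le hqL) a ha haq
  have hq1 : (0:ℝ) < q - 1 := by
    have : (2:ℝ) ≤ q := by exact_mod_cast hq.two_le
    linarith
  have h2 := le_count hφ q a hh0.le hL0 (fun u hu => by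
    have := abs_lt.1 (hφ2 u hu)
    constructor <;> linarith [this.1, this.2])
  have h3 := mainM_ge hφ (α := η) (β := h - η) (L := L) hη0.le (by linarith) (by linarith)
    (fun u hu1 hu2 => hφ1 u (by rw [abs_le]; constructor <;> linarith)) hL0.le
  have h4 := err_le hC hL0 hq.one_le hqL
  have h5 := (abs_le.1 h1).1
  have h6 : mainM φ L - 4 * C * L ^ (-(1/2) : ℝ) * L ^ 3 ≤ primeT φ L q a * (q - 1) := by
    have e : mainM φ L / (q - 1) * (q - 1) = mainM φ L := by field_simp
    have := mul_le_mul_of_nonneg_right h5 hq1.le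
    rw [sub_mul, e] at this
    linarith
  have hI := (integral_bounds hL0 hh0.le).2
  have hA : 0 < Real.exp L / L := by positivity
  have hB : 0 < Real.exp L / (L + h) ^ 4 := by positivity
  calc _ ≤ (1 - ε) * (Real.exp L * (Real.exp h - 1) / L) := by gcongr
    _ = Real.exp L / L * ((1 - ε) * (Real.exp h - 1)) := by ring
    _ ≤ Real.exp L / L * ((1 / (1 + h / L)) ^ 4 *
      (h - 2 * η - Real.exp (-L) - 4 * C * L ^ (-(1/2) : ℝ))) := by gcongr
    _ = Real.exp L / (L + h) ^ 4 * (L ^ 3 * (h - η - η - Real.exp (-L)) -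
          4 * C * L ^ (-(1/2) : ℝ) * L ^ 3) := by
        have : L + h ≠ 0 := by positivity
        field_simp
        ring
    _ ≤ Real.exp L / (L + h) ^ 4 * (primeT φ L q a * (q - 1)) := by
        apply mul_le_mul_of_nonneg_left _ hB.le
        linarith
    _ = Real.exp L / (L + h) ^ 4 * primeT φ L q a * (q - 1) := by ring
    _ ≤ _ := by gcongr

end SW

namespace SW
open MeasureTheory Set Filter Topology

/-- discrepancy -/
noncomputable def dis (q a : ℕ) (L : ℝ) : ℝ :=
  cntP q a (Real.exp L) * (q - 1) - ∫ t in (2:ℝ)..(Real.exp L), 1 / Real.log t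

lemma two_le_exp {L : ℝ} (hL : 1 ≤ L) : 2 ≤ Real.exp L := by
  linarith [Real.add_one_le_exp L]

lemma li_add {L M : ℝ} (hL : 1 ≤ L) (hLM : L ≤ M) :
    ∫ t in (Real.exp L)..(Real.exp M), 1 / Real.log t =
    (∫ t in (2:ℝ)..(Real.exp M), 1 / Real.log t) - ∫ t in (2:ℝ)..(Real.exp L), 1 / Real.log t := by
  have h := intervalIntegral.integral_add_adjacent_intervals
    (log_inv_integrable (by norm_num : (1:ℝ) < 2) (two_le_exp hL))
    (log_inv_integrable (a := Real.exp L) (b := Real.exp M) (by linarith [two_le_exp hL])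
      (Real.exp_le_exp.2 hLM))
  linarith

lemma telescope {ε h : ℝ} (hε : 0 < ε) (hε1 : ε ≤ 1) (hh : h = ε / 8) : ∃ L₀ : ℝ, 1 ≤ L₀ ∧
    ∀ q : ℕ, q.Prime → ∀ a : ℕ, 0 < a → a < q → ∀ k : ℕ, ∀ Y : ℝ, L₀ ≤ Y → (q:ℝ) < 2 * Y ^ 2 →
    |dis q a (Y + k * h) - dis q a Y| ≤ ε * ((∫ t in (2:ℝ)..(Real.exp (Y + k * h)), 1 / Real.log t) -
      ∫ t in (2:ℝ)..(Real.exp Y), 1 / Real.log t) := by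
  obtain ⟨L₁, hL₁⟩ := eventually_atTop.1 ((window_upper hε hε1 hh).and (window_lower hε hε1 hh))
  have hh0 : 0 < h := by rw [hh]; positivity
  refine ⟨max 1 L₁, le_max_left _ _, ?_⟩
  intro q hq a ha haq k Y hY hqY
  have hY1 : 1 ≤ Y := (le_max_left _ _).trans hY
  have hY2 : L₁ ≤ Y := (le_max_right _ _).trans hY
  induction k with
  | zero => simp
  | succ k ih =>
    set Z := Y + k * h with hZ
    have hZY : Y ≤ Z := by rw [hZ]; have : 0 ≤ k * h := by positivity
                           linarith
    have e : Y + (k + 1 : ℕ) * h = Z + h := by rw [hZ]; push_cast; ring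
    rw [e]
    have hqZ : (q:ℝ) < 2 * Z ^ 2 := by
      refine hqY.trans_le ?_
      have : Y ^ 2 ≤ Z ^ 2 := pow_le_pow_left₀ (by linarith) hZY 2
      linarith
    obtain ⟨hu, hl⟩ := hL₁ Z (hY2.trans hZY)
    have hu := hu q hq hqZ a ha haq
    have hl := hl q hq hqZ a ha haq
    rw [li_add (hY1.trans hZY) (by linarith)] at hu hl
    have hstep : |dis q a (Z + h) - dis q a Z| ≤ ε * ((∫ t in (2:ℝ)..(Real.exp (Z + h)), 1 / Real.log t) -
        ∫ t in (2:ℝ)..(Real.exp Z), 1 / Real.log t) := by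
      rw [abs_le, dis, dis]
      constructor <;> linarith
    have := abs_sub_le (dis q a (Z + h)) (dis q a Z) (dis q a Y)
    linarith

lemma cntP_nonneg (q a : ℕ) (x : ℝ) : 0 ≤ cntP q a x :=
  Finset.sum_nonneg fun n _ => by split_ifs <;> norm_num

lemma cntP_le (q a : ℕ) {x : ℝ} (hx : 0 ≤ x) : cntP q a x ≤ x := by
  calc cntP q a x ≤ ∑ n ∈ Finset.Ioc 0 ⌊x⌋₊, (1:ℝ) :=
        Finset.sum_le_sum fun n _ => by split_ifs <;> norm_num
    _ = ⌊x⌋₊ := by simp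
    _ ≤ x := Nat.floor_le hx

lemma li_bounds {x : ℝ} (hx : 2 ≤ x) :
    (x - 2) / Real.log x ≤ ∫ t in (2:ℝ)..x, 1 / Real.log t ∧
    ∫ t in (2:ℝ)..x, 1 / Real.log t ≤ 2 * x := by
  have h_integ := log_inv_integrable (by norm_num : (1:ℝ) < 2) hx
  have hl2 : 1/2 < Real.log 2 := by linarith [Real.log_two_gt_d9]
  constructor
  · have := intervalIntegral.integral_mono_on hx (intervalIntegrable_const (c := 1 / Real.log x)) h_integ
      (fun t ht => one_div_le_one_div_of_le (Real.log_pos (by linarith [ht.1]))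
        (Real.log_le_log (by linarith [ht.1]) ht.2))
    rw [intervalIntegral.integral_const, smul_eq_mul] at this
    refine le_trans (le_of_eq ?_) this
    ring
  · have := intervalIntegral.integral_mono_on hx h_integ (intervalIntegrable_const (c := 2))
      (fun t ht => by
        have h3 := Real.log_le_log (by norm_num) ht.1
        rw [div_le_iff₀ (by linarith)]
        linarith)
    rw [intervalIntegral.integral_const, smul_eq_mul] at this
    linarith

lemma main_dis {ε : ℝ} (hε : 0 < ε) (hε1 : ε ≤ 1) : ∀ᶠ X : ℝ in atTop, ∀ q : ℕ, q.Prime →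
    (q:ℝ) < X ^ 2 → ∀ a : ℕ, 0 < a → a < q →
    |dis q a X| ≤ 2 * ε * ∫ t in (2:ℝ)..(Real.exp X), 1 / Real.log t := by
  obtain ⟨L₀, hL₀, htel⟩ := telescope hε hε1 rfl
  set h := ε / 8 with hh
  have hh0 : 0 < h := by positivity
  have hh1 : h ≤ 1 := by rw [hh]; linarith
  have hlog : ∀ᶠ X : ℝ in atTop, Real.log X ≤ 1/32 * X := by
    have := Real.isLittleO_log_id_atTop.bound (show (0:ℝ) < 1/32 by norm_num)
    filter_upwards [this, eventually_ge_atTop 1] with X hX hX1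
    rw [Real.norm_eq_abs, Real.norm_eq_abs, id, abs_of_pos (by linarith : 0 < X)] at hX
    exact (le_abs_self _).trans hX
  filter_upwards [hlog, eventually_ge_atTop (2 * L₀), eventually_ge_atTop 8,
    eventually_ge_atTop (4 / ε)] with X hX hXL hX8 hXε q hq hqX a ha haq
  have hX0 : 0 < X := by linarith
  have hlX : 0 ≤ Real.log X := Real.log_nonneg (by linarith)
  set k := ⌈4 * Real.log X / h⌉₊ with hk
  have hk1 : 4 * Real.log X ≤ k * h := by
    rw [← div_le_iff₀ hh0]; exact Nat.le_ceil _
  have hk2 : k * h ≤ 4 * Real.log X + h := by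
    have := (Nat.ceil_lt_add_one (a := 4 * Real.log X / h) (by positivity)).le
    calc (k:ℝ) * h ≤ (4 * Real.log X / h + 1) * h := by gcongr
      _ = _ := by field_simp
  set Y := X - k * h with hY
  have hYX : 3/4 * X ≤ Y := by rw [hY]; linarith
  have hYL : L₀ ≤ Y := by linarith
  have hqY : (q:ℝ) < 2 * Y ^ 2 := by
    have : (3/4 * X) ^ 2 ≤ Y ^ 2 := pow_le_pow_left₀ (by positivity) hYX 2
    nlinarith
  have ht := htel q hq a ha haq k Y hYL hqY
  have eX : Y + k * h = X := by rw [hY]; ring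
  rw [eX] at ht
  have hIY := li_bounds (two_le_exp (hL₀.trans hYL))
  have hIX := li_bounds (two_le_exp (by linarith : 1 ≤ X))
  rw [Real.log_exp] at hIX hIY
  have hIY0 : 0 ≤ ∫ t in (2:ℝ)..(Real.exp Y), 1 / Real.log t := by
    refine le_trans ?_ hIY.1
    have := two_le_exp (hL₀.trans hYL)
    apply div_nonneg <;> linarith
  have hq1 : (1:ℝ) ≤ q := by exact_mod_cast hq.one_le
  have hDY : |dis q a Y| ≤ Real.exp Y * (2 * X ^ 2) := by
    have h1 := cntP_le q a (Real.exp_pos Y).le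
    have h2 := cntP_nonneg q a (Real.exp Y)
    have h3 : cntP q a (Real.exp Y) * (q - 1) ≤ Real.exp Y * X ^ 2 := by
      apply mul_le_mul h1 _ (by linarith) (Real.exp_pos Y).le
      linarith
    have h4 : 0 ≤ cntP q a (Real.exp Y) * (q - 1) := mul_nonneg h2 (by linarith)
    have h5 : 2 * Real.exp Y ≤ Real.exp Y * X ^ 2 := by
      rw [mul_comm]
      apply mul_le_mul_of_nonneg_left _ (Real.exp_pos Y).le
      nlinarith
    have h6 : 0 ≤ Real.exp Y * X ^ 2 := by positivity
    rw [dis, abs_le]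
    constructor <;> linarith
  have hEY : Real.exp Y ≤ Real.exp X / X ^ 4 := by
    rw [le_div_iff₀ (by positivity)]
    have e4 : X ^ 4 = Real.exp (4 * Real.log X) := by
      rw [mul_comm, Real.exp_mul, Real.exp_log hX0]
      norm_cast
    rw [e4, ← Real.exp_add]
    apply Real.exp_le_exp.2
    rw [hY]; linarith
  have hsmall : Real.exp Y * (2 * X ^ 2) ≤ ε * ∫ t in (2:ℝ)..(Real.exp X), 1 / Real.log t := by
    have h4ε : 4 ≤ X * ε := by rwa [div_le_iff₀ hε] at hXε
    calc Real.exp Y * (2 * X ^ 2) ≤ Real.exp X / X ^ 4 * (2 * X ^ 2) := by gcongr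
      _ = Real.exp X / (2 * X ^ 2) * 4 := by field_simp; ring
      _ ≤ Real.exp X / (2 * X ^ 2) * (X * ε) := by gcongr
      _ = ε * ((Real.exp X / 2) / X) := by field_simp
      _ ≤ ε * ((Real.exp X - 2) / X) := by
        gcongr
        have := Real.add_one_le_exp X
        linarith
      _ ≤ _ := by gcongr; exact hIX.1
  have := abs_sub_abs_le_abs_sub (dis q a X) (dis q a Y)
  have h9 : 0 ≤ ε * ∫ t in (2:ℝ)..(Real.exp Y), 1 / Real.log t := by positivity
  linarith

lemma card_eq_cntP (q a : ℕ) {x : ℝ} (hx : 0 ≤ x) :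
    (Nat.card {p : ℕ | p.Prime ∧ (p : ℝ) ≤ x ∧ p % q = a} : ℝ) = cntP q a x := by
  have : {p : ℕ | p.Prime ∧ (p : ℝ) ≤ x ∧ p % q = a} =
      (((Finset.Ioc 0 ⌊x⌋₊).filter fun n => n.Prime ∧ n % q = a : Finset ℕ) : Set ℕ) := by
    ext p
    simp only [Set.mem_setOf_eq, Finset.coe_filter, Finset.mem_Ioc, Nat.le_floor_iff hx]
    constructor
    · rintro ⟨h1, h2, h3⟩
      exact ⟨⟨h1.pos, h2⟩, h1, h3⟩
    · rintro ⟨⟨_, h2⟩, h1, h3⟩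
      exact ⟨h1, h2, h3⟩
  rw [this, Nat.card_coe_set_eq, Set.ncard_coe_finset, cntP, ← Finset.sum_filter, Finset.sum_const,
    nsmul_eq_mul, mul_one]

theorem final (ε : ℝ) (hε : 0 < ε) : ∃ x₀ : ℝ, ∀ x : ℝ, x₀ ≤ x → ∀ Q : ℕ, Q.Prime →
    (Q : ℝ) < (Real.log x) ^ 2 → ∀ a : ℕ, 0 < a → a < Q →
    |(Nat.card {p : ℕ | p.Prime ∧ (p : ℝ) ≤ x ∧ p % Q = a} : ℝ) -
      (∫ t in (2 : ℝ)..x, 1 / Real.log t) / ((Q : ℝ) - 1)| ≤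
      ε * ((∫ t in (2 : ℝ)..x, 1 / Real.log t) / ((Q : ℝ) - 1)) := by
  set δ := min (ε / 2) 1 with hδ
  have hδ0 : 0 < δ := lt_min (by positivity) one_pos
  obtain ⟨X₀, hX₀⟩ := eventually_atTop.1 (main_dis hδ0 (min_le_right _ _))
  refine ⟨max 2 (Real.exp X₀), fun x hx Q hQ hQx a ha haQ => ?_⟩
  have hx2 : 2 ≤ x := (le_max_left _ _).trans hx
  have hx0 : 0 < x := by linarith
  have h := hX₀ (Real.log x) ((Real.le_log_iff_exp_le hx0).2 ((le_max_right _ _).trans hx)) Q hQ hQx a ha haQ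
  rw [dis, Real.exp_log hx0] at h
  rw [card_eq_cntP Q a hx0.le]
  have hq1 : (0:ℝ) < Q - 1 := by
    have : (2:ℝ) ≤ Q := by exact_mod_cast hQ.two_le
    linarith
  have hI0 : 0 ≤ ∫ t in (2:ℝ)..x, 1 / Real.log t := by
    refine le_trans ?_ (li_bounds hx2).1
    exact div_nonneg (by linarith) (Real.log_nonneg (by linarith))
  set I := ∫ t in (2:ℝ)..x, 1 / Real.log t
  have e : cntP Q a x - I / (Q - 1) = (cntP Q a x * (Q - 1) - I) / (Q - 1) := by field_simp
  rw [e, abs_div, abs_of_pos hq1, ← mul_div_assoc]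
  gcongr
  refine h.trans ?_
  gcongr
  have := min_le_left (ε / 2) 1
  linarith

end SW

open Real in
/-- Uniform Siegel–Walfisz type asymptotic: `π(x; q, a) ∼ Li(x)/(q−1)` uniformly over
primes `q < (log x)²` and residues `0 < a < q`, where `π(x; q, a)` counts primes `p ≤ x`
with `p ≡ a (mod q)` and `Li(x) = ∫₂^x dt/log t`. -/
theorem stmt_9 :
    ∀ ε > (0 : ℝ), ∃ x₀ : ℝ, ∀ x : ℝ, x₀ ≤ x →
      ∀ Q : ℕ, Q.Prime → (Q : ℝ) < (Real.log x) ^ 2 →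
        ∀ a : ℕ, 0 < a → a < Q →
          |(Nat.card {p : ℕ | p.Prime ∧ (p : ℝ) ≤ x ∧ p % Q = a} : ℝ) -
              (∫ t in (2 : ℝ)..x, 1 / Real.log t) / ((Q : ℝ) - 1)| ≤
            ε * ((∫ t in (2 : ℝ)..x, 1 / Real.log t) / ((Q : ℝ) - 1)) := by
  intro ε hε
  exact SW.final ε hε
end
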